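/- arXiv:cs/0308001 — 3 statements merged into one kernel-verified Lean document; each statement's English description precedes it below -/
import Mathlib

section
/- Let S be a semi-algebraic subset of ℝⁿ. If S is connected then S is path-connected. -/
open Set

def IsSemialgebraic {n : ℕ} (A : Set (Fin n → ℝ)) : Prop :=
  ∃ (N : ℕ) (E I : Fin N → Finset (MvPolynomial (Fin n) ℝ)),
    A = ⋃ m, {x | (∀ p ∈ E m, MvPolynomial.eval x p = 0) ∧
                  (∀ p ∈ I m, 0 < MvPolynomial.eval x p)}

open Polynomial

/-- The sign of a real function does not depend on the point. -/
def SignConst {I : Type*} (u : I → ℝ) : Prop :=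
  ∀ s t, SignType.sign (u s) = SignType.sign (u t)

theorem SignConst.eq_zero {I : Type*} {u : I → ℝ} (hu : SignConst u) {s : I} (hs : u s = 0)
    (t : I) : u t = 0 := by
  have h := hu t s
  rwa [hs, sign_zero, sign_eq_zero_iff] at h

theorem SignConst.eq_zero_or_ne_zero {I : Type*} {u : I → ℝ} (hu : SignConst u) :
    (∀ t, u t = 0) ∨ ∀ t, u t ≠ 0 := by
  by_cases h : ∃ s, u s = 0
  · obtain ⟨s, hs⟩ := h
    exact Or.inl fun t => hu.eq_zero hs t
  · exact Or.inr (not_exists.mp h)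

theorem forall_lt_of_ne {I : Type*} [TopologicalSpace I] [PreconnectedSpace I] {u v : I → ℝ}
    (hu : Continuous u) (hv : Continuous v) (hne : ∀ t, u t ≠ v t) {t₀ : I} (h₀ : u t₀ < v t₀)
    (t : I) : u t < v t := by
  by_contra! h
  obtain ⟨s, hs⟩ := intermediate_value_univ₂ hu hv h₀.le h
  exact hne s hs

theorem signConst_of_ne_zero {I : Type*} [TopologicalSpace I] [PreconnectedSpace I] {u : I → ℝ}
    (hu : Continuous u) (hne : ∀ t, u t ≠ 0) : SignConst u := by
  intro s t
  rcases lt_or_gt_of_ne (hne s) with h | h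
  · rw [sign_neg h, sign_neg (forall_lt_of_ne hu continuous_const hne h t)]
  · rw [sign_pos h, sign_pos (forall_lt_of_ne continuous_const hu (fun t => (hne t).symm) h t)]

/-- **Thom's lemma**: if a real polynomial and all its derivatives have the same signs at both
endpoints of an interval, then its sign is constant on that interval. -/
theorem Polynomial.sign_eval_eq_of_mem_Icc {u v : ℝ} (p : ℝ[X])
    (h : ∀ k, SignType.sign ((derivative^[k] p).eval u) =
      SignType.sign ((derivative^[k] p).eval v)) :
    ∀ w ∈ Icc u v, SignType.sign (p.eval w) = SignType.sign (p.eval u) := by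
  induction hn : p.natDegree using Nat.strong_induction_on generalizing p with
  | _ n ih =>
  intro w hw
  have huv : u ≤ v := hw.1.trans hw.2
  rcases Nat.eq_zero_or_pos n with rfl | hpos
  · rw [eq_C_of_natDegree_eq_zero hn]; simp
  have hd := ih _ (hn ▸ natDegree_derivative_lt (by omega)) (derivative p)
    (fun k => by simpa only [Function.iterate_succ_apply] using h (k + 1)) rfl
  have h0 : SignType.sign (p.eval u) = SignType.sign (p.eval v) := h 0
  have hu : u ∈ Icc u v := left_mem_Icc.2 huv
  have hv : v ∈ Icc u v := right_mem_Icc.2 huv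
  have hmono : MonotoneOn (fun z => p.eval z) (Icc u v) ∨
      AntitoneOn (fun z => p.eval z) (Icc u v) := by
    rcases le_total 0 ((derivative p).eval u) with hs | hs
    · left
      refine monotoneOn_of_deriv_nonneg (convex_Icc u v) p.continuous.continuousOn
        p.differentiable.differentiableOn fun z hz => ?_
      rw [Polynomial.deriv, ← sign_nonneg_iff, hd z (interior_subset hz)]
      exact sign_nonneg_iff.2 hs
    · right
      refine antitoneOn_of_deriv_nonpos (convex_Icc u v) p.continuous.continuousOn
        p.differentiable.differentiableOn fun z hz => ?_
      rw [Polynomial.deriv, ← sign_nonpos_iff, hd z (interior_subset hz)]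
      exact sign_nonpos_iff.2 hs
  rcases hmono with hm | hm
  · have h1 := SignType.sign.monotone (hm hu hw hw.1)
    have h2 := SignType.sign.monotone (hm hw hv hw.2)
    exact le_antisymm (h2.trans h0.ge) h1
  · have h1 := SignType.sign.monotone (hm hu hw hw.1)
    have h2 := SignType.sign.monotone (hm hw hv hw.2)
    exact le_antisymm h1 (h0.le.trans h2)

theorem Polynomial.eq_zero_of_forall_mem_Icc {u v : ℝ} (huv : u < v) {p : ℝ[X]}
    (h : ∀ w ∈ Icc u v, p.eval w = 0) : p = 0 :=
  p.eq_zero_of_infinite_isRoot ((Icc_infinite huv).mono h)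

/-- A finite family of polynomials with parameter in `I`, closed under differentiation, each member
of which vanishes identically either everywhere or nowhere on `I`. -/
structure IsAdmissible {I : Type*} [TopologicalSpace I] (H : Set (I → ℝ[X])) : Prop where
  finite : H.Finite
  continuous : ∀ h ∈ H, Continuous fun q : I × ℝ => (h q.1).eval q.2
  derivative : ∀ h ∈ H, (fun t => derivative (h t)) ∈ H
  zero_or_ne : ∀ h ∈ H, (∀ t, h t = 0) ∨ ∀ t, h t ≠ 0
  X_sub_one : (fun _ => X - 1) ∈ H
  X_add_one : (fun _ => X + 1) ∈ H

/-- A continuous section along which all members of the family have constant sign. -/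
structure IsSection {I : Type*} [TopologicalSpace I] (H : Set (I → ℝ[X])) (z : I → ℝ) : Prop where
  continuous : Continuous z
  signConst : ∀ h ∈ H, SignConst fun t => (h t).eval (z t)

/-- There is a section through every root in `[-1, 1]` of a nonzero member of the family. -/
def HasRootSections {I : Type*} [TopologicalSpace I] (H : Set (I → ℝ[X])) : Prop :=
  ∀ h ∈ H, (∀ t, h t ≠ 0) → ∀ t₀ z₀, |z₀| ≤ 1 → (h t₀).eval z₀ = 0 →
    ∃ z, IsSection H z ∧ z t₀ = z₀

section Sections

variable {I : Type*} [TopologicalSpace I] {H : Set (I → ℝ[X])}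

theorem IsAdmissible.iterate_derivative (hH : IsAdmissible H) {h : I → ℝ[X]} (hh : h ∈ H) (k : ℕ) :
    (fun t => Polynomial.derivative^[k] (h t)) ∈ H := by
  induction k with
  | zero => exact hh
  | succ k ih => simpa only [Function.iterate_succ_apply'] using hH.derivative _ ih

theorem IsSection.abs_le_one (hH : IsAdmissible H) {z : I → ℝ} (hz : IsSection H z) {t₀ : I}
    (h₀ : |z t₀| ≤ 1) (t : I) : |z t| ≤ 1 := by
  have h1 := hz.signConst _ hH.X_sub_one t t₀
  have h2 := hz.signConst _ hH.X_add_one t t₀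
  rw [abs_le] at h₀ ⊢
  simp only [eval_sub, eval_add, eval_X, eval_one] at h1 h2
  constructor
  · have : 0 ≤ z t + 1 := by
      rw [← sign_nonneg_iff, h2, sign_nonneg_iff]; linarith
    linarith
  · have : z t - 1 ≤ 0 := by
      rw [← sign_nonpos_iff, h1, sign_nonpos_iff]; linarith
    linarith

theorem IsSection.eq_of_meet (hH : IsAdmissible H) {u v : I → ℝ} (hu : IsSection H u)
    (hv : IsSection H v) {s : I} (hs : u s = v s) {g : I → ℝ[X]} (hg : g ∈ H)
    (hg0 : ∀ t, g t ≠ 0) (hroot : ∀ t, (g t).eval (u t) = 0) (t : I) : u t = v t := by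
  have key : ∀ h ∈ H, SignType.sign ((h t).eval (u t)) = SignType.sign ((h t).eval (v t)) := by
    intro h hh
    exact (hu.signConst h hh t s).trans (by simpa only [hs] using hv.signConst h hh s t)
  have key' := fun k => key _ (hH.iterate_derivative hg k)
  have hv0 : (g t).eval (v t) = 0 := by
    have := key g hg
    rwa [hroot, sign_zero, eq_comm, sign_eq_zero_iff] at this
  by_contra hne
  rcases lt_or_gt_of_ne hne with hlt | hlt
  · refine hg0 t (eq_zero_of_forall_mem_Icc hlt fun w hw => ?_)
    have := sign_eval_eq_of_mem_Icc (g t) key' w hw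
    rwa [hroot, sign_zero, sign_eq_zero_iff] at this
  · refine hg0 t (eq_zero_of_forall_mem_Icc hlt fun w hw => ?_)
    have := sign_eval_eq_of_mem_Icc (g t) (fun k => (key' k).symm) w hw
    rwa [hv0, sign_zero, sign_eq_zero_iff] at this

/-- A section consisting of roots of a nonzero member of the family. -/
structure IsRootSection (H : Set (I → ℝ[X])) (z : I → ℝ) : Prop extends IsSection H z where
  root : ∃ h ∈ H, (∀ t, h t ≠ 0) ∧ ∀ t, (h t).eval (z t) = 0

theorem HasRootSections.exists_isRootSection (hR : HasRootSections H) {h : I → ℝ[X]} (hh : h ∈ H)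
    (h0 : ∀ t, h t ≠ 0) {t₀ : I} {z₀ : ℝ} (hz₀ : |z₀| ≤ 1) (hr : (h t₀).eval z₀ = 0) :
    ∃ z, IsRootSection H z ∧ z t₀ = z₀ := by
  obtain ⟨z, hz, hzt⟩ := hR h hh h0 t₀ z₀ hz₀ hr
  exact ⟨z, ⟨hz, h, hh, h0, (hz.signConst h hh).eq_zero (s := t₀) (by simpa only [hzt] using hr)⟩,
    hzt⟩

/-- A point which is not a root lies between two consecutive sections of roots. -/
theorem exists_gap [PreconnectedSpace I] (hH : IsAdmissible H) (hR : HasRootSections H) {t₀ : I}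
    {z₀ : ℝ} (hz₀ : |z₀| ≤ 1) (hne : ∀ h ∈ H, (∀ t, h t ≠ 0) → (h t₀).eval z₀ ≠ 0) :
    ∃ a b, IsRootSection H a ∧ IsRootSection H b ∧ a t₀ < z₀ ∧ z₀ < b t₀ ∧ (∀ t, a t < b t) ∧
      ∀ t, ∀ z ∈ Ioo (a t) (b t), ∀ h ∈ H, (∀ t, h t ≠ 0) → (h t).eval z ≠ 0 := by
  set N : Set ℝ := {z | |z| ≤ 1 ∧ ∃ h ∈ H, (∀ t, h t ≠ 0) ∧ (h t₀).eval z = 0} with hN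
  have hNfin : N.Finite := by
    refine (hH.finite.biUnion (t := fun h => {z | (∀ t, h t ≠ 0) ∧ (h t₀).eval z = 0})
      fun h _ => ?_).subset ?_
    · by_cases h0 : ∀ t, h t ≠ 0
      · exact (finite_setOfPred_isRoot (h0 t₀)).subset fun z hz => hz.2
      · simp [h0]
    · rintro z ⟨-, h, hh, h0, hz⟩
      exact mem_biUnion hh ⟨h0, hz⟩
  have hX1 : (X - 1 : ℝ[X]) ≠ 0 := by simpa using X_sub_C_ne_zero (1 : ℝ)
  have hX2 : (X + 1 : ℝ[X]) ≠ 0 := by simpa using X_add_C_ne_zero (1 : ℝ)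
  have h1 : (1 : ℝ) ∈ N := ⟨by simp, _, hH.X_sub_one, fun _ => hX1, by simp⟩
  have h2 : (-1 : ℝ) ∈ N := ⟨by simp, _, hH.X_add_one, fun _ => hX2, by simp⟩
  have hzN : z₀ ∉ N := fun ⟨_, h, hh, h0, hz⟩ => hne h hh h0 hz
  rw [abs_le] at hz₀
  have hz1 : z₀ < 1 := lt_of_le_of_ne hz₀.2 fun h => hzN (h ▸ h1)
  have hz2 : -1 < z₀ := lt_of_le_of_ne hz₀.1 fun h => hzN (h ▸ h2)
  obtain ⟨a₀, ⟨⟨ha1, ha, haH, ha0, har⟩, haz⟩, hamax⟩ :=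
    (hNfin.inter_of_left (Iio z₀)).exists_le_maximal ⟨h2, hz2⟩ |>.imp fun _ h => h.2
  obtain ⟨b₀, ⟨⟨hb1, hb, hbH, hb0, hbr⟩, hbz⟩, hbmin⟩ :=
    (hNfin.inter_of_left (Ioi z₀)).exists_le_minimal ⟨h1, hz1⟩ |>.imp fun _ h => h.2
  obtain ⟨a, haS, rfl⟩ := hR.exists_isRootSection haH ha0 ha1 har
  obtain ⟨b, hbS, rfl⟩ := hR.exists_isRootSection hbH hb0 hb1 hbr
  have never : ∀ {u v : I → ℝ}, IsRootSection H u → IsRootSection H v → ∀ {s}, u s < v s →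
      ∀ t, u t < v t := by
    intro u v hu hv s hs
    refine forall_lt_of_ne hu.continuous hv.continuous (fun t ht => hs.ne ?_) hs
    obtain ⟨g, hg, hg0, hgr⟩ := hu.root
    exact hu.eq_of_meet hH hv.toIsSection ht hg hg0 hgr s
  have haz' : a t₀ < z₀ := haz
  have hbz' : z₀ < b t₀ := hbz
  refine ⟨a, b, haS, hbS, haz', hbz', never haS hbS (haz'.trans hbz'), ?_⟩
  intro t z hz h hh h0 hr
  have hzabs : |z| ≤ 1 := by
    have h3 := abs_le.1 (haS.abs_le_one hH ha1 t)
    have h4 := abs_le.1 (hbS.abs_le_one hH hb1 t)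
    exact abs_le.2 ⟨by linarith [hz.1], by linarith [hz.2]⟩
  obtain ⟨w, hw, rfl⟩ := hR.exists_isRootSection hh h0 hzabs hr
  obtain ⟨g, hg, hg0, hgr⟩ := hw.root
  have hwN : w t₀ ∈ N := ⟨hw.abs_le_one hH hzabs t₀, g, hg, hg0, hgr t₀⟩
  have hl := never haS hw hz.1 t₀
  have hu := never hw hbS hz.2 t₀
  rcases lt_trichotomy (w t₀) z₀ with h5 | h5 | h5
  · exact absurd (hamax ⟨hwN, h5⟩ hl.le) (not_le.2 hl)
  · exact hzN (h5 ▸ hwN)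
  · exact absurd (hbmin ⟨hwN, h5⟩ hu.le) (not_le.2 hu)

theorem HasRootSections.exists_isSection [PreconnectedSpace I] (hH : IsAdmissible H)
    (hR : HasRootSections H) (t₀ : I) {z₀ : ℝ} (hz₀ : |z₀| ≤ 1) :
    ∃ z, IsSection H z ∧ z t₀ = z₀ := by
  by_cases hne : ∀ h ∈ H, (∀ t, h t ≠ 0) → (h t₀).eval z₀ ≠ 0
  · obtain ⟨a, b, ha, hb, haz, hbz, hab, hgap⟩ := exists_gap hH hR hz₀ hne
    set c := (z₀ - a t₀) / (b t₀ - a t₀) with hc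
    have hpos : 0 < b t₀ - a t₀ := sub_pos.2 (hab t₀)
    have hc0 : 0 < c := div_pos (by linarith) hpos
    have hc1 : c < 1 := (div_lt_one hpos).2 (by linarith)
    have hcont : Continuous fun t => a t + c * (b t - a t) :=
      ha.continuous.add (continuous_const.mul (hb.continuous.sub ha.continuous))
    refine ⟨fun t => a t + c * (b t - a t), ⟨hcont, fun h hh => ?_⟩, ?_⟩
    · rcases hH.zero_or_ne h hh with h0 | h0
      · intro s t; simp [h0]
      · refine signConst_of_ne_zero ((hH.continuous h hh).comp (continuous_id.prodMk hcont))
          fun t => hgap t _ ⟨?_, ?_⟩ h hh h0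
        · have := mul_pos hc0 (sub_pos.2 (hab t)); linarith
        · have := mul_pos (sub_pos.2 hc1) (sub_pos.2 (hab t)); linarith
    · show a t₀ + c * (b t₀ - a t₀) = z₀
      rw [hc, div_mul_cancel₀ _ hpos.ne']; ring
  · push Not at hne
    obtain ⟨h, hh, h0, hr⟩ := hne
    exact hR h hh h0 t₀ z₀ hz₀ hr

end Sections

/-- A continuous function of two variables, strictly monotone in the second one, has a continuous
implicit function. -/
theorem exists_continuous_root {I : Type*} [TopologicalSpace I] {f : I → ℝ → ℝ}
    (hf : Continuous fun q : I × ℝ => f q.1 q.2) {a b : I → ℝ} (ha : Continuous a)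
    (hb : Continuous b) (hab : ∀ t, a t < b t) (hsign : ∀ t, f t (a t) * f t (b t) < 0)
    (hmono : ∀ t, StrictMonoOn (f t) (Icc (a t) (b t)) ∨ StrictAntiOn (f t) (Icc (a t) (b t))) :
    ∃ w : I → ℝ, Continuous w ∧ ∀ t, w t ∈ Ioo (a t) (b t) ∧ f t (w t) = 0 := by
  have ivt : ∀ t {u v : ℝ}, u < v → f t u * f t v < 0 → ∃ z ∈ Ioo u v, f t z = 0 := by
    intro t u v huv h
    have hc : ContinuousOn (f t) (Icc u v) :=
      (hf.comp (continuous_const.prodMk continuous_id)).continuousOn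
    rcases mul_neg_iff.1 h with ⟨h1, h2⟩ | ⟨h1, h2⟩
    · exact intermediate_value_Ioo' huv.le hc ⟨h2, h1⟩
    · exact intermediate_value_Ioo huv.le hc ⟨h1, h2⟩
  choose w hw hw0 using fun t => ivt t (hab t) (hsign t)
  refine ⟨w, continuous_iff_continuousAt.2 fun t₁ => ?_, fun t => ⟨hw t, hw0 t⟩⟩
  have huniq : ∀ t, ∀ z ∈ Ioo (a t) (b t), f t z = 0 → z = w t := by
    intro t z hz h0
    have hinj : InjOn (f t) (Icc (a t) (b t)) :=
      (hmono t).elim StrictMonoOn.injOn StrictAntiOn.injOn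
    exact hinj (Ioo_subset_Icc_self hz) (Ioo_subset_Icc_self (hw t)) (h0.trans (hw0 t).symm)
  rw [ContinuousAt, tendsto_order]
  have key : ∀ u v, a t₁ < u → u < w t₁ → w t₁ < v → v < b t₁ →
      ∀ᶠ t in nhds t₁, w t ∈ Ioo u v := by
    intro u v hau huw hwv hvb
    have hneg : f t₁ u * f t₁ v < 0 := by
      have hmu : u ∈ Icc (a t₁) (b t₁) := ⟨hau.le, (huw.trans (hw t₁).2).le⟩
      have hmv : v ∈ Icc (a t₁) (b t₁) := ⟨((hw t₁).1.trans hwv).le, hvb.le⟩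
      have hmw := Ioo_subset_Icc_self (hw t₁)
      rcases hmono t₁ with h | h
      · have h1 := h hmu hmw huw
        have h2 := h hmw hmv hwv
        rw [hw0] at h1 h2
        exact mul_neg_of_neg_of_pos h1 h2
      · have h1 := h hmu hmw huw
        have h2 := h hmw hmv hwv
        rw [hw0] at h1 h2
        exact mul_neg_of_pos_of_neg h1 h2
    have hcont : Continuous fun t => f t u * f t v :=
      (hf.comp (continuous_id.prodMk continuous_const)).mul
        (hf.comp (continuous_id.prodMk continuous_const))
    filter_upwards [hcont.continuousAt.eventually_lt continuousAt_const hneg,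
      ha.continuousAt.eventually_lt continuousAt_const hau,
      continuousAt_const.eventually_lt hb.continuousAt hvb] with t h1 h2 h3
    obtain ⟨z, hz, hz0⟩ := ivt t (huw.trans hwv) h1
    exact huniq t z ⟨h2.trans hz.1, hz.2.trans h3⟩ hz0 ▸ hz
  obtain ⟨u₁, hu₁, hu₁'⟩ := exists_between (hw t₁).1
  obtain ⟨v₁, hv₁, hv₁'⟩ := exists_between (hw t₁).2
  constructor
  · intro c hc
    filter_upwards [key (max u₁ c) v₁ (lt_max_of_lt_left hu₁) (max_lt hu₁' hc) hv₁ hv₁'] with t ht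
    exact (le_max_right _ _).trans_lt ht.1
  · intro c hc
    filter_upwards [key u₁ (min v₁ c) hu₁ hu₁' (lt_min hv₁ hc) (min_lt_of_left_lt hv₁')] with t ht
    exact ht.2.trans_le (min_le_right _ _)

theorem Polynomial.strictMonoOn_or_strictAntiOn {p : ℝ[X]} {a b : ℝ}
    (h : ∀ z ∈ Ioo a b, (derivative p).eval z ≠ 0) :
    StrictMonoOn (fun z => p.eval z) (Icc a b) ∨ StrictAntiOn (fun z => p.eval z) (Icc a b) := by
  by_cases hpos : ∀ z ∈ Ioo a b, 0 < (derivative p).eval z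
  · left
    refine strictMonoOn_of_deriv_pos (convex_Icc a b) p.continuous.continuousOn fun z hz => ?_
    rw [interior_Icc] at hz
    rw [Polynomial.deriv]
    exact hpos z hz
  · right
    push Not at hpos
    obtain ⟨y, hy, hy0⟩ := hpos
    refine strictAntiOn_of_deriv_neg (convex_Icc a b) p.continuous.continuousOn fun z hz => ?_
    rw [interior_Icc] at hz
    rw [Polynomial.deriv]
    by_contra! hz0
    obtain ⟨x, hx, hx0⟩ := isPreconnected_Ioo.intermediate_value hy hz
      (derivative p).continuous.continuousOn ⟨hy0, hz0⟩
    exact h x hx hx0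

/-- The conditions under which the polynomial `f` can be added to an admissible family `H`, as part
of a set `K` of polynomials of the same degree. -/
structure IsExtension {I : Type*} [TopologicalSpace I] (H K : Set (I → ℝ[X])) (f : I → ℝ[X]) :
    Prop where
  continuous : Continuous fun q : I × ℝ => (f q.1).eval q.2
  derivative_mem : (fun t => derivative (f t)) ∈ H
  ne_zero : ∀ t, f t ≠ 0
  derivative_ne_zero : ∀ t, derivative (f t) ≠ 0
  remainder : ∀ h ∈ H ∪ K, (∀ t, h t ≠ 0) → ∃ r ∈ H, ∀ t z, (h t).eval z = 0 →
    SignType.sign ((f t).eval z) = SignType.sign ((r t).eval z)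

section Extension

variable {I : Type*} [TopologicalSpace I] {H K : Set (I → ℝ[X])}

theorem IsAdmissible.union (hH : IsAdmissible H) (hK : K.Finite)
    (hext : ∀ f ∈ K, f ∈ H ∨ IsExtension H K f) : IsAdmissible (H ∪ K) where
  finite := hH.finite.union hK
  continuous := by
    rintro f (hf | hf)
    · exact hH.continuous f hf
    · exact (hext f hf).elim (hH.continuous f) fun h => h.continuous
  derivative := by
    rintro f (hf | hf)
    · exact Or.inl (hH.derivative f hf)
    · exact Or.inl ((hext f hf).elim (hH.derivative f) fun h => h.derivative_mem)
  zero_or_ne := by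
    rintro f (hf | hf)
    · exact hH.zero_or_ne f hf
    · exact (hext f hf).elim (hH.zero_or_ne f) fun h => Or.inr h.ne_zero
  X_sub_one := Or.inl hH.X_sub_one
  X_add_one := Or.inl hH.X_add_one

theorem IsSection.signConst_of_root (hext : ∀ f ∈ K, f ∈ H ∨ IsExtension H K f) {z : I → ℝ}
    (hz : IsSection H z) {h : I → ℝ[X]} (hh : h ∈ H ∪ K) (h0 : ∀ t, h t ≠ 0)
    (hr : ∀ t, (h t).eval (z t) = 0) : IsSection (H ∪ K) z where
  continuous := hz.continuous
  signConst := by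
    rintro f (hf | hf)
    · exact hz.signConst f hf
    rcases hext f hf with hf | hf
    · exact hz.signConst f hf
    obtain ⟨r, hrH, hrs⟩ := hf.remainder h hh h0
    intro s t
    simp only [hrs s _ (hr s), hrs t _ (hr t)]
    exact hz.signConst r hrH s t

theorem HasRootSections.union [PreconnectedSpace I] (hH : IsAdmissible H) (hR : HasRootSections H)
    (hext : ∀ f ∈ K, f ∈ H ∨ IsExtension H K f) : HasRootSections (H ∪ K) := by
  intro h hh h0 t₀ z₀ hz₀ hr
  by_cases hne : ∀ g ∈ H, (∀ t, g t ≠ 0) → (g t₀).eval z₀ ≠ 0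
  swap
  · push Not at hne
    obtain ⟨g, hg, hg0, hgr⟩ := hne
    obtain ⟨z, hz, hzt⟩ := hR.exists_isRootSection hg hg0 hz₀ hgr
    obtain ⟨k, hk, hk0, hkr⟩ := hz.root
    exact ⟨z, hz.signConst_of_root hext (Or.inl hk) hk0 hkr, hzt⟩
  have hhH : h ∉ H := fun hhH => hne h hhH h0 hr
  have hhE : IsExtension H K h := (hext h (hh.resolve_left hhH)).resolve_left hhH
  obtain ⟨a, b, ha, hb, haz, hbz, hab, hgap⟩ := exists_gap hH hR hz₀ hne
  have hmono : ∀ t, StrictMonoOn (fun z => (h t).eval z) (Icc (a t) (b t)) ∨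
      StrictAntiOn (fun z => (h t).eval z) (Icc (a t) (b t)) := fun t =>
    strictMonoOn_or_strictAntiOn fun z hz =>
      hgap t z hz _ hhE.derivative_mem hhE.derivative_ne_zero
  have hneg₀ : (h t₀).eval (a t₀) * (h t₀).eval (b t₀) < 0 := by
    have hma := left_mem_Icc.2 (hab t₀).le
    have hmb := right_mem_Icc.2 (hab t₀).le
    have hmz : z₀ ∈ Icc (a t₀) (b t₀) := ⟨haz.le, hbz.le⟩
    rcases hmono t₀ with hm | hm
    · have h1 := hm hma hmz haz
      have h2 := hm hmz hmb hbz
      simp only [hr] at h1 h2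
      exact mul_neg_of_neg_of_pos h1 h2
    · have h1 := hm hma hmz haz
      have h2 := hm hmz hmb hbz
      simp only [hr] at h1 h2
      exact mul_neg_of_pos_of_neg h1 h2
  have hneg : ∀ t, (h t).eval (a t) * (h t).eval (b t) < 0 := by
    intro t
    obtain ⟨g, hg, hg0, hgr⟩ := ha.root
    obtain ⟨k, hk, hk0, hkr⟩ := hb.root
    have h1 := (ha.signConst_of_root hext (Or.inl hg) hg0 hgr).signConst h hh t t₀
    have h2 := (hb.signConst_of_root hext (Or.inl hk) hk0 hkr).signConst h hh t t₀
    rw [← sign_eq_neg_one_iff, sign_mul] at hneg₀ ⊢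
    rw [← hneg₀]
    exact congrArg₂ _ h1 h2
  obtain ⟨w, hwc, hw⟩ := exists_continuous_root hhE.continuous ha.continuous hb.continuous hab hneg
    hmono
  have hwS : IsSection H w := by
    refine ⟨hwc, fun g hg => ?_⟩
    rcases hH.zero_or_ne g hg with hg0 | hg0
    · intro s t; simp [hg0]
    · exact signConst_of_ne_zero ((hH.continuous g hg).comp (continuous_id.prodMk hwc))
        fun t => hgap t _ (hw t).1 g hg hg0
  refine ⟨w, hwS.signConst_of_root hext hh h0 fun t => (hw t).2, ?_⟩
  have hinj : InjOn (fun z => (h t₀).eval z) (Icc (a t₀) (b t₀)) :=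
    (hmono t₀).elim StrictMonoOn.injOn StrictAntiOn.injOn
  exact hinj (Ioo_subset_Icc_self (hw t₀).1) ⟨haz.le, hbz.le⟩ ((hw t₀).2.trans hr.symm)

end Extension

/-- Pseudo-division with an even power of the leading coefficient. -/
theorem Polynomial.exists_pseudo_remainder {A : Type*} [CommRing A] (f g : A[X])
    (hg : 1 ≤ g.natDegree) :
    ∃ (k : ℕ) (q r : A[X]), C (g.leadingCoeff ^ (2 * k)) * f = q * g + r ∧
      r.natDegree < g.natDegree := by
  suffices ∃ (k : ℕ) (q r : A[X]), C (g.leadingCoeff ^ k) * f = q * g + r ∧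
      r.natDegree < g.natDegree by
    obtain ⟨k, q, r, h, hr⟩ := this
    refine ⟨k, C (g.leadingCoeff ^ k) * q, C (g.leadingCoeff ^ k) * r, ?_,
      (natDegree_C_mul_le _ _).trans_lt hr⟩
    rw [two_mul, pow_add, C_mul, mul_assoc, h]
    ring
  induction hn : f.natDegree using Nat.strong_induction_on generalizing f with
  | _ n ih =>
  by_cases hlt : n < g.natDegree
  · exact ⟨0, 0, f, by simp, hn ▸ hlt⟩
  push Not at hlt
  set m := n - g.natDegree with hm
  set f' : A[X] := C g.leadingCoeff * f - C f.leadingCoeff * X ^ m * g with hf'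
  have hdeg : f'.natDegree < n := by
    have hle : f'.natDegree ≤ n := by
      refine (natDegree_sub_le_of_le ((natDegree_C_mul_le _ _).trans hn.le) (n := n) ?_).trans
        (max_self n).le
      refine natDegree_mul_le.trans ?_
      have := natDegree_C_mul_X_pow_le f.leadingCoeff m
      omega
    refine lt_of_le_of_ne hle fun heq => ?_
    have hc : f'.coeff n = 0 := by
      rw [hf', coeff_sub, coeff_C_mul, mul_assoc, coeff_C_mul, coeff_X_pow_mul', if_pos (by omega),
        show n - m = g.natDegree by omega, ← hn, coeff_natDegree, coeff_natDegree]
      ring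
    rw [← heq, coeff_natDegree, leadingCoeff_eq_zero] at hc
    rw [hc, natDegree_zero] at heq
    omega
  obtain ⟨k, q, r, h, hr⟩ := ih _ hdeg f' rfl
  refine ⟨k + 1, q + C (g.leadingCoeff ^ k) * (C f.leadingCoeff * X ^ m), r, ?_, hr⟩
  rw [pow_succ, C_mul, mul_assoc]
  have : C g.leadingCoeff * f = f' + C f.leadingCoeff * X ^ m * g := by rw [hf']; ring
  rw [this, mul_add, h]
  ring

/-- If the values of an operation in two variables have smaller rank than its second argument, then
every finite set is contained in a finite set closed under the operation. -/
theorem exists_finite_closed {α : Type*} (rank : α → ℕ) (op : α → α → Set α)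
    (hfin : ∀ f g, (op f g).Finite)
    (hop : ∀ f g, 1 ≤ rank g → ∀ r ∈ op f g, rank r < rank g) {F : Set α} (hF : F.Finite) :
    ∃ G, F ⊆ G ∧ G.Finite ∧
      ∀ f ∈ G, ∀ g ∈ G, 1 ≤ rank g → rank g ≤ rank f → op f g ⊆ G := by
  obtain ⟨D, hD⟩ : ∃ D, ∀ f ∈ F, rank f ≤ D := by
    obtain ⟨D, hD⟩ := (hF.image rank).bddAbove
    exact ⟨D, fun f hf => hD (mem_image_of_mem _ hf)⟩
  suffices ∀ k ≤ D, ∃ G, F ⊆ G ∧ G.Finite ∧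
      ∀ f ∈ G, ∀ g ∈ G, 1 ≤ rank g → D < rank g + k → rank g ≤ rank f → op f g ⊆ G by
    obtain ⟨G, hFG, hG, h⟩ := this D le_rfl
    exact ⟨G, hFG, hG, fun f hf g hg h1 => h f hf g hg h1 (by omega)⟩
  intro k
  induction k with
  | zero =>
    intro _
    refine ⟨F, Subset.rfl, hF, fun f _ g hg _ h => ?_⟩
    have := hD g hg
    omega
  | succ k ih =>
    intro hk
    obtain ⟨G, hFG, hG, h⟩ := ih (by omega)
    have hnew : ∀ r ∈ ⋃ f ∈ G, ⋃ g ∈ {g ∈ G | rank g = D - k}, op f g, rank r < D - k := by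
      intro r hr
      simp only [mem_iUnion] at hr
      obtain ⟨f, hf, g, ⟨hg, hgk⟩, hr⟩ := hr
      exact hgk ▸ hop f g (by omega) r hr
    refine ⟨G ∪ ⋃ f ∈ G, ⋃ g ∈ {g ∈ G | rank g = D - k}, op f g, hFG.trans subset_union_left,
      hG.union (hG.biUnion fun f _ => (hG.subset (sep_subset _ _)).biUnion fun g _ => hfin f g),
      ?_⟩
    intro f hf g hg h1 h2 h3
    have hg' : g ∈ G := hg.resolve_right fun h' => by have := hnew g h'; omega
    have hf' : f ∈ G := hf.resolve_right fun h' => by have := hnew f h'; omega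
    by_cases hgk : rank g = D - k
    · intro r hr
      exact Or.inr (mem_biUnion hf' (mem_biUnion
        (show g ∈ {g ∈ G | rank g = D - k} from ⟨hg', hgk⟩) hr))
    · exact (h f hf' g hg' h1 (by omega) h3).trans subset_union_left

/-- Closure of a set of polynomials under derivatives, truncation, evaluation at `±1` and
pseudo-remainders. -/
structure IsEliminationClosed {A : Type*} [CommRing A] (G : Set A[X]) : Prop where
  derivative : ∀ f ∈ G, 1 ≤ f.natDegree → derivative f ∈ G
  eraseLead : ∀ f ∈ G, 1 ≤ f.natDegree → f.eraseLead ∈ G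
  eval_one : ∀ f ∈ G, 1 ≤ f.natDegree → C (f.eval 1) ∈ G
  eval_neg_one : ∀ f ∈ G, 1 ≤ f.natDegree → C (f.eval (-1)) ∈ G
  remainder : ∀ f ∈ G, ∀ g ∈ G, 1 ≤ g.natDegree → g.natDegree ≤ f.natDegree → ∃ r ∈ G,
    r.natDegree < g.natDegree ∧ ∃ (k : ℕ) (q : A[X]), C (g.leadingCoeff ^ (2 * k)) * f = q * g + r

theorem exists_isEliminationClosed {A : Type*} [CommRing A] {F : Set A[X]} (hF : F.Finite) :
    ∃ G, F ⊆ G ∧ G.Finite ∧ IsEliminationClosed G := by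
  have hrem : ∀ f g : A[X], ∃ r : A[X], 1 ≤ g.natDegree → r.natDegree < g.natDegree ∧
      ∃ (k : ℕ) (q : A[X]), C (g.leadingCoeff ^ (2 * k)) * f = q * g + r := by
    intro f g
    by_cases hg : 1 ≤ g.natDegree
    · obtain ⟨k, q, r, h, hr⟩ := exists_pseudo_remainder f g hg
      exact ⟨r, fun _ => ⟨hr, k, q, h⟩⟩
    · exact ⟨0, fun h => absurd h hg⟩
  choose rem hrem using hrem
  let op : A[X] → A[X] → Set A[X] := fun f g =>
    {derivative g, g.eraseLead, C (g.eval 1), C (g.eval (-1)), rem f g}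
  have hop : ∀ f g : A[X], 1 ≤ g.natDegree → ∀ r ∈ op f g, r.natDegree < g.natDegree := by
    rintro f g hg r (rfl | rfl | rfl | rfl | rfl)
    · exact natDegree_derivative_lt (by omega)
    · rcases eraseLead_natDegree_lt_or_eraseLead_eq_zero g with h | h
      · exact h
      · rw [h, natDegree_zero]; omega
    · rw [natDegree_C]; omega
    · rw [natDegree_C]; omega
    · exact (hrem f g hg).1
  obtain ⟨G, hFG, hG, h⟩ := exists_finite_closed natDegree op (fun f g => by simp [op]) hop hF
  refine ⟨G, hFG, hG, ⟨?_, ?_, ?_, ?_, ?_⟩⟩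
  · exact fun f hf h1 => h f hf f hf h1 le_rfl (by simp [op])
  · exact fun f hf h1 => h f hf f hf h1 le_rfl (by simp [op])
  · exact fun f hf h1 => h f hf f hf h1 le_rfl (by simp [op])
  · exact fun f hf h1 => h f hf f hf h1 le_rfl (by simp [op])
  · exact fun f hf g hg h1 h2 => ⟨rem f g, h f hf g hg h1 h2 (by simp [op]), hrem f g h1⟩

section Specialization

variable {I A : Type*} [CommRing A]

/-- The polynomials of degree at most `d` in `G`, specialized along the family `φ` of
homomorphisms, together with a few constant polynomials. -/
def specializedFamily (φ : I → A →+* ℝ) (G : Set A[X]) (d : ℕ) : Set (I → ℝ[X]) :=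
  (fun (f : A[X]) t => f.map (φ t)) '' {f ∈ G | f.natDegree ≤ d} ∪
    {fun _ => 0, fun _ => 1, fun _ => X - 1, fun _ => X + 1}

variable {φ : I → A →+* ℝ} {G : Set A[X]} {d : ℕ}

theorem map_mem_specializedFamily {f : A[X]} (hf : f ∈ G) (hd : f.natDegree ≤ d) :
    (fun t => f.map (φ t)) ∈ specializedFamily φ G d :=
  Or.inl ⟨f, ⟨hf, hd⟩, rfl⟩

theorem zero_mem_specializedFamily : (fun _ => 0) ∈ specializedFamily φ G d := Or.inr (by simp)

theorem one_mem_specializedFamily : (fun _ => 1) ∈ specializedFamily φ G d := Or.inr (by simp)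

theorem Polynomial.map_ne_zero_of_leadingCoeff {R S : Type*} [Semiring R] [Semiring S]
    {f : R →+* S} {p : R[X]} (h : f p.leadingCoeff ≠ 0) : p.map f ≠ 0 := fun h0 => h <| by
  rw [leadingCoeff, ← coeff_map, h0, coeff_zero]

theorem IsEliminationClosed.exists_leadingCoeff_ne_zero (hG : IsEliminationClosed G)
    (hs : ∀ f ∈ G, SignConst fun t => φ t f.leadingCoeff) {f : A[X]} (hf : f ∈ G) :
    (∀ t, f.map (φ t) = 0) ∨ ∃ g ∈ G, g.natDegree ≤ f.natDegree ∧
      (∀ t, g.map (φ t) = f.map (φ t)) ∧ ∀ t, φ t g.leadingCoeff ≠ 0 := by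
  induction hn : f.natDegree using Nat.strong_induction_on generalizing f with
  | _ n ih =>
  rcases (hs f hf).eq_zero_or_ne_zero with h0 | h0
  swap
  · exact Or.inr ⟨f, hf, hn.le, fun _ => rfl, h0⟩
  have herase : ∀ t, f.map (φ t) = f.eraseLead.map (φ t) := by
    intro t
    conv_lhs => rw [← eraseLead_add_C_mul_X_pow f, Polynomial.map_add, Polynomial.map_mul, map_C,
      h0 t, C_0, zero_mul, add_zero]
  rcases Nat.eq_zero_or_pos n with rfl | hpos
  · left
    intro t
    have h := h0 t
    rw [leadingCoeff, hn] at h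
    rw [eq_C_of_natDegree_eq_zero hn, map_C, h, C_0]
  have hlt : f.eraseLead.natDegree < n := by
    rcases eraseLead_natDegree_lt_or_eraseLead_eq_zero f with h | h
    · exact hn ▸ h
    · rw [h, natDegree_zero]; exact hpos
  rcases ih _ hlt (hG.eraseLead f hf (by omega)) rfl with h | ⟨g, hg, hgd, hgf, hg0⟩
  · exact Or.inl fun t => (herase t).trans (h t)
  · exact Or.inr ⟨g, hg, by omega, fun t => (hgf t).trans (herase t).symm, hg0⟩

theorem Polynomial.continuous_eval_map [TopologicalSpace I] (hφ : ∀ a, Continuous fun t => φ t a)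
    (f : A[X]) : Continuous fun q : I × ℝ => (f.map (φ q.1)).eval q.2 := by
  simp only [eval_map, eval₂_eq_sum, Polynomial.sum]
  exact continuous_finsetSum _ fun i _ => ((hφ _).comp continuous_fst).mul (continuous_snd.pow i)

theorem isAdmissible_specializedFamily_zero [TopologicalSpace I]
    (hφ : ∀ a, Continuous fun t => φ t a) (hGf : G.Finite)
    (hs : ∀ f ∈ G, SignConst fun t => φ t f.leadingCoeff) :
    IsAdmissible (specializedFamily φ G 0) where
  finite := ((hGf.subset (sep_subset _ _)).image _).union (by simp)
  continuous := by
    rintro _ (⟨f, -, rfl⟩ | rfl | rfl | rfl | rfl)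
    · exact continuous_eval_map hφ f
    all_goals simp only [eval_zero, eval_one, eval_sub, eval_add, eval_X]; fun_prop
  derivative := by
    rintro _ (⟨f, ⟨hf, hd⟩, rfl⟩ | rfl | rfl | rfl | rfl)
    · simp only [derivative_map, derivative_of_natDegree_zero (Nat.le_zero.1 hd),
        Polynomial.map_zero]
      exact zero_mem_specializedFamily
    · simpa using zero_mem_specializedFamily
    · simpa using zero_mem_specializedFamily
    · simpa using one_mem_specializedFamily
    · simpa using one_mem_specializedFamily
  zero_or_ne := by
    rintro _ (⟨f, ⟨hf, hd⟩, rfl⟩ | rfl | rfl | rfl | rfl)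
    · rcases (hs f hf).eq_zero_or_ne_zero with h0 | h0
      · left
        intro t
        have h := h0 t
        rw [leadingCoeff, Nat.le_zero.1 hd] at h
        simp only
        rw [eq_C_of_natDegree_eq_zero (Nat.le_zero.1 hd), map_C, h, C_0]
      · exact Or.inr fun t => map_ne_zero_of_leadingCoeff (h0 t)
    · simp
    · simp
    · exact Or.inr fun _ => by simpa using X_sub_C_ne_zero (1 : ℝ)
    · exact Or.inr fun _ => by simpa using X_add_C_ne_zero (1 : ℝ)
  X_sub_one := Or.inr (by simp)
  X_add_one := Or.inr (by simp)

theorem hasRootSections_specializedFamily_zero [TopologicalSpace I]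
    (hs : ∀ f ∈ G, SignConst fun t => φ t f.leadingCoeff) :
    HasRootSections (specializedFamily φ G 0) := by
  intro h hh h0 t₀ z₀ hz₀ hr
  refine ⟨fun _ => z₀, ⟨continuous_const, ?_⟩, rfl⟩
  rintro _ (⟨f, ⟨hf, hd⟩, rfl⟩ | rfl | rfl | rfl | rfl)
  · have h := hs f hf
    rw [leadingCoeff, Nat.le_zero.1 hd] at h
    simp only
    rw [eq_C_of_natDegree_eq_zero (Nat.le_zero.1 hd)]
    simpa using h
  all_goals exact fun _ _ => rfl

theorem specializedFamily_succ : specializedFamily φ G (d + 1) = specializedFamily φ G d ∪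
    (fun (f : A[X]) t => f.map (φ t)) '' {f ∈ G | f.natDegree = d + 1} := by
  have : {f ∈ G | f.natDegree ≤ d + 1} =
      {f ∈ G | f.natDegree ≤ d} ∪ {f ∈ G | f.natDegree = d + 1} := by
    ext f
    simp only [mem_ofPred_eq, mem_union, Nat.le_succ_iff, and_or_left]
  rw [specializedFamily, specializedFamily, this, image_union, union_right_comm]

theorem IsEliminationClosed.isExtension [TopologicalSpace I]
    (hφ : ∀ a, Continuous fun t => φ t a) (hG : IsEliminationClosed G)
    (hs : ∀ f ∈ G, SignConst fun t => φ t f.leadingCoeff) {f : A[X]} (hf : f ∈ G)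
    (hfd : f.natDegree = d + 1) :
    (fun t => f.map (φ t)) ∈ specializedFamily φ G d ∨
    IsExtension (specializedFamily φ G d)
      ((fun (f : A[X]) t => f.map (φ t)) '' {f ∈ G | f.natDegree = d + 1})
      (fun t => f.map (φ t)) := by
  rcases hG.exists_leadingCoeff_ne_zero hs hf with h0 | ⟨g, hg, hgd, hgf, hg0⟩
  · left
    simp only [h0]
    exact zero_mem_specializedFamily
  by_cases hgd' : g.natDegree ≤ d
  · left
    simp only [← hgf]
    exact map_mem_specializedFamily hg hgd'
  right
  have hgd1 : g.natDegree = d + 1 := by omega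
  simp only [← hgf]
  have hne : ∀ t, g.map (φ t) ≠ 0 := fun t => map_ne_zero_of_leadingCoeff (hg0 t)
  refine ⟨continuous_eval_map hφ g, ?_, hne, fun t h => ?_, ?_⟩
  · simp only [derivative_map]
    refine map_mem_specializedFamily (hG.derivative g hg (by omega)) ?_
    have := natDegree_derivative_lt (p := g) (by omega)
    omega
  · have := derivative_eq_zero.1 h
    rw [natDegree_map_of_leadingCoeff_ne_zero _ (hg0 t)] at this
    omega
  rw [← specializedFamily_succ]
  rintro _ (⟨h, ⟨hh, hd⟩, rfl⟩ | rfl | rfl | rfl | rfl) hne0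
  · rcases hG.exists_leadingCoeff_ne_zero hs hh with h0 | ⟨k, hk, hkd, hkh, hk0⟩
    · refine ⟨_, zero_mem_specializedFamily, fun t => absurd (h0 t) (hne0 t)⟩
    simp only [← hkh]
    rcases Nat.eq_zero_or_pos k.natDegree with hk1 | hk1
    · refine ⟨_, zero_mem_specializedFamily, fun t z hz => absurd hz ?_⟩
      have := hk0 t
      rw [leadingCoeff, hk1] at this
      rw [eq_C_of_natDegree_eq_zero hk1]
      simpa using this
    · obtain ⟨r, hr, hrd, m, q, hmq⟩ := hG.remainder g hg k hk hk1 (by omega)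
      refine ⟨_, map_mem_specializedFamily hr (by omega), fun t z hz => ?_⟩
      have := congrArg (fun p => (p.map (φ t)).eval z) hmq
      simp only [Polynomial.map_mul, Polynomial.map_add, map_C, eval_mul, eval_add, eval_C, hz,
        mul_zero, zero_add] at this
      rw [← this, sign_mul, map_pow, pow_mul, sign_pos (pow_pos (sq_pos_of_ne_zero (hk0 t)) m),
        one_mul]
  · exact ⟨_, zero_mem_specializedFamily, fun t => absurd rfl (hne0 t)⟩
  · exact ⟨_, zero_mem_specializedFamily, fun t z hz => absurd hz (by simp)⟩
  · refine ⟨_, map_mem_specializedFamily (hG.eval_one g hg (by omega)) (by simp), fun t z hz => ?_⟩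
    obtain rfl : z = 1 := by simpa [sub_eq_zero] using hz
    rw [map_C, eval_C, eval_one_map]
  · refine ⟨_, map_mem_specializedFamily (hG.eval_neg_one g hg (by omega)) (by simp),
      fun t z hz => ?_⟩
    obtain rfl : z = -1 := by simpa [add_eq_zero_iff_eq_neg] using hz
    rw [map_C, eval_C, show (g.map (φ t)).eval (-1) = φ t (g.eval (-1)) by
      simpa using eval_intCast_map (φ t) g (-1)]

theorem IsEliminationClosed.hasRootSections [TopologicalSpace I] [PreconnectedSpace I]
    (hφ : ∀ a, Continuous fun t => φ t a) (hG : IsEliminationClosed G) (hGf : G.Finite)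
    (hs : ∀ f ∈ G, SignConst fun t => φ t f.leadingCoeff) (d : ℕ) :
    IsAdmissible (specializedFamily φ G d) ∧ HasRootSections (specializedFamily φ G d) := by
  induction d with
  | zero => exact ⟨isAdmissible_specializedFamily_zero hφ hGf hs,
      hasRootSections_specializedFamily_zero hs⟩
  | succ d ih =>
    have hext : ∀ h ∈ (fun (f : A[X]) t => f.map (φ t)) '' {f ∈ G | f.natDegree = d + 1},
        h ∈ specializedFamily φ G d ∨ IsExtension (specializedFamily φ G d)
          ((fun (f : A[X]) t => f.map (φ t)) '' {f ∈ G | f.natDegree = d + 1}) h := by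
      rintro _ ⟨f, ⟨hf, hfd⟩, rfl⟩
      exact hG.isExtension hφ hs hf hfd
    rw [specializedFamily_succ]
    exact ⟨ih.1.union ((hGf.subset (sep_subset _ _)).image _) hext, ih.2.union ih.1 hext⟩

end Specialization

/-- Elimination of one variable: continuous sections along which finitely many polynomials have
constant signs exist as soon as finitely many elements of the coefficient ring have constant
signs. -/
theorem exists_elimination {A : Type*} [CommRing A] {F : Set A[X]} (hF : F.Finite) :
    ∃ F' : Set A, F'.Finite ∧ ∀ (I : Type) [TopologicalSpace I] [PreconnectedSpace I]
      (φ : I → A →+* ℝ), (∀ a, Continuous fun t => φ t a) → (∀ a ∈ F', SignConst fun t => φ t a) →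
      ∀ t₀ z₀, |z₀| ≤ 1 → ∃ z : I → ℝ, Continuous z ∧ z t₀ = z₀ ∧
        ∀ f ∈ F, SignConst fun t => (f.map (φ t)).eval (z t) := by
  obtain ⟨G, hFG, hGf, hG⟩ := exists_isEliminationClosed hF
  refine ⟨leadingCoeff '' G, hGf.image _, ?_⟩
  intro I _ _ φ hφ hs t₀ z₀ hz₀
  obtain ⟨d, hd⟩ := (hGf.image natDegree).bddAbove
  obtain ⟨h1, h2⟩ := hG.hasRootSections hφ hGf (fun f hf => hs _ (mem_image_of_mem _ hf)) d
  obtain ⟨z, hz, hz0⟩ := h2.exists_isSection h1 t₀ hz₀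
  exact ⟨z, hz.continuous, hz0, fun f hf => hz.signConst _
    (map_mem_specializedFamily (hFG hf) (hd (mem_image_of_mem _ (hFG hf))))⟩

theorem MvPolynomial.continuous_eval₂Hom {I R σ : Type*} [CommRing R] [TopologicalSpace I]
    {φ : I → R →+* ℝ} (hφ : ∀ a, Continuous fun t => φ t a) {c : I → σ → ℝ} (hc : Continuous c)
    (p : MvPolynomial σ R) : Continuous fun t => eval₂Hom (φ t) (c t) p := by
  induction p using MvPolynomial.induction_on with
  | C a => simpa using hφ a
  | add p q hp hq => simp only [map_add]; exact hp.add hq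
  | mul_X p i hp =>
    simp only [map_mul, eval₂Hom_X']
    exact hp.mul ((continuous_apply i).comp hc)

theorem MvPolynomial.eval₂Hom_cons {R : Type*} [CommRing R] {n : ℕ} (φ : R →+* ℝ) (z : ℝ)
    (c : Fin n → ℝ) (p : MvPolynomial (Fin (n + 1)) R) :
    eval₂Hom φ (Fin.cons z c : Fin (n + 1) → ℝ) p =
      ((finSuccEquiv R n p).map (eval₂Hom φ c)).eval z := by
  induction p using MvPolynomial.induction_on with
  | C a => simp [finSuccEquiv_apply]
  | add p q hp hq => simp only [map_add, Polynomial.map_add, Polynomial.eval_add, hp, hq]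
  | mul_X p i hp =>
    rw [map_mul, hp, map_mul, Polynomial.map_mul, Polynomial.eval_mul]
    congr 1
    refine Fin.cases ?_ (fun j => ?_) i
    · simp [finSuccEquiv_X_zero]
    · simp [finSuccEquiv_X_succ]

/-- Finitely many polynomials admit continuous sections with constant signs through every point of
the unit cube, as soon as finitely many elements of the coefficient ring have constant signs. -/
theorem MvPolynomial.exists_elimination {R : Type*} [CommRing R] {n : ℕ}
    {F : Set (MvPolynomial (Fin n) R)} (hF : F.Finite) :
    ∃ F' : Set R, F'.Finite ∧ ∀ (I : Type) [TopologicalSpace I] [PreconnectedSpace I]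
      (φ : I → R →+* ℝ), (∀ a, Continuous fun t => φ t a) → (∀ a ∈ F', SignConst fun t => φ t a) →
      ∀ t₀ (y₀ : Fin n → ℝ), (∀ i, |y₀ i| ≤ 1) → ∃ c : I → Fin n → ℝ, Continuous c ∧ c t₀ = y₀ ∧
        ∀ f ∈ F, SignConst fun t => eval₂Hom (φ t) (c t) f := by
  induction n with
  | zero =>
    refine ⟨MvPolynomial.coeff 0 '' F, hF.image _, ?_⟩
    intro I _ _ φ hφ hs t₀ y₀ _
    refine ⟨fun _ => y₀, continuous_const, rfl, fun f hf => ?_⟩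
    have h := hs _ (mem_image_of_mem _ hf)
    obtain ⟨a, rfl⟩ := MvPolynomial.C_surjective (R := R) (Fin 0) f
    simpa [MvPolynomial.coeff_C] using h
  | succ n ih =>
    obtain ⟨F₁, hF₁, h₁⟩ := _root_.exists_elimination (hF.image (finSuccEquiv R n))
    obtain ⟨F₂, hF₂, h₂⟩ := ih hF₁
    refine ⟨F₂, hF₂, ?_⟩
    intro I _ _ φ hφ hs t₀ y₀ hy₀
    obtain ⟨c, hc, hc0, hcs⟩ := h₂ I φ hφ hs t₀ (Fin.tail y₀) fun i => hy₀ i.succ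
    obtain ⟨z, hz, hz0, hzs⟩ := h₁ I (fun t => eval₂Hom (φ t) (c t)) (continuous_eval₂Hom hφ hc)
      hcs t₀ (y₀ 0) (hy₀ 0)
    refine ⟨fun t => Fin.cons (z t) (c t), ?_, ?_, fun f hf => ?_⟩
    · refine continuous_pi fun i => Fin.cases ?_ (fun j => ?_) i
      · simpa using hz
      · simp only [Fin.cons_succ]
        exact (continuous_apply j).comp hc
    · simp only [hz0, hc0, Fin.cons_self_tail]
    · simp only [eval₂Hom_cons]
      exact hzs _ (mem_image_of_mem _ hf)

theorem Polynomial.exists_signConst_Ioo {F : Set ℝ[X]} (hF : F.Finite) :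
    ∃ ε : ℝ, 0 < ε ∧ ε ≤ 1 ∧ ∀ p ∈ F, SignConst fun t : Ioo 0 ε => p.eval (t : ℝ) := by
  have hroots : (⋃ p ∈ F, {z | 0 < z ∧ p ≠ 0 ∧ p.eval z = 0}).Finite := by
    refine hF.biUnion fun p _ => ?_
    by_cases hp : p = 0
    · simp [hp]
    · exact (finite_setOfPred_isRoot hp).subset fun z hz => hz.2.2
  obtain ⟨ε, ⟨hε, hε1⟩, hne⟩ : ∃ ε ∈ Ioc (0 : ℝ) 1, ∀ z ∈ Ioo 0 ε,
      z ∉ ⋃ p ∈ F, {z | 0 < z ∧ p ≠ 0 ∧ p.eval z = 0} := by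
    have h0 : (0 : ℝ) ∉ ⋃ p ∈ F, {z | 0 < z ∧ p ≠ 0 ∧ p.eval z = 0} := by simp
    obtain ⟨δ, hδ, hball⟩ := Metric.mem_nhds_iff.1 (hroots.isClosed.isOpen_compl.mem_nhds h0)
    refine ⟨min δ 1, ⟨by positivity, min_le_right _ _⟩, fun z hz => hball ?_⟩
    rw [Metric.mem_ball, Real.dist_0_eq_abs, abs_of_pos hz.1]
    exact hz.2.trans_le (min_le_left _ _)
  refine ⟨ε, hε, hε1, fun p hp => ?_⟩
  by_cases hp0 : p = 0
  · intro s t; simp [hp0]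
  have : PreconnectedSpace (Ioo 0 ε) := Subtype.preconnectedSpace isPreconnected_Ioo
  refine signConst_of_ne_zero (p.continuous.comp continuous_subtype_val) fun t ht => ?_
  exact hne t t.2 (mem_biUnion hp ⟨t.2.1, hp0, ht⟩)

/-- Near any point `x`, every point can be moved continuously to `x` without changing the
signs of given finitely many polynomials until `x` is reached. -/
theorem MvPolynomial.exists_path_signConst {n : ℕ} (F : Set (MvPolynomial (Fin n) ℝ))
    (hF : F.Finite) (x : Fin n → ℝ) :
    ∀ᶠ y in nhds x, ∃ γ : ℝ → Fin n → ℝ, ContinuousOn γ (Icc 0 1) ∧ γ 0 = x ∧ γ 1 = y ∧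
      ∀ f ∈ F, ∀ s ∈ Ioc (0 : ℝ) 1, SignType.sign (eval (γ s) f) = SignType.sign (eval y f) := by
  let τ : MvPolynomial (Fin n) ℝ →+* MvPolynomial (Fin n) ℝ[X] :=
    eval₂Hom (C.comp Polynomial.C) fun i => X i + C (Polynomial.C (x i))
  let S : MvPolynomial (Fin n) ℝ[X] := ∑ i, X i ^ 2 - C (Polynomial.X ^ 2)
  have hτ : ∀ t (c : Fin n → ℝ) f, eval₂Hom (Polynomial.evalRingHom t) c (τ f) =
      eval (c + x) f := by
    intro t c f
    induction f using MvPolynomial.induction_on with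
    | C a => simp [τ]
    | add p q hp hq => simp only [map_add, hp, hq]
    | mul_X p i hp => rw [map_mul, map_mul, hp, map_mul]; simp [τ]
  have hS : ∀ t (c : Fin n → ℝ), eval₂Hom (Polynomial.evalRingHom t) c S =
      ∑ i, c i ^ 2 - t ^ 2 := by
    intro t c
    simp [S]
  obtain ⟨F', hF', hsec⟩ := exists_elimination ((hF.image τ).insert S)
  obtain ⟨ε, hε, hε1, hconst⟩ := exists_signConst_Ioo hF'
  have : PreconnectedSpace (Ioo 0 ε) := Subtype.preconnectedSpace isPreconnected_Ioo
  have hcont : Continuous fun y : Fin n → ℝ => ∑ i, (y i - x i) ^ 2 := by fun_prop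
  have hx0 : ∑ i, (x i - x i) ^ 2 < ε ^ 2 := by simpa using pow_pos hε 2
  filter_upwards [hcont.continuousAt.eventually_lt continuousAt_const hx0] with y hy
  by_cases hyx : y = x
  · exact ⟨fun _ => x, continuousOn_const, rfl, hyx.symm, fun f _ s _ => by rw [hyx]⟩
  set t₀ := √(∑ i, (y i - x i) ^ 2) with ht₀
  have hsq : t₀ ^ 2 = ∑ i, (y i - x i) ^ 2 :=
    Real.sq_sqrt (Finset.sum_nonneg fun i _ => sq_nonneg _)
  have ht₀ε : t₀ < ε := (Real.sqrt_lt' hε).2 hy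
  have ht₀pos : 0 < t₀ := by
    obtain ⟨i, hi⟩ := Function.ne_iff.1 hyx
    exact Real.sqrt_pos.2 (Finset.sum_pos' (fun i _ => sq_nonneg _)
      ⟨i, Finset.mem_univ i, sq_pos_of_ne_zero (sub_ne_zero.2 hi)⟩)
  have hle : ∀ {c : Fin n → ℝ} {t : ℝ}, 0 ≤ t → ∑ i, c i ^ 2 = t ^ 2 → ∀ i, |c i| ≤ t := by
    intro c t ht h i
    refine abs_le_of_sq_le_sq ?_ ht
    rw [← h]
    exact Finset.single_le_sum (fun i _ => sq_nonneg (c i)) (Finset.mem_univ i)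
  obtain ⟨c, hc, hc0, hcs⟩ := hsec (Ioo 0 ε) (fun t => Polynomial.evalRingHom (t : ℝ))
    (fun a => a.continuous.comp continuous_subtype_val) hconst ⟨t₀, ht₀pos, ht₀ε⟩ (y - x)
    fun i => (hle ht₀pos.le (by simpa using hsq.symm) i).trans (ht₀ε.le.trans hε1)
  have hnorm : ∀ t, ∑ i, c t i ^ 2 = (t : ℝ) ^ 2 := by
    intro t
    have h := (hcs S (mem_insert _ _)).eq_zero (s := ⟨t₀, ht₀pos, ht₀ε⟩) (by
      simp only [hS, hc0]; simp [hsq]) t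
    rw [hS] at h
    linarith
  have hmem : ∀ {s : ℝ}, s ∈ Ioc (0 : ℝ) 1 → t₀ * s ∈ Ioo 0 ε := fun {s} hs =>
    ⟨mul_pos ht₀pos hs.1, (mul_le_of_le_one_right ht₀pos.le hs.2).trans_lt ht₀ε⟩
  have hmem1 : (1 : ℝ) ∈ Ioc (0 : ℝ) 1 := ⟨one_pos, le_rfl⟩
  let γ : ℝ → Fin n → ℝ := fun s => if hs : s ∈ Ioc (0 : ℝ) 1 then c ⟨t₀ * s, hmem hs⟩ + x else x
  have hγ : ∀ s (hs : s ∈ Ioc (0 : ℝ) 1), γ s = c ⟨t₀ * s, hmem hs⟩ + x := fun s hs => dif_pos hs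
  have hγ0 : γ 0 = x := dif_neg (by simp)
  have hγ1 : γ 1 = y := by
    rw [hγ 1 hmem1]
    simp only [mul_one, hc0, sub_add_cancel]
  refine ⟨γ, ?_, hγ0, hγ1, fun f hf s hs => ?_⟩
  · intro s hs
    rcases hs.1.eq_or_lt with rfl | hs0
    · rw [ContinuousWithinAt, hγ0, tendsto_pi_nhds]
      intro i
      rw [tendsto_iff_dist_tendsto_zero]
      have hlim : Filter.Tendsto (fun s => t₀ * s) (nhdsWithin 0 (Icc 0 1)) (nhds 0) := by
        have h : Continuous fun s => t₀ * s := by fun_prop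
        simpa using (h.tendsto 0).mono_left nhdsWithin_le_nhds
      refine squeeze_zero' (.of_forall fun _ => dist_nonneg) ?_ hlim
      filter_upwards [self_mem_nhdsWithin] with s hs
      rcases hs.1.eq_or_lt with rfl | hs0
      · simp [hγ0]
      · rw [hγ s ⟨hs0, hs.2⟩, Pi.add_apply, Real.dist_eq, add_sub_cancel_right]
        exact hle (mul_pos ht₀pos hs0).le (hnorm _) i
    · have hon : ContinuousOn γ (Ioc 0 1) := by
        rw [continuousOn_iff_continuous_domRestrict]
        have h : (Ioc (0 : ℝ) 1).domRestrict γ =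
            fun s : Ioc (0 : ℝ) 1 => c ⟨t₀ * s, hmem s.2⟩ + x := by
          ext1 s
          exact hγ s s.2
        rw [h]
        exact (hc.comp ((continuous_const.mul continuous_subtype_val).subtype_mk _)).add
          continuous_const
      refine (hon s ⟨hs0, hs.2⟩).mono_of_mem_nhdsWithin ?_
      filter_upwards [self_mem_nhdsWithin, mem_nhdsWithin_of_mem_nhds (Ioi_mem_nhds hs0)]
        with r hr hr0 using ⟨hr0, hr.2⟩
  · have h := hcs (τ f) (mem_insert_of_mem _ (mem_image_of_mem _ hf)) ⟨t₀ * s, hmem hs⟩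
      ⟨t₀ * 1, hmem hmem1⟩
    simp only [hτ] at h
    rwa [← hγ s hs, ← hγ 1 hmem1, hγ1] at h

/-- Semialgebraic sets are locally connected by paths. -/
theorem IsSemialgebraic.eventually_joinedIn {n : ℕ} {S : Set (Fin n → ℝ)} (hS : IsSemialgebraic S)
    {x : Fin n → ℝ} (hx : x ∈ S) : ∀ᶠ y in nhdsWithin x S, JoinedIn S x y := by
  obtain ⟨N, E, J, rfl⟩ := hS
  have hF : (⋃ m, (E m ∪ J m : Set (MvPolynomial (Fin n) ℝ))).Finite :=
    finite_iUnion fun m => (E m).finite_toSet.union (J m).finite_toSet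
  filter_upwards [mem_nhdsWithin_of_mem_nhds (MvPolynomial.exists_path_signConst _ hF x),
    self_mem_nhdsWithin] with y ⟨γ, hγ, hγ0, hγ1, hsign⟩ hy
  refine JoinedIn.ofLine hγ hγ0 hγ1 ?_
  rintro _ ⟨s, hs, rfl⟩
  rcases hs.1.eq_or_lt with rfl | hs0
  · rwa [hγ0]
  obtain ⟨m, hE, hJ⟩ := mem_iUnion.1 hy
  refine mem_iUnion.2 ⟨m, fun p hp => ?_, fun p hp => ?_⟩
  · rw [← sign_eq_zero_iff, hsign p (mem_iUnion.2 ⟨m, Or.inl hp⟩) s ⟨hs0, hs.2⟩, hE p hp, sign_zero]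
  · rw [← sign_eq_one_iff, hsign p (mem_iUnion.2 ⟨m, Or.inr hp⟩) s ⟨hs0, hs.2⟩, sign_pos (hJ p hp)]

theorem stmt5 {n : ℕ} (S : Set (Fin n → ℝ)) (hS : IsSemialgebraic S)
    (hconn : IsConnected S) : IsPathConnected S := by
  rw [isPathConnected_iff]
  refine ⟨hconn.nonempty, fun x hx y hy => ?_⟩
  refine hconn.isPreconnected.induction₂ (JoinedIn S)
    (fun z hz => hS.eventually_joinedIn hz) (fun _ _ _ _ _ _ h h' => h.trans h')
    (fun _ _ _ _ h => h.symm) hx hy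
end

section
/- Let n > 2 and let e₁, …, e_ℓ be finitely many (n−1)-ary cartesian-product-free relational algebra expressions over a set variable S ranging over subsets of ℝⁿ. Then there exist semi-algebraic sets A, B ⊆ ℝⁿ such that A is connected, B is disconnected, and eᵢ(A) = eᵢ(B) for all i = 1, …, ℓ. -/
open Set

/-- Relational algebra expressions over a set variable of arity `n`;
`RAE n k` produces a `k`-ary output. Constant sets are required to be
semi-algebraic. -/
inductive RAE (n : ℕ) : ℕ → Type 1 where
  | var : RAE n n
  | const : {k : ℕ} → (C : Set (Fin k → ℝ)) → IsSemialgebraic C → RAE n k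
  | union : {k : ℕ} → RAE n k → RAE n k → RAE n k
  | inter : {k : ℕ} → RAE n k → RAE n k → RAE n k
  | diff : {k : ℕ} → RAE n k → RAE n k → RAE n k
  | prod : {k₁ k₂ : ℕ} → RAE n k₁ → RAE n k₂ → RAE n (k₁ + k₂)
  | proj : {k : ℕ} → (p : ℕ) → (Fin p → Fin k) → RAE n k → RAE n p

def RAE.eval {n : ℕ} : {k : ℕ} → RAE n k → Set (Fin n → ℝ) → Set (Fin k → ℝ)
  | _, .var, S => S
  | _, .const C _, _ => C
  | _, .union e₁ e₂, S => e₁.eval S ∪ e₂.eval S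
  | _, .inter e₁ e₂, S => e₁.eval S ∩ e₂.eval S
  | _, .diff e₁ e₂, S => e₁.eval S \ e₂.eval S
  | _, .prod e₁ e₂, S =>
      {x | (fun i => x (Fin.castAdd _ i)) ∈ e₁.eval S ∧
           (fun i => x (Fin.natAdd _ i)) ∈ e₂.eval S}
  | _, .proj _ idx e, S => (fun x i => x (idx i)) '' e.eval S

/-- The expression does not use the difference operator. -/
def RAE.Positive {n : ℕ} : {k : ℕ} → RAE n k → Prop
  | _, .var => True
  | _, .const _ _ => True
  | _, .union e₁ e₂ => e₁.Positive ∧ e₂.Positive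
  | _, .inter e₁ e₂ => e₁.Positive ∧ e₂.Positive
  | _, .diff _ _ => False
  | _, .prod e₁ e₂ => e₁.Positive ∧ e₂.Positive
  | _, .proj _ _ e => e.Positive

/-- Number of occurrences of the set variable `S`. -/
def RAE.varCount {n : ℕ} : {k : ℕ} → RAE n k → ℕ
  | _, .var => 1
  | _, .const _ _ => 0
  | _, .union e₁ e₂ => e₁.varCount + e₂.varCount
  | _, .inter e₁ e₂ => e₁.varCount + e₂.varCount
  | _, .diff e₁ e₂ => e₁.varCount + e₂.varCount
  | _, .prod e₁ e₂ => e₁.varCount + e₂.varCount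
  | _, .proj _ _ e => e.varCount

/-- The expression does not use the cartesian product operator. -/
def RAE.ProductFree {n : ℕ} : {k : ℕ} → RAE n k → Prop
  | _, .var => True
  | _, .const _ _ => True
  | _, .union e₁ e₂ => e₁.ProductFree ∧ e₂.ProductFree
  | _, .inter e₁ e₂ => e₁.ProductFree ∧ e₂.ProductFree
  | _, .diff e₁ e₂ => e₁.ProductFree ∧ e₂.ProductFree
  | _, .prod _ _ => False
  | _, .proj _ _ e => e.ProductFree

/-- `t` and `s` lie in the same cell of the sign diagram of the polynomials `L i`, `i ∈ I`. -/
def SameCell {ι : Type*} (L : ι → Polynomial ℝ) (I : Set ι) (t s : ℝ) : Prop :=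
  ∀ i ∈ I, ∀ u ∈ uIcc t s, SignType.sign ((L i).eval u) = SignType.sign ((L i).eval t)

namespace SameCell

variable {ι : Type*} {L : ι → Polynomial ℝ} {I J : Set ι} {t s u v w : ℝ}

theorem refl (L : ι → Polynomial ℝ) (I : Set ι) (t : ℝ) : SameCell L I t t := by
  intro i _ u hu
  rw [uIcc_self, mem_singleton_iff] at hu
  rw [hu]

theorem sub (h : SameCell L I t s) (hu : u ∈ uIcc t s) : SameCell L I t u :=
  fun i hi v hv => h i hi v (uIcc_subset_uIcc_left hu hv)

theorem symm (h : SameCell L I t s) : SameCell L I s t := by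
  intro i hi u hu
  rw [uIcc_comm] at hu
  rw [h i hi u hu, h i hi s right_mem_uIcc]

theorem trans (h : SameCell L I t s) (h' : SameCell L I s w) : SameCell L I t w := by
  intro i hi u hu
  rcases uIcc_subset_uIcc_union_uIcc (b := s) hu with hu | hu
  · exact h i hi u hu
  · rw [h' i hi u hu, h i hi s right_mem_uIcc]

theorem sign_eq (h : SameCell L I t s) {i : ι} (hi : i ∈ I) :
    SignType.sign ((L i).eval s) = SignType.sign ((L i).eval t) :=
  h i hi s right_mem_uIcc

theorem mono (hJ : J ⊆ I) (h : SameCell L I t s) : SameCell L J t s :=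
  fun i hi => h i (hJ hi)

theorem lt_of_lt (hts : t < s) (hn : ¬ SameCell L I t s) (hw : SameCell L I t w)
    (hv : SameCell L I s v) : w < v := by
  by_contra! hvw
  rcases le_or_gt s w with h | h
  · exact hn (hw.sub (by rw [mem_uIcc]; left; exact ⟨hts.le, h⟩))
  · have : SameCell L I s w := hv.sub (by rw [mem_uIcc]; right; exact ⟨hvw, h.le⟩)
    exact hn (hw.trans this.symm)

theorem eq_of_root {i : ι} (hi : i ∈ I) (hL : L i ≠ 0) (ht : (L i).eval t = 0)
    (h : SameCell L I t s) : t = s := by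
  by_contra hne
  refine hL (Polynomial.eq_zero_of_infinite_isRoot _
    ((Icc_infinite (inf_lt_sup.2 hne)).mono ?_))
  intro u hu
  have := h i hi u hu
  rw [ht, sign_zero, sign_eq_zero_iff] at this
  exact this

theorem reflect : SameCell (fun i => (L i).comp (-Polynomial.X)) I t s ↔
    SameCell L I (-t) (-s) := by
  have key : ∀ u, u ∈ uIcc t s ↔ -u ∈ uIcc (-t) (-s) := by
    intro u
    simp only [mem_uIcc, neg_le_neg_iff]
    tauto
  simp only [SameCell, Polynomial.eval_comp, Polynomial.eval_neg, Polynomial.eval_X]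
  refine forall₂_congr fun i _ => ⟨fun h u hu => ?_, fun h u hu => h _ ((key u).1 hu)⟩
  simpa using h (-u) ((key _).2 (by simpa using hu))

theorem of_ne_zero (h : ∀ i ∈ I, L i ≠ 0 → ∀ u ∈ uIcc t s, (L i).eval u ≠ 0) :
    SameCell L I t s := by
  intro i hi u hu
  by_cases h0 : L i = 0
  · simp [h0]
  have hne := h i hi h0
  have hc : ContinuousOn (fun x => (L i).eval x) (uIcc t s) := (L i).continuous.continuousOn
  have hpc := isPreconnected_uIcc.image _ hc
  have hmu : (L i).eval u ∈ (fun x => (L i).eval x) '' uIcc t s := ⟨u, hu, rfl⟩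
  have hmt : (L i).eval t ∈ (fun x => (L i).eval x) '' uIcc t s := ⟨t, left_mem_uIcc, rfl⟩
  have h0 : (0 : ℝ) ∉ (fun x => (L i).eval x) '' uIcc t s := by
    rintro ⟨x, hx, hx0⟩
    exact hne x hx hx0
  rcases lt_or_gt_of_ne (hne u hu) with hu' | hu' <;>
    rcases lt_or_gt_of_ne (hne t left_mem_uIcc) with ht' | ht'
  · rw [sign_neg hu', sign_neg ht']
  · exact (h0 (hpc.ordConnected.out hmu hmt ⟨hu'.le, ht'.le⟩)).elim
  · exact (h0 (hpc.ordConnected.out hmt hmu ⟨ht'.le, hu'.le⟩)).elim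
  · rw [sign_pos hu', sign_pos ht']

/-- To the right of a point which is not a root, a cell either is unbounded or ends in a root. -/
theorem unbounded_or_root (hI : I.Finite) (ht : ∀ i ∈ I, L i ≠ 0 → (L i).eval t ≠ 0) :
    (∀ u, t ≤ u → SameCell L I t u) ∨
      ∃ b, t < b ∧ (∃ i ∈ I, L i ≠ 0 ∧ (L i).eval b = 0) ∧
        ∀ u, t ≤ u → u < b → SameCell L I t u := by
  classical
  set Z : Set ℝ := {b | t < b ∧ ∃ i ∈ I, L i ≠ 0 ∧ (L i).eval b = 0} with hZ
  have hfin : Z.Finite := by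
    refine (hI.biUnion (t := fun i => {b | L i ≠ 0 ∧ (L i).eval b = 0}) fun i _ => ?_).subset ?_
    · by_cases h0 : L i = 0
      · simp [h0]
      · refine (Polynomial.finite_setOfPred_isRoot h0).subset fun b hb => hb.2
    · rintro b ⟨-, i, hi, hb⟩
      exact mem_biUnion hi hb
  have main : ∀ u, t ≤ u → (∀ b ∈ Z, u < b) → SameCell L I t u := by
    intro u htu hu
    refine of_ne_zero fun i hi h0 v hv hv0 => ?_
    rw [uIcc_of_le htu] at hv
    rcases hv.1.eq_or_lt with rfl | htv
    · exact ht i hi h0 hv0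
    · exact absurd (hu v ⟨htv, i, hi, h0, hv0⟩) hv.2.not_gt
  rcases Z.eq_empty_or_nonempty with he | hne
  · left
    intro u hu
    exact main u hu (by simp [he])
  · right
    obtain ⟨b, hb, hmin⟩ := hfin.exists_minimal hne
    refine ⟨b, hb.1, hb.2, fun u hu hub => main u hu fun c hc => ?_⟩
    by_contra! hcu
    exact absurd (hmin hc (hcu.trans hub.le)) (hcu.trans_lt hub).not_ge

end SameCell

/-- `R` matches the sign diagrams of two families of polynomials, preserving the order of the
cells. -/
structure DiagramEquiv {ι : Type*} (L₁ L₂ : ι → Polynomial ℝ) (I : Set ι) (R : ℝ → ℝ → Prop) :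
    Prop where
  total_left : ∀ t, ∃ t', R t t'
  total_right : ∀ t', ∃ t, R t t'
  sign_eq : ∀ t t', R t t' → ∀ i ∈ I,
    SignType.sign ((L₁ i).eval t) = SignType.sign ((L₂ i).eval t')
  cross : ∀ t t' s s', R t t' → R s s' → t < s → s' < t' → SameCell L₁ I t s

namespace DiagramEquiv

variable {ι : Type*} {L₁ L₂ : ι → Polynomial ℝ} {I J : Set ι} {R : ℝ → ℝ → Prop}
  {t s t' s' : ℝ}

theorem mono (h : DiagramEquiv L₁ L₂ I R) (hJ : J ⊆ I) : DiagramEquiv L₁ L₂ J R where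
  total_left := h.total_left
  total_right := h.total_right
  sign_eq := fun _ _ ht i hi => h.sign_eq _ _ ht i (hJ hi)
  cross := fun _ _ _ _ h₁ h₂ h₃ h₄ => (h.cross _ _ _ _ h₁ h₂ h₃ h₄).mono hJ

theorem sameCell_of_le (h : DiagramEquiv L₁ L₂ I R) (ht : R t t') (hs : R s s') (hts : t ≤ s)
    (hc : SameCell L₁ I t s) : SameCell L₂ I t' s' := by
  have key : ∀ u' ∈ uIcc t' s', ∃ u, R u u' ∧ SameCell L₁ I t u := by
    intro u' hu'
    by_cases e1 : u' = t'
    · exact ⟨t, e1 ▸ ht, .refl _ _ _⟩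
    by_cases e2 : u' = s'
    · exact ⟨s, e2 ▸ hs, hc⟩
    obtain ⟨u, hu⟩ := h.total_right u'
    refine ⟨u, hu, ?_⟩
    have hlt : t' < u' ∧ u' < s' ∨ s' < u' ∧ u' < t' := by
      rcases mem_uIcc.1 hu' with ⟨h1, h2⟩ | ⟨h1, h2⟩
      · left; exact ⟨lt_of_le_of_ne h1 (Ne.symm e1), lt_of_le_of_ne h2 e2⟩
      · right; exact ⟨lt_of_le_of_ne h1 (Ne.symm e2), lt_of_le_of_ne h2 e1⟩
    rcases lt_or_ge u t with hut | htu
    · rcases hlt with ⟨h1, h2⟩ | ⟨h1, h2⟩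
      · exact (h.cross _ _ _ _ hu ht hut h1).symm
      · exact hc.trans (h.cross _ _ _ _ hu hs (hut.trans_le hts) h1).symm
    rcases lt_or_ge s u with hsu | hus
    · rcases hlt with ⟨h1, h2⟩ | ⟨h1, h2⟩
      · exact hc.trans (h.cross _ _ _ _ hs hu hsu h2)
      · exact h.cross _ _ _ _ ht hu (hts.trans_lt hsu) h2
    · exact hc.sub (mem_uIcc.2 (Or.inl ⟨htu, hus⟩))
  intro i hi u' hu'
  obtain ⟨u, hu, hcu⟩ := key u' hu'
  rw [← h.sign_eq _ _ hu i hi, ← h.sign_eq _ _ ht i hi, hcu.sign_eq hi]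

theorem sameCell (h : DiagramEquiv L₁ L₂ I R) (ht : R t t') (hs : R s s')
    (hc : SameCell L₁ I t s) : SameCell L₂ I t' s' := by
  rcases le_total t s with hts | hst
  · exact h.sameCell_of_le ht hs hts hc
  · exact (h.sameCell_of_le hs ht hst hc.symm).symm

theorem symm (h : DiagramEquiv L₁ L₂ I R) : DiagramEquiv L₂ L₁ I (fun a b => R b a) where
  total_left := h.total_right
  total_right := h.total_left
  sign_eq := fun _ _ ht i hi => (h.sign_eq _ _ ht i hi).symm
  cross := fun _ _ _ _ h₁ h₂ h₃ h₄ =>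
    h.sameCell h₁ h₂ (h.cross _ _ _ _ h₂ h₁ h₄ h₃).symm

theorem eq_zero_iff (h : DiagramEquiv L₁ L₂ I R) {i : ι} (hi : i ∈ I) : L₁ i = 0 ↔ L₂ i = 0 := by
  have key : ∀ {M₁ M₂ : ι → Polynomial ℝ} {Q : ℝ → ℝ → Prop}, DiagramEquiv M₁ M₂ I Q →
      M₁ i = 0 → M₂ i = 0 := by
    intro M₁ M₂ Q hQ h0
    refine Polynomial.funext fun t' => ?_
    obtain ⟨t, ht⟩ := hQ.total_right t'
    have := hQ.sign_eq _ _ ht i hi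
    rw [h0, Polynomial.eval_zero, sign_zero, eq_comm, sign_eq_zero_iff] at this
    rw [this, Polynomial.eval_zero]
  exact ⟨key h, key h.symm⟩

/-- The relation between cells generated by a relation between points. -/
theorem saturate (h : DiagramEquiv L₁ L₂ I R) :
    DiagramEquiv L₁ L₂ I
      (fun t t' => ∃ w w', R w w' ∧ SameCell L₁ I w t ∧ SameCell L₂ I w' t') where
  total_left := fun t => by
    obtain ⟨t', ht⟩ := h.total_left t
    exact ⟨t', t, t', ht, .refl _ _ _, .refl _ _ _⟩
  total_right := fun t' => by
    obtain ⟨t, ht⟩ := h.total_right t'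
    exact ⟨t, t, t', ht, .refl _ _ _, .refl _ _ _⟩
  sign_eq := by
    rintro t t' ⟨w, w', hw, hwt, hwt'⟩ i hi
    rw [hwt.sign_eq hi, hwt'.sign_eq hi, h.sign_eq _ _ hw i hi]
  cross := by
    rintro t t' s s' ⟨w, w', hw, hwt, hwt'⟩ ⟨v, v', hv, hvs, hvs'⟩ hts hst'
    by_contra hn
    have hwv : w < v := SameCell.lt_of_lt hts hn hwt.symm hvs.symm
    have hnwv : ¬ SameCell L₁ I w v := fun hc => hn ((hwt.symm.trans hc).trans hvs)
    have hn' : ¬ SameCell L₂ I s' t' := fun hc =>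
      hnwv (h.symm.sameCell hv hw ((hvs'.trans hc).trans hwt'.symm)).symm
    have hvw' : v' < w' := SameCell.lt_of_lt hst' hn' hvs'.symm hwt'.symm
    exact hnwv (h.cross _ _ _ _ hw hv hwv hvw')

theorem reflect (h : DiagramEquiv L₁ L₂ I R) :
    DiagramEquiv (fun i => (L₁ i).comp (-Polynomial.X)) (fun i => (L₂ i).comp (-Polynomial.X)) I
      (fun t t' => R (-t) (-t')) where
  total_left := fun t => by
    obtain ⟨t', ht⟩ := h.total_left (-t)
    exact ⟨-t', by simpa using ht⟩
  total_right := fun t' => by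
    obtain ⟨t, ht⟩ := h.total_right (-t')
    exact ⟨-t, by simpa using ht⟩
  sign_eq := fun _ _ ht i hi => by simpa using h.sign_eq _ _ ht i hi
  cross := fun _ _ _ _ h₁ h₂ h₃ h₄ => SameCell.reflect.2
    (h.cross _ _ _ _ h₂ h₁ (neg_lt_neg h₃) (neg_lt_neg h₄)).symm

end DiagramEquiv

namespace DiagramEquiv

variable {ι : Type*} {L₁ L₂ : ι → Polynomial ℝ} {I J : Set ι} {R : ℝ → ℝ → Prop}
  {t s t' s' : ℝ}

theorem exists_pos_of_deriv_pos (h : DiagramEquiv L₁ L₂ I R) (hI : I.Finite)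
    {p₁ p₂ : Polynomial ℝ}
    (hd : ∀ u u', R u u' → SignType.sign ((Polynomial.derivative p₁).eval u) =
      SignType.sign ((Polynomial.derivative p₂).eval u'))
    (hd' : ∀ u v, SameCell L₂ I u v → SignType.sign ((Polynomial.derivative p₂).eval u) =
      SignType.sign ((Polynomial.derivative p₂).eval v))
    (hroot : ∀ u u', R u u' → (∃ i ∈ I, L₁ i ≠ 0 ∧ (L₁ i).eval u = 0) →
      SignType.sign (p₁.eval u) = SignType.sign (p₂.eval u'))
    (ht : R t t') (hopen : ∀ i ∈ I, L₁ i ≠ 0 → (L₁ i).eval t ≠ 0)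
    (hpos : 0 < p₁.eval t) (hdt : 0 < (Polynomial.derivative p₁).eval t) :
    ∃ u', SameCell L₂ I t' u' ∧ 0 < p₂.eval u' := by
  have hopen' : ∀ i ∈ I, L₂ i ≠ 0 → (L₂ i).eval t' ≠ 0 := by
    intro i hi h0 h1
    refine hopen i hi (fun h2 => h0 ((h.eq_zero_iff hi).1 h2)) ?_
    rw [← sign_eq_zero_iff, h.sign_eq _ _ ht i hi, h1, sign_zero]
  have hdt' : 0 < (Polynomial.derivative p₂).eval t' := by
    rw [← sign_eq_one_iff, ← hd _ _ ht, sign_eq_one_iff]; exact hdt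
  have hcell : ∀ u, SameCell L₂ I t' u → 0 < (Polynomial.derivative p₂).eval u := by
    intro u hu
    rw [← sign_eq_one_iff, ← hd' _ _ hu, sign_eq_one_iff]; exact hdt'
  rcases SameCell.unbounded_or_root hI hopen' with hunb | ⟨b, hb, ⟨i, hi, hi0, hib⟩, hcb⟩
  · have hmono : MonotoneOn (fun x => p₂.eval x) (Ici t') := by
      refine monotoneOn_of_deriv_nonneg (convex_Ici _) p₂.continuous.continuousOn
        p₂.differentiable.differentiableOn fun x hx => ?_
      rw [interior_Ici] at hx
      rw [Polynomial.deriv]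
      exact (hcell x (hunb x hx.le)).le
    have hdeg : 0 < p₂.degree := by
      rw [← Polynomial.natDegree_pos_iff_degree_pos]
      by_contra! h0
      rw [Nat.le_zero] at h0
      rw [Polynomial.derivative_of_natDegree_zero h0] at hdt'
      simp at hdt'
    obtain ⟨u, hu, hut⟩ := (((p₂.abs_tendsto_atTop hdeg).eventually_gt_atTop
      |p₂.eval t'|).and (Filter.eventually_ge_atTop t')).exists
    refine ⟨u, hunb u hut, ?_⟩
    have h1 : p₂.eval t' ≤ p₂.eval u := hmono (mem_Ici.2 le_rfl) hut hut
    by_contra! h2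
    rw [abs_of_nonpos h2, abs_of_nonpos (h1.trans h2)] at hu
    linarith
  · obtain ⟨c, hc⟩ := h.total_right b
    have hic : (L₁ i).eval c = 0 := by
      rw [← sign_eq_zero_iff, h.sign_eq _ _ hc i hi, hib, sign_zero]
    have hi0' : L₁ i ≠ 0 := fun h0 => hi0 ((h.eq_zero_iff hi).1 h0)
    have htc : t < c := by
      rcases lt_trichotomy t c with h1 | h1 | h1
      · exact h1
      · exact (hopen i hi hi0' (h1 ▸ hic)).elim
      · have := (h.cross _ _ _ _ hc ht h1 hb).sign_eq hi
        rw [hic, sign_zero, sign_eq_zero_iff] at this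
        exact (hopen i hi hi0' this).elim
    have hdb : 0 ≤ (Polynomial.derivative p₂).eval b := by
      have hcl : IsClosed {x | 0 ≤ (Polynomial.derivative p₂).eval x} :=
        isClosed_le continuous_const (Polynomial.derivative p₂).continuous
      have hsub : Ioo t' b ⊆ {x | 0 ≤ (Polynomial.derivative p₂).eval x} :=
        fun x hx => (hcell x (hcb x hx.1.le hx.2)).le
      have := closure_minimal hsub hcl
      rw [closure_Ioo hb.ne] at this
      exact this (right_mem_Icc.2 hb.le)
    have hmono : MonotoneOn (fun x => p₁.eval x) (Icc t c) := by
      refine monotoneOn_of_deriv_nonneg (convex_Icc _ _) p₁.continuous.continuousOn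
        p₁.differentiable.differentiableOn fun x hx => ?_
      rw [interior_Icc] at hx
      rw [Polynomial.deriv, ← sign_nonneg_iff]
      obtain ⟨x', hx'⟩ := h.total_left x
      rw [hd _ _ hx', sign_nonneg_iff]
      rcases lt_or_ge x' t' with h1 | h1
      · exact (hcell x' (h.sameCell ht hx' (h.cross _ _ _ _ ht hx' hx.1 h1))).le
      rcases lt_trichotomy x' b with h2 | h2 | h2
      · exact (hcell x' (hcb x' h1 h2)).le
      · rw [h2]; exact hdb
      · exact absurd ((h.cross _ _ _ _ hx' hc hx.2 h2).symm.eq_of_root hi hi0' hic) hx.2.ne'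
    have hpc : 0 < p₁.eval c :=
      hpos.trans_le (hmono (left_mem_Icc.2 htc.le) (right_mem_Icc.2 htc.le) htc.le)
    have hpb : 0 < p₂.eval b := by
      rw [← sign_eq_one_iff, ← hroot _ _ hc ⟨i, hi, hi0', hic⟩, sign_eq_one_iff]; exact hpc
    have hev : ∀ᶠ x in nhdsWithin b (Iio b), 0 < p₂.eval x :=
      (p₂.continuous.continuousAt.eventually (lt_mem_nhds hpb)).filter_mono nhdsWithin_le_nhds
    have hev' : ∀ᶠ x in nhdsWithin b (Iio b), x ∈ Ioo t' b := Ioo_mem_nhdsLT hb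
    obtain ⟨x, hx, hx'⟩ := (hev.and hev').exists
    exact ⟨x, hcb x hx'.1.le hx'.2, hx⟩

theorem exists_pos (h : DiagramEquiv L₁ L₂ I R) (hI : I.Finite)
    {p₁ p₂ : Polynomial ℝ}
    (hd : ∀ u u', R u u' → SignType.sign ((Polynomial.derivative p₁).eval u) =
      SignType.sign ((Polynomial.derivative p₂).eval u'))
    (hd' : ∀ u v, SameCell L₂ I u v → SignType.sign ((Polynomial.derivative p₂).eval u) =
      SignType.sign ((Polynomial.derivative p₂).eval v))
    (hroot : ∀ u u', R u u' → (∃ i ∈ I, L₁ i ≠ 0 ∧ (L₁ i).eval u = 0) →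
      SignType.sign (p₁.eval u) = SignType.sign (p₂.eval u'))
    (ht : R t t') (hopen : ∀ i ∈ I, L₁ i ≠ 0 → (L₁ i).eval t ≠ 0)
    (hpos : 0 < p₁.eval t) (hdt : (Polynomial.derivative p₁).eval t ≠ 0) :
    ∃ u', SameCell L₂ I t' u' ∧ 0 < p₂.eval u' := by
  rcases hdt.lt_or_gt with hneg | hdpos
  · obtain ⟨u', hu', hp⟩ := h.reflect.exists_pos_of_deriv_pos hI (t := -t) (t' := -t')
      (p₁ := p₁.comp (-Polynomial.X)) (p₂ := p₂.comp (-Polynomial.X))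
      (fun u u' hu => by
        simpa [Polynomial.derivative_comp, Left.sign_neg] using hd _ _ hu)
      (fun u v hu => by
        simpa [Polynomial.derivative_comp, Left.sign_neg] using hd' _ _ (SameCell.reflect.1 hu))
      (fun u u' hu => by
        rintro ⟨i, hi, h0, h1⟩
        simp only [Polynomial.eval_comp, Polynomial.eval_neg, Polynomial.eval_X] at h1 ⊢
        refine hroot _ _ hu ⟨i, hi, ?_, h1⟩
        rintro h2
        rw [h2] at h0
        simp at h0)
      (by simpa using ht)
      (fun i hi h0 => by
        simp only [Polynomial.eval_comp, Polynomial.eval_neg, Polynomial.eval_X, neg_neg]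
        refine hopen i hi fun h2 => ?_
        rw [h2] at h0
        simp at h0)
      (by simpa using hpos)
      (by simpa [Polynomial.derivative_comp] using hneg)
    refine ⟨-u', ?_, by simpa using hp⟩
    simpa using SameCell.reflect.1 hu'
  · exact h.exists_pos_of_deriv_pos hI hd hd' hroot ht hopen hpos hdpos

theorem exists_neg (h : DiagramEquiv L₁ L₂ I R) (hI : I.Finite)
    {p₁ p₂ : Polynomial ℝ}
    (hd : ∀ u u', R u u' → SignType.sign ((Polynomial.derivative p₁).eval u) =
      SignType.sign ((Polynomial.derivative p₂).eval u'))
    (hd' : ∀ u v, SameCell L₂ I u v → SignType.sign ((Polynomial.derivative p₂).eval u) =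
      SignType.sign ((Polynomial.derivative p₂).eval v))
    (hroot : ∀ u u', R u u' → (∃ i ∈ I, L₁ i ≠ 0 ∧ (L₁ i).eval u = 0) →
      SignType.sign (p₁.eval u) = SignType.sign (p₂.eval u'))
    (ht : R t t') (hopen : ∀ i ∈ I, L₁ i ≠ 0 → (L₁ i).eval t ≠ 0)
    (hneg : p₁.eval t < 0) (hdt : (Polynomial.derivative p₁).eval t ≠ 0) :
    ∃ u', SameCell L₂ I t' u' ∧ p₂.eval u' < 0 := by
  obtain ⟨u', hu', hp⟩ := h.exists_pos hI (p₁ := -p₁) (p₂ := -p₂)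
    (fun u u' hu => by simpa [Left.sign_neg] using hd _ _ hu)
    (fun u v hu => by simpa [Left.sign_neg] using hd' _ _ hu)
    (fun u u' hu hr => by simpa [Left.sign_neg] using hroot _ _ hu hr)
    ht hopen (by simpa using hneg) (by simpa using hdt)
  exact ⟨u', hu', by simpa using hp⟩

theorem _root_.Polynomial.strictMonoOn_of_derivative_pos {p : Polynomial ℝ} {a b : ℝ}
    (h : ∀ x ∈ Icc a b, 0 < (Polynomial.derivative p).eval x) :
    StrictMonoOn (fun x => p.eval x) (Icc a b) := by
  refine strictMonoOn_of_deriv_pos (convex_Icc _ _) p.continuous.continuousOn fun x hx => ?_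
  rw [Polynomial.deriv]
  exact h x (interior_subset hx)

/-- Near a simple point, a polynomial with a zero takes both signs. -/
theorem _root_.Polynomial.exists_pos_neg_of_root {p : Polynomial ℝ} {U : Set ℝ}
    (hU : U ∈ nhds t) (h0 : p.eval t = 0) (hd : (Polynomial.derivative p).eval t ≠ 0) :
    (∃ x ∈ U, 0 < p.eval x) ∧ ∃ x ∈ U, p.eval x < 0 := by
  have key : ∀ q : Polynomial ℝ, q.eval t = 0 → 0 < (Polynomial.derivative q).eval t →
      (∃ x ∈ U, 0 < q.eval x) ∧ ∃ x ∈ U, q.eval x < 0 := by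
    intro q hq hqd
    have hV : U ∩ {x | 0 < (Polynomial.derivative q).eval x} ∈ nhds t :=
      Filter.inter_mem hU
        ((Polynomial.derivative q).continuous.continuousAt.eventually (lt_mem_nhds hqd))
    obtain ⟨ε, hε, hball⟩ := Metric.nhds_basis_closedBall.mem_iff.1 hV
    rw [Real.closedBall_eq_Icc] at hball
    have hm := Polynomial.strictMonoOn_of_derivative_pos (p := q) fun x hx => (hball hx).2
    have m1 : t - ε ∈ Icc (t - ε) (t + ε) := ⟨by linarith, by linarith⟩
    have m2 : t ∈ Icc (t - ε) (t + ε) := ⟨by linarith, by linarith⟩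
    have m3 : t + ε ∈ Icc (t - ε) (t + ε) := ⟨by linarith, by linarith⟩
    have h1 := hm m1 m2 (by linarith)
    have h2 := hm m2 m3 (by linarith)
    simp only [hq] at h1 h2
    exact ⟨⟨_, (hball m3).1, h2⟩, ⟨_, (hball m1).1, h1⟩⟩
  rcases hd.lt_or_gt with hlt | hgt
  · obtain ⟨⟨x, hx, hx'⟩, y, hy, hy'⟩ := key (-p) (by simpa using h0) (by simpa using hlt)
    exact ⟨⟨y, hy, by simpa using hy'⟩, x, hx, by simpa using hx'⟩
  · exact key p h0 hgt

theorem exists_sign_eq (h : DiagramEquiv L₁ L₂ I R) (hI : I.Finite)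
    {p₁ p₂ : Polynomial ℝ}
    (hd : ∀ u u', R u u' → SignType.sign ((Polynomial.derivative p₁).eval u) =
      SignType.sign ((Polynomial.derivative p₂).eval u'))
    (hd' : ∀ u v, SameCell L₂ I u v → SignType.sign ((Polynomial.derivative p₂).eval u) =
      SignType.sign ((Polynomial.derivative p₂).eval v))
    (hroot : ∀ u u', R u u' → (∃ i ∈ I, L₁ i ≠ 0 ∧ (L₁ i).eval u = 0) →
      SignType.sign (p₁.eval u) = SignType.sign (p₂.eval u'))
    (hdt : (∀ i ∈ I, L₁ i ≠ 0 → (L₁ i).eval t ≠ 0) → (Polynomial.derivative p₁).eval t ≠ 0)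
    (ht : R t t') :
    ∃ u', SameCell L₂ I t' u' ∧ SignType.sign (p₂.eval u') = SignType.sign (p₁.eval t) := by
  by_cases hopen : ∀ i ∈ I, L₁ i ≠ 0 → (L₁ i).eval t ≠ 0
  swap
  · push Not at hopen
    exact ⟨t', .refl _ _ _, (hroot _ _ ht hopen).symm⟩
  have hdt := hdt hopen
  rcases lt_trichotomy (p₁.eval t) 0 with hp | hp | hp
  · obtain ⟨u', hu', hp'⟩ := h.exists_neg hI hd hd' hroot ht hopen hp hdt
    exact ⟨u', hu', by rw [sign_neg hp, sign_neg hp']⟩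
  · have hU : {x | ∀ i ∈ I, L₁ i ≠ 0 → (L₁ i).eval x ≠ 0} ∩
        {x | (Polynomial.derivative p₁).eval x ≠ 0} ∈ nhds t := by
      refine Filter.inter_mem ?_ ((Polynomial.derivative p₁).continuous.continuousAt.eventually
        (isOpen_ne.mem_nhds hdt))
      refine (Filter.eventually_all_finite hI).2 fun i hi => ?_
      by_cases h0 : L₁ i = 0
      · simp [h0]
      · filter_upwards [(L₁ i).continuous.continuousAt.eventually
          (isOpen_ne.mem_nhds (hopen i hi h0))] with x hx _ using hx
    obtain ⟨ε, hε, hball⟩ := Metric.nhds_basis_ball.mem_iff.1 hU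
    obtain ⟨⟨x, hx, hxp⟩, y, hy, hyn⟩ :=
      Polynomial.exists_pos_neg_of_root (Metric.ball_mem_nhds t hε) hp hdt
    have hcell : ∀ z ∈ Metric.ball t ε, SameCell L₁ I t z := by
      intro z hz
      refine SameCell.of_ne_zero fun i hi h0 u hu => (hball ?_).1 i hi h0
      have hoc : (Metric.ball t ε).OrdConnected := (convex_ball t ε).ordConnected
      exact hoc.uIcc_subset (Metric.mem_ball_self hε) hz hu
    obtain ⟨x', hx'⟩ := h.total_left x
    obtain ⟨y', hy'⟩ := h.total_left y
    obtain ⟨a, ha, hap⟩ := h.exists_pos hI hd hd' hroot hx' (hball hx).1 hxp (hball hx).2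
    obtain ⟨b, hb, hbn⟩ := h.exists_neg hI hd hd' hroot hy' (hball hy).1 hyn (hball hy).2
    have ha' := (h.sameCell ht hx' (hcell x hx)).trans ha
    have hb' := (h.sameCell ht hy' (hcell y hy)).trans hb
    have hpc := isPreconnected_uIcc.image (fun x => p₂.eval x)
      (s := uIcc a b) p₂.continuous.continuousOn
    obtain ⟨u, hu, hu0⟩ := hpc.ordConnected.out ⟨b, right_mem_uIcc, rfl⟩ ⟨a, left_mem_uIcc, rfl⟩
      ⟨hbn.le, hap.le⟩
    refine ⟨u, ha'.trans ((ha'.symm.trans hb').sub hu), ?_⟩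
    simp only at hu0
    rw [hu0, hp]
  · obtain ⟨u', hu', hp'⟩ := h.exists_pos hI hd hd' hroot ht hopen hp hdt
    exact ⟨u', hu', by rw [sign_pos hp, sign_pos hp']⟩

/-- Along a cell of the derivative, two polynomials that agree in sign at reversed pairs of points
have constant sign. -/
theorem sign_const_of_cross {p₁ p₂ : Polynomial ℝ} (hts : t < s) (hst' : s' < t')
    (h₁ : SignType.sign (p₁.eval t) = SignType.sign (p₂.eval t'))
    (h₂ : SignType.sign (p₁.eval s) = SignType.sign (p₂.eval s'))
    (hd₁ : ∀ u ∈ Icc t s, 0 ≤ (Polynomial.derivative p₁).eval u)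
    (hd₂ : ∀ u ∈ Icc s' t', 0 ≤ (Polynomial.derivative p₂).eval u) :
    ∀ u ∈ Icc t s, SignType.sign (p₁.eval u) = SignType.sign (p₁.eval t) := by
  have mono : ∀ {p : Polynomial ℝ} {a b : ℝ},
      (∀ u ∈ Icc a b, 0 ≤ (Polynomial.derivative p).eval u) →
      MonotoneOn (fun x => p.eval x) (Icc a b) := by
    intro p a b hp
    refine monotoneOn_of_deriv_nonneg (convex_Icc _ _) p.continuous.continuousOn
      p.differentiable.differentiableOn fun x hx => ?_
    rw [Polynomial.deriv]
    exact hp x (interior_subset hx)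
  intro u hu
  have l : t ∈ Icc t s := left_mem_Icc.2 hts.le
  have r : s ∈ Icc t s := right_mem_Icc.2 hts.le
  have a1 := SignType.sign.monotone (mono hd₁ l hu hu.1)
  have a2 := SignType.sign.monotone (mono hd₁ hu r hu.2)
  have a3 := SignType.sign.monotone
    (mono hd₂ (left_mem_Icc.2 hst'.le) (right_mem_Icc.2 hst'.le) hst'.le)
  simp only at a1 a2 a3
  refine le_antisymm (a2.trans ?_) a1
  rw [h₂, h₁]
  exact a3

/-- Adding a polynomial to a family containing its derivative. -/
theorem insert_of_derivative (h : DiagramEquiv L₁ L₂ I R) (hI : I.Finite) {p j : ι} (hj : j ∈ I)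
    (hj₁ : L₁ j = Polynomial.derivative (L₁ p)) (hj₂ : L₂ j = Polynomial.derivative (L₂ p))
    (hj0 : L₁ j ≠ 0)
    (hroot : ∀ u u', R u u' → (∃ i ∈ I, L₁ i ≠ 0 ∧ (L₁ i).eval u = 0) →
      SignType.sign ((L₁ p).eval u) = SignType.sign ((L₂ p).eval u')) :
    ∃ R', DiagramEquiv L₁ L₂ (insert p I) R' := by
  set Q : ℝ → ℝ → Prop := fun t t' => ∃ w w', R w w' ∧ SameCell L₁ I w t ∧ SameCell L₂ I w' t'
    with hQ
  have hs : DiagramEquiv L₁ L₂ I Q := h.saturate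
  have hrootQ : ∀ u u', Q u u' → (∃ i ∈ I, L₁ i ≠ 0 ∧ (L₁ i).eval u = 0) →
      SignType.sign ((L₁ p).eval u) = SignType.sign ((L₂ p).eval u') := by
    rintro u u' hu ⟨i, hi, h0, h1⟩
    obtain ⟨w, w', hw, hwu, hwu'⟩ := id hu
    have h1' : (L₂ i).eval u' = 0 := by
      rw [← sign_eq_zero_iff, ← hs.sign_eq _ _ hu i hi, h1, sign_zero]
    obtain rfl := hwu.symm.eq_of_root hi h0 h1
    obtain rfl := hwu'.symm.eq_of_root hi (fun h2 => h0 ((h.eq_zero_iff hi).2 h2)) h1'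
    exact hroot _ _ hw ⟨i, hi, h0, h1⟩
  have hj0' : L₂ j ≠ 0 := fun h2 => hj0 ((h.eq_zero_iff hj).2 h2)
  have ext : ∀ t t', Q t t' →
      ∃ u', SameCell L₂ I t' u' ∧
        SignType.sign ((L₂ p).eval u') = SignType.sign ((L₁ p).eval t) := by
    intro t t' ht
    refine hs.exists_sign_eq hI (fun u u' hu => ?_) (fun u v hu => ?_) hrootQ (fun ho => ?_) ht
    · rw [← hj₁, ← hj₂]; exact hs.sign_eq _ _ hu j hj
    · rw [← hj₂]; exact (hu.sign_eq hj).symm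
    · rw [← hj₁]; exact ho j hj hj0
  have ext' : ∀ t t', Q t t' →
      ∃ u, SameCell L₁ I t u ∧
        SignType.sign ((L₁ p).eval u) = SignType.sign ((L₂ p).eval t') := by
    intro t t' ht
    refine hs.symm.exists_sign_eq hI (p₁ := L₂ p) (p₂ := L₁ p) (fun u u' hu => ?_)
      (fun u v hu => ?_) ?_ (fun ho => ?_) ht
    · rw [← hj₁, ← hj₂]; exact hs.symm.sign_eq _ _ hu j hj
    · rw [← hj₁]; exact (hu.sign_eq hj).symm
    · rintro u u' hu ⟨i, hi, h0, h1⟩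
      refine (hrootQ _ _ hu ⟨i, hi, fun h2 => h0 ((h.eq_zero_iff hi).1 h2), ?_⟩).symm
      rw [← sign_eq_zero_iff, hs.sign_eq _ _ hu i hi, h1, sign_zero]
    · rw [← hj₂]; exact ho j hj hj0'
  refine ⟨fun t t' => Q t t' ∧ SignType.sign ((L₁ p).eval t) = SignType.sign ((L₂ p).eval t'),
    ?_, ?_, ?_, ?_⟩
  · intro t
    obtain ⟨t', ht⟩ := h.total_left t
    obtain ⟨u', hu', hsg⟩ := ext t t' ⟨t, t', ht, .refl _ _ _, .refl _ _ _⟩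
    exact ⟨u', ⟨t, t', ht, .refl _ _ _, hu'⟩, hsg.symm⟩
  · intro t'
    obtain ⟨t, ht⟩ := h.total_right t'
    obtain ⟨u, hu, hsg⟩ := ext' t t' ⟨t, t', ht, .refl _ _ _, .refl _ _ _⟩
    exact ⟨u, ⟨t, t', ht, hu, .refl _ _ _⟩, hsg⟩
  · rintro t t' ⟨ht, hsg⟩ i (rfl | hi)
    · exact hsg
    · exact hs.sign_eq _ _ ht i hi
  · rintro t t' s s' ⟨ht, hsgt⟩ ⟨hss, hsgs⟩ hts hst'
    have hc := hs.cross _ _ _ _ ht hss hts hst'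
    have hc' := hs.sameCell ht hss hc
    rintro i (rfl | hi) u hu
    swap
    · exact hc i hi u hu
    have d₁ : ∀ u ∈ Icc t s, SignType.sign ((Polynomial.derivative (L₁ i)).eval u) =
        SignType.sign ((Polynomial.derivative (L₁ i)).eval t) := by
      intro u hu
      rw [← hj₁]
      exact hc j hj u (Icc_subset_uIcc hu)
    have d₂ : ∀ u ∈ Icc s' t', SignType.sign ((Polynomial.derivative (L₂ i)).eval u) =
        SignType.sign ((Polynomial.derivative (L₁ i)).eval t) := by
      intro u hu
      rw [← hj₁, ← hj₂, hs.sign_eq _ _ ht j hj]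
      exact hc' j hj u (Icc_subset_uIcc' hu)
    rw [uIcc_of_le hts.le] at hu
    rcases le_total 0 ((Polynomial.derivative (L₁ i)).eval t) with hpos | hneg
    · refine sign_const_of_cross hts hst' hsgt hsgs (fun u hu => ?_) (fun u hu => ?_) u hu
      · rw [← sign_nonneg_iff, d₁ u hu, sign_nonneg_iff]; exact hpos
      · rw [← sign_nonneg_iff, d₂ u hu, sign_nonneg_iff]; exact hpos
    · have := sign_const_of_cross (p₁ := -(L₁ i)) (p₂ := -(L₂ i)) hts hst'
        (by simpa [Left.sign_neg] using hsgt) (by simpa [Left.sign_neg] using hsgs)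
        (fun u hu => ?_) (fun u hu => ?_) u hu
      · simpa [Left.sign_neg] using this
      · simp only [Polynomial.derivative_neg, Polynomial.eval_neg, Left.nonneg_neg_iff]
        rw [← sign_nonpos_iff, d₁ u hu, sign_nonpos_iff]; exact hneg
      · simp only [Polynomial.derivative_neg, Polynomial.eval_neg, Left.nonneg_neg_iff]
        rw [← sign_nonpos_iff, d₂ u hu, sign_nonpos_iff]; exact hneg

/-- Adding a polynomial whose signs are those of a member of the family. -/
theorem insert_of_eq (h : DiagramEquiv L₁ L₂ I R) {p j : ι} (hj : j ∈ I)
    (h₁ : L₁ p = L₁ j) (h₂ : L₂ p = L₂ j) : DiagramEquiv L₁ L₂ (insert p I) R where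
  total_left := h.total_left
  total_right := h.total_right
  sign_eq := by
    rintro t t' ht i (rfl | hi)
    · rw [h₁, h₂]; exact h.sign_eq _ _ ht j hj
    · exact h.sign_eq _ _ ht i hi
  cross := by
    rintro t t' s s' ht hs hts hst' i (rfl | hi) u hu
    · rw [h₁]; exact h.cross _ _ _ _ ht hs hts hst' j hj u hu
    · exact h.cross _ _ _ _ ht hs hts hst' i hi u hu

end DiagramEquiv

section Elimination

variable {A : Type*} [CommRing A]

theorem Polynomial.natDegree_cancelLeads_comm_lt {p q : Polynomial A}
    (h : q.natDegree ≤ p.natDegree) (hp : 0 < p.natDegree) :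
    (Polynomial.C q.leadingCoeff * p - Polynomial.C p.leadingCoeff *
      Polynomial.X ^ (p.natDegree - q.natDegree) * q).natDegree < p.natDegree := by
  have := Polynomial.natDegree_cancelLeads_lt_of_natDegree_le_natDegree h hp
  rwa [Polynomial.cancelLeads, Nat.sub_eq_zero_of_le h, pow_zero, mul_one] at this

/-- Pseudo-division by `q`. -/
theorem Polynomial.exists_pseudo_mod (q : Polynomial A) (hq : 0 < q.natDegree) :
    ∀ (n : ℕ) (p : Polynomial A), p.natDegree ≤ n → ∃ (m : ℕ) (a r : Polynomial A),
      Polynomial.C (q.leadingCoeff ^ m) * p = a * q + r ∧ r.natDegree < q.natDegree := by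
  intro n
  induction n with
  | zero => intro p hp; exact ⟨0, 0, p, by simp, by omega⟩
  | succ n ih =>
    intro p hp
    rcases lt_or_ge p.natDegree q.natDegree with h | h
    · exact ⟨0, 0, p, by simp, h⟩
    · obtain ⟨m, a, r, hr, hd⟩ := ih _ (Nat.le_of_lt_succ
        ((Polynomial.natDegree_cancelLeads_comm_lt h (hq.trans_le h)).trans_le hp))
      refine ⟨m + 1, a + Polynomial.C (q.leadingCoeff ^ m) * (Polynomial.C p.leadingCoeff *
        Polynomial.X ^ (p.natDegree - q.natDegree)), r, ?_, hd⟩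
      rw [pow_succ, Polynomial.C_mul]
      linear_combination hr

variable {X : Type*} (ev : X → A →+* ℝ)

theorem Polynomial.map_eq_map_eraseLead {B : Type*} [CommRing B] (f : A →+* B)
    {p : Polynomial A} (h : f p.leadingCoeff = 0) : p.map f = p.eraseLead.map f := by
  conv_lhs => rw [← p.eraseLead_add_C_mul_X_pow]
  rw [Polynomial.map_add, Polynomial.map_mul, Polynomial.map_C, h, Polynomial.C_0, zero_mul,
    add_zero]

/-- Finitely many polynomials of lower degree determine the sign of `p` at the roots of `q`. -/
theorem exists_finset_sign_at_root (p : Polynomial A) (d : ℕ) :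
    ∀ (n : ℕ) (q : Polynomial A), q.natDegree ≤ n → n ≤ d + 1 →
    ∃ s : Finset (Polynomial A), (∀ r ∈ s, r.natDegree ≤ d) ∧
      ∀ (x y : X) (t t' : ℝ),
        (∀ r ∈ s, SignType.sign ((r.map (ev x)).eval t) = SignType.sign ((r.map (ev y)).eval t')) →
        q.map (ev x) ≠ 0 → (q.map (ev x)).eval t = 0 → (q.map (ev y)).eval t' = 0 →
        SignType.sign ((p.map (ev x)).eval t) = SignType.sign ((p.map (ev y)).eval t') := by
  classical
  intro n
  induction n with
  | zero =>
    intro q hq _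
    refine ⟨∅, by simp, fun x y t t' _ h0 h1 => ?_⟩
    rw [Polynomial.eq_C_of_natDegree_le_zero hq] at h0 h1
    simp only [Polynomial.map_C, Polynomial.eval_C] at h0 h1
    rw [h1] at h0
    simp at h0
  | succ n ih =>
    intro q hq hnd
    obtain ⟨s, hs, hs'⟩ := ih q.eraseLead (q.eraseLead_natDegree_le.trans (by omega)) (by omega)
    rcases Nat.eq_zero_or_pos q.natDegree with hq0 | hq0
    · refine ⟨∅, by simp, fun x y t t' _ h0 h1 => ?_⟩
      rw [Polynomial.eq_C_of_natDegree_le_zero hq0.le] at h0 h1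
      simp only [Polynomial.map_C, Polynomial.eval_C] at h0 h1
      rw [h1] at h0
      simp at h0
    obtain ⟨m, a, r, hr, hrd⟩ := Polynomial.exists_pseudo_mod q hq0 _ p le_rfl
    refine ⟨insert (Polynomial.C q.leadingCoeff)
      (insert (Polynomial.C (q.leadingCoeff ^ m) * r) s), ?_, ?_⟩
    · intro f hf
      simp only [Finset.mem_insert] at hf
      rcases hf with rfl | rfl | hf
      · simp
      · exact (Polynomial.natDegree_C_mul_le _ _).trans (by omega)
      · exact hs f hf
    · intro x y t t' hsg h0 h1 h2
      have hl := hsg _ (Finset.mem_insert_self _ _)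
      simp only [Polynomial.map_C, Polynomial.eval_C] at hl
      have hrs := hsg _ (Finset.mem_insert_of_mem (Finset.mem_insert_self _ _))
      have hrest := fun f hf => hsg f (Finset.mem_insert_of_mem (Finset.mem_insert_of_mem hf))
      by_cases hlx : ev x q.leadingCoeff = 0
      · have hly : ev y q.leadingCoeff = 0 := by
          rw [← sign_eq_zero_iff, ← hl, hlx, sign_zero]
        rw [Polynomial.map_eq_map_eraseLead _ hlx] at h0 h1
        rw [Polynomial.map_eq_map_eraseLead _ hly] at h2
        exact hs' x y t t' hrest h0 h1 h2
      · have hly : ev y q.leadingCoeff ≠ 0 := by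
          rw [← sign_ne_zero, ← hl, sign_ne_zero]; exact hlx
        have key : ∀ (z : X) (u : ℝ), ev z q.leadingCoeff ≠ 0 → (q.map (ev z)).eval u = 0 →
            SignType.sign (((Polynomial.C (q.leadingCoeff ^ m) * r).map (ev z)).eval u) =
              SignType.sign ((p.map (ev z)).eval u) := by
          intro z u hz hu
          have e := congrArg (fun f => (f.map (ev z)).eval u) hr
          simp only [Polynomial.map_mul, Polynomial.map_add, Polynomial.map_C,
            Polynomial.eval_mul, Polynomial.eval_add, Polynomial.eval_C, hu, mul_zero,
            zero_add] at e
          simp only [Polynomial.map_mul, Polynomial.map_C, Polynomial.eval_mul, Polynomial.eval_C]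
          have hz' : ev z (q.leadingCoeff ^ m) ≠ 0 := by
            rw [map_pow]
            exact pow_ne_zero _ hz
          rw [← e, ← mul_assoc, sign_mul, sign_pos (mul_self_pos.2 hz'), one_mul]
        rw [← key x t hlx h1, ← key y t' hly h2]
        exact hrs

/-- Signs of finitely many parameters determine the sign diagram of a finite family of
polynomials in one variable. -/
theorem exists_finset_diagramEquiv : ∀ (d : ℕ) (P : Finset (Polynomial A)),
    (∀ p ∈ P, p.natDegree ≤ d) → ∃ s : Finset A, ∀ x y : X,
      (∀ a ∈ s, SignType.sign (ev x a) = SignType.sign (ev y a)) →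
      ∃ R, DiagramEquiv (fun p : Polynomial A => p.map (ev x)) (fun p => p.map (ev y)) ↑P R := by
  classical
  intro d
  induction d with
  | zero =>
    intro P hP
    refine ⟨P.image fun p => p.coeff 0, fun x y hxy => ⟨fun _ _ => True, fun t => ⟨t, trivial⟩,
      fun t => ⟨t, trivial⟩, fun t t' _ p hp => ?_, fun t t' s s' _ _ _ _ p hp u _ => ?_⟩⟩
    · have := hxy _ (Finset.mem_image_of_mem _ hp)
      rw [Polynomial.eq_C_of_natDegree_le_zero (hP p hp)]
      simpa using this
    · rw [Polynomial.eq_C_of_natDegree_le_zero (hP p hp)]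
      simp
  | succ d ih =>
    have main : ∀ D Q : Finset (Polynomial A), (∀ p ∈ D, p.natDegree ≤ d + 1) →
        (∀ p ∈ Q, p.natDegree ≤ d) → ∃ s : Finset A, ∀ x y : X,
          (∀ a ∈ s, SignType.sign (ev x a) = SignType.sign (ev y a)) →
          ∃ R, DiagramEquiv (fun p : Polynomial A => p.map (ev x)) (fun p => p.map (ev y))
            ↑(Q ∪ D) R := by
      intro D
      induction D using Finset.induction_on with
      | empty =>
        intro Q _ hQ
        simpa using ih Q hQ
      | insert p D hpD ihD =>
        intro Q hD hQ
        have hp : p.natDegree ≤ d + 1 := hD p (Finset.mem_insert_self _ _)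
        have hD' : ∀ q ∈ D, q.natDegree ≤ d + 1 := fun q hq =>
          hD q (Finset.mem_insert_of_mem hq)
        have hpd : (Polynomial.derivative p).natDegree ≤ d :=
          (Polynomial.natDegree_derivative_le p).trans (by omega)
        set I : Finset (Polynomial A) := insert (Polynomial.derivative p) (Q ∪ D) with hI
        have hId : ∀ q ∈ I, q.natDegree ≤ d + 1 := by
          intro q hq
          simp only [hI, Finset.mem_insert, Finset.mem_union] at hq
          rcases hq with rfl | hq | hq
          · omega
          · have := hQ q hq; omega
          · exact hD' q hq
        choose! S hS hS' using fun (q : Polynomial A) (hq : q.natDegree ≤ d + 1) =>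
          exists_finset_sign_at_root ev p d (d + 1) q hq le_rfl
        obtain ⟨s, hs⟩ := ihD (insert (Polynomial.derivative p) (insert p.eraseLead
          (insert (Polynomial.C p.leadingCoeff) (Q ∪ I.biUnion S)))) hD' (by
            intro q hq
            simp only [Finset.mem_insert, Finset.mem_union, Finset.mem_biUnion] at hq
            rcases hq with rfl | rfl | rfl | hq | ⟨r, hr, hq⟩
            · exact hpd
            · exact p.eraseLead_natDegree_le.trans (by omega)
            · simp
            · exact hQ q hq
            · exact hS r (hId r hr) q hq)
        refine ⟨s, fun x y hxy => ?_⟩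
        obtain ⟨R, hR⟩ := hs x y hxy
        have hlead : SignType.sign (ev x p.leadingCoeff) = SignType.sign (ev y p.leadingCoeff) := by
          obtain ⟨t', ht⟩ := hR.total_left 0
          simpa using hR.sign_eq _ _ ht (Polynomial.C p.leadingCoeff) (by simp)
        by_cases hp0 : p.natDegree = 0 ∨ ev x p.leadingCoeff = 0
        · suffices hj : ∃ j, j ∈ (insert (Polynomial.derivative p) (insert p.eraseLead
              (insert (Polynomial.C p.leadingCoeff) (Q ∪ I.biUnion S)))) ∪ D ∧
              p.map (ev x) = j.map (ev x) ∧ p.map (ev y) = j.map (ev y) by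
            obtain ⟨j, hj, h₁, h₂⟩ := hj
            refine ⟨R, (hR.insert_of_eq (p := p) (j := j) hj h₁ h₂).mono ?_⟩
            intro q hq
            simp only [Finset.coe_union, Finset.coe_insert, Finset.coe_biUnion, mem_union,
              mem_insert_iff] at hq ⊢
            tauto
          rcases hp0 with h0 | h0
          · refine ⟨Polynomial.C p.leadingCoeff, by simp, ?_⟩
            have : p = Polynomial.C p.leadingCoeff := by
              rw [Polynomial.leadingCoeff, h0]
              exact Polynomial.eq_C_of_natDegree_le_zero h0.le
            exact ⟨congrArg _ this, congrArg _ this⟩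
          · refine ⟨p.eraseLead, by simp, Polynomial.map_eq_map_eraseLead _ h0,
              Polynomial.map_eq_map_eraseLead _ ?_⟩
            rw [← sign_eq_zero_iff, ← hlead, h0, sign_zero]
        · push Not at hp0
          have hRI : DiagramEquiv (fun p : Polynomial A => p.map (ev x))
              (fun p => p.map (ev y)) ↑I R := by
            refine hR.mono ?_
            intro q hq
            simp only [hI, Finset.coe_union, Finset.coe_insert, Finset.coe_biUnion, mem_union,
              mem_insert_iff] at hq ⊢
            tauto
          obtain ⟨R', hR'⟩ := hRI.insert_of_derivative I.finite_toSet (p := p)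
            (j := Polynomial.derivative p) (by simp [hI])
            (Polynomial.derivative_map _ _).symm (Polynomial.derivative_map _ _).symm
            (by
              rw [← Polynomial.derivative_map]
              intro h0
              have h1 := Polynomial.derivative_eq_zero.1 h0
              rw [Polynomial.natDegree_map_of_leadingCoeff_ne_zero _ hp0.2] at h1
              exact hp0.1 h1)
            (by
              rintro u u' hu ⟨q, hq, h0, h1⟩
              refine hS' q (hId q hq) x y u u' (fun r hr => hR.sign_eq _ _ hu r ?_) h0 h1 ?_
              · simp only [Finset.coe_union, Finset.coe_insert, Finset.coe_biUnion, mem_union,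
                  mem_insert_iff, mem_iUnion]
                exact Or.inl (Or.inr (Or.inr (Or.inr (Or.inr ⟨q, hq, hr⟩))))
              · have := hRI.sign_eq _ _ hu q hq
                rw [h1, sign_zero, eq_comm, sign_eq_zero_iff] at this
                exact this)
          refine ⟨R', hR'.mono ?_⟩
          intro q hq
          simp only [hI, Finset.coe_union, Finset.coe_insert, mem_union, mem_insert_iff] at hq ⊢
          tauto
    intro P hP
    simpa using main P ∅ hP (by simp)

end Elimination

/-- Membership in `D` depends only on the signs of finitely many polynomials. -/
def SignDetermined {σ : Type*} (D : Set (σ → ℝ)) : Prop :=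
  ∃ s : Finset (MvPolynomial σ ℝ), ∀ x y : σ → ℝ,
    (∀ p ∈ s, SignType.sign (MvPolynomial.eval x p) = SignType.sign (MvPolynomial.eval y p)) →
      (x ∈ D ↔ y ∈ D)

namespace SignDetermined

variable {σ τ : Type*} {D E : Set (σ → ℝ)}

theorem empty : SignDetermined (∅ : Set (σ → ℝ)) := ⟨∅, by simp⟩

theorem compl (hD : SignDetermined D) : SignDetermined Dᶜ := by
  obtain ⟨s, hs⟩ := hD
  exact ⟨s, fun x y h => not_congr (hs x y h)⟩

theorem inter (hD : SignDetermined D) (hE : SignDetermined E) : SignDetermined (D ∩ E) := by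
  classical
  obtain ⟨s, hs⟩ := hD
  obtain ⟨t, ht⟩ := hE
  exact ⟨s ∪ t, fun x y h => and_congr (hs x y fun p hp => h p (Finset.mem_union_left _ hp))
    (ht x y fun p hp => h p (Finset.mem_union_right _ hp))⟩

theorem union (hD : SignDetermined D) (hE : SignDetermined E) : SignDetermined (D ∪ E) := by
  rw [← compl_compl (D ∪ E), compl_union]
  exact (hD.compl.inter hE.compl).compl

theorem diff (hD : SignDetermined D) (hE : SignDetermined E) : SignDetermined (D \ E) :=
  hD.inter hE.compl

theorem iUnion {ι : Type*} [Finite ι] {D : ι → Set (σ → ℝ)} (h : ∀ i, SignDetermined (D i)) :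
    SignDetermined (⋃ i, D i) := by
  classical
  cases nonempty_fintype ι
  choose s hs using h
  refine ⟨Finset.univ.biUnion s, fun x y hxy => ?_⟩
  simp only [mem_iUnion]
  exact exists_congr fun i => hs i x y fun p hp =>
    hxy p (Finset.mem_biUnion.2 ⟨i, Finset.mem_univ _, hp⟩)

theorem iInter {ι : Type*} [Finite ι] {D : ι → Set (σ → ℝ)} (h : ∀ i, SignDetermined (D i)) :
    SignDetermined (⋂ i, D i) := by
  rw [← compl_compl (⋂ i, D i), compl_iInter]
  exact (iUnion fun i => (h i).compl).compl

theorem eq_coord (i j : σ) : SignDetermined {x : σ → ℝ | x i = x j} := by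
  refine ⟨{MvPolynomial.X i - MvPolynomial.X j}, fun x y h => ?_⟩
  have := h _ (Finset.mem_singleton_self _)
  simp only [map_sub, MvPolynomial.eval_X] at this
  rw [mem_ofPred_eq, mem_ofPred_eq, ← sub_eq_zero, ← sign_eq_zero_iff, this, sign_eq_zero_iff,
    sub_eq_zero]

theorem preimage_comp (hD : SignDetermined D) (f : σ → τ) :
    SignDetermined {y : τ → ℝ | y ∘ f ∈ D} := by
  classical
  obtain ⟨s, hs⟩ := hD
  refine ⟨s.image (MvPolynomial.rename f), fun x y h => hs _ _ fun p hp => ?_⟩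
  have := h _ (Finset.mem_image_of_mem _ hp)
  rwa [MvPolynomial.eval_rename, MvPolynomial.eval_rename] at this

theorem eval_optionElim (p : MvPolynomial (Option σ) ℝ) (t : ℝ) (z : σ → ℝ) :
    MvPolynomial.eval (fun o => Option.elim o t z) p =
      ((MvPolynomial.optionEquivLeft ℝ σ p).map (MvPolynomial.eval z)).eval t := by
  induction p using MvPolynomial.induction_on with
  | C a => simp
  | add p q hp hq => simp [hp, hq]
  | mul_X p o hp => cases o <;> simp [hp]

theorem exists_option {D : Set (Option σ → ℝ)} (hD : SignDetermined D) :
    SignDetermined {z : σ → ℝ | ∃ t : ℝ, (fun o => Option.elim o t z) ∈ D} := by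
  classical
  obtain ⟨P, hP⟩ := hD
  obtain ⟨s, hs⟩ := exists_finset_diagramEquiv
    (fun z : σ → ℝ => (MvPolynomial.eval z : MvPolynomial σ ℝ →+* ℝ)) _
    (P.image (MvPolynomial.optionEquivLeft ℝ σ)) fun p hp => Finset.le_sup (f := fun p => p.natDegree) hp
  refine ⟨s, fun x y h => ?_⟩
  obtain ⟨R, hR⟩ := hs x y h
  have key : ∀ t t', R t t' →
      ((fun o => Option.elim o t x) ∈ D ↔ (fun o => Option.elim o t' y) ∈ D) := by
    intro t t' ht
    refine hP _ _ fun p hp => ?_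
    rw [eval_optionElim, eval_optionElim]
    exact hR.sign_eq _ _ ht _ (Finset.mem_coe.2 (Finset.mem_image_of_mem _ hp))
  constructor
  · rintro ⟨t, ht⟩
    obtain ⟨t', h'⟩ := hR.total_left t
    exact ⟨t', (key _ _ h').1 ht⟩
  · rintro ⟨t', ht⟩
    obtain ⟨t, h'⟩ := hR.total_right t'
    exact ⟨t, (key _ _ h').2 ht⟩

theorem exists_sum (k : ℕ) : ∀ {D : Set (Fin k ⊕ σ → ℝ)}, SignDetermined D →
    SignDetermined {z : σ → ℝ | ∃ x : Fin k → ℝ, Sum.elim x z ∈ D} := by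
  induction k with
  | zero =>
    intro D hD
    convert hD.preimage_comp (Sum.elim (fun i : Fin 0 => i.elim0) id) using 1
    ext z
    have : ∀ x : Fin 0 → ℝ, Sum.elim x z = z ∘ Sum.elim (fun i : Fin 0 => i.elim0) id := by
      intro x
      funext i
      rcases i with i | i
      · exact i.elim0
      · rfl
    simp [this]
  | succ k ih =>
    intro D hD
    have h := ih (hD.preimage_comp (Sum.elim (fun i : Fin (k + 1) =>
      (Fin.cases none (fun j => some (Sum.inl j)) i : Option (Fin k ⊕ σ)))
      (fun i => some (Sum.inr i)))).exists_option
    convert h using 1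
    ext z
    simp only [mem_ofPred_eq]
    have e : ∀ (x : Fin k → ℝ) (t : ℝ), (fun o => Option.elim o t (Sum.elim x z)) ∘
        (Sum.elim (fun i : Fin (k + 1) =>
          (Fin.cases none (fun j => some (Sum.inl j)) i : Option (Fin k ⊕ σ)))
          (fun i => some (Sum.inr i))) = Sum.elim (Fin.cons t x : Fin (k + 1) → ℝ) z := by
      intro x t
      funext i
      rcases i with i | i
      · refine Fin.cases ?_ (fun j => ?_) i <;> rfl
      · rfl
    simp only [e]
    constructor
    · rintro ⟨x, hx⟩
      exact ⟨Fin.tail x, x 0, by rwa [Fin.cons_self_tail]⟩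
    · rintro ⟨x, t, hx⟩
      exact ⟨_, hx⟩

/-- Existential quantification over points of `D` subject to equations between coordinates. -/
theorem exists_comp_eq {k p : ℕ} {D : Set (Fin k → ℝ)} (hD : SignDetermined D)
    (g : Fin p → Fin k) (h : Fin p → σ) :
    SignDetermined {z : σ → ℝ | ∃ y ∈ D, y ∘ g = z ∘ h} := by
  have h₁ := (hD.preimage_comp (Sum.inl : Fin k → Fin k ⊕ σ)).inter
    (iInter fun i => eq_coord (σ := Fin k ⊕ σ) (Sum.inl (g i)) (Sum.inr (h i)))
  convert exists_sum k h₁ using 1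
  ext z
  simp [funext_iff]

theorem image_comp {k p : ℕ} {D : Set (Fin k → ℝ)} (hD : SignDetermined D) (g : Fin p → Fin k) :
    SignDetermined ((fun x i => x (g i)) '' D) :=
  hD.exists_comp_eq g id

end SignDetermined

theorem IsSemialgebraic.signDetermined {n : ℕ} {A : Set (Fin n → ℝ)} (hA : IsSemialgebraic A) :
    SignDetermined A := by
  classical
  obtain ⟨N, E, I, rfl⟩ := hA
  refine SignDetermined.iUnion fun m => ⟨E m ∪ I m, fun x y h => and_congr
    (forall₂_congr fun p hp => ?_) (forall₂_congr fun p hp => ?_)⟩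
  · rw [← sign_eq_zero_iff, h p (Finset.mem_union_left _ hp), sign_eq_zero_iff]
  · rw [← sign_eq_one_iff, h p (Finset.mem_union_right _ hp), sign_eq_one_iff]

theorem RAE.signDetermined_eval_empty {n : ℕ} : ∀ {k : ℕ} (e : RAE n k), e.ProductFree →
    SignDetermined (e.eval ∅)
  | _, .var, _ => .empty
  | _, .const _ hC, _ => hC.signDetermined
  | _, .union e₁ e₂, h => (e₁.signDetermined_eval_empty h.1).union (e₂.signDetermined_eval_empty h.2)
  | _, .inter e₁ e₂, h => (e₁.signDetermined_eval_empty h.1).inter (e₂.signDetermined_eval_empty h.2)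
  | _, .diff e₁ e₂, h => (e₁.signDetermined_eval_empty h.1).diff (e₂.signDetermined_eval_empty h.2)
  | _, .proj _ g e, h => (e.signDetermined_eval_empty h).image_comp g

/-- The tuple `x` has at least `m` distinct entries. -/
def HasEntries (m : ℕ) {ι α : Type*} (x : ι → α) : Prop :=
  ∃ c : Fin m → ι, Function.Injective (x ∘ c)

namespace HasEntries

variable {m n k p : ℕ} {ι κ α : Type*}

theorem of_comp {y : κ → α} {g : ι → κ} : HasEntries m (y ∘ g) → HasEntries m y
  | ⟨c, hc⟩ => ⟨g ∘ c, hc⟩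

theorem surjective {u : Fin n → α} {f : ι → Fin n} :
    HasEntries n (u ∘ f) → Function.Surjective f
  | ⟨_, hc⟩ => (Finite.surjective_of_injective
      (Function.Injective.of_comp (f := u) hc)).of_comp

theorem of_surjective {u : Fin n → α} (hu : Function.Injective u) {f : ι → Fin n}
    (hf : Function.Surjective f) : HasEntries n (u ∘ f) := by
  obtain ⟨c, hc⟩ := hf.hasRightInverse
  refine ⟨c, ?_⟩
  rwa [Function.comp_assoc, hc.comp_eq_id]

theorem not_succ_comp {u : Fin n → α} {f : ι → Fin n} : ¬ HasEntries (n + 1) (u ∘ f)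
  | ⟨_, hc⟩ => by
    have := Fintype.card_le_of_injective _ (Function.Injective.of_comp (f := u) hc)
    simp at this

theorem not_of_lt {x : Fin k → α} (h : k < n) : ¬ HasEntries n x
  | ⟨_, hc⟩ => by
    have := Fintype.card_le_of_injective _ hc.of_comp
    simp at this
    omega

theorem exists_eq_comp {u : Fin n → α} (hu : Function.Injective u) {y : κ → α} {g : ι → κ}
    {h : ι → Fin n} (hh : Function.Surjective h) (hy : y ∘ g = u ∘ h)
    (hn : ¬ HasEntries (n + 1) y) : ∃ f : κ → Fin n, y = u ∘ f := by
  suffices ∀ i, ∃ j, y i = u j by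
    choose f hf using this
    exact ⟨f, funext hf⟩
  intro i
  by_contra! hi
  obtain ⟨r, hr⟩ := hh.hasRightInverse
  refine hn ⟨Fin.cons i (g ∘ r), ?_⟩
  have e : y ∘ (Fin.cons i (g ∘ r) : Fin (n + 1) → κ) = (Fin.cons (y i) u : Fin (n + 1) → α) := by
    funext j
    refine Fin.cases rfl (fun j => ?_) j
    have := congr_fun hy (r j)
    simp only [Function.comp_apply, hr j] at this
    simpa using this
  rw [e, Fin.cons_injective_iff]
  exact ⟨fun ⟨j, hj⟩ => hi j hj.symm, hu⟩

theorem signDetermined (m k : ℕ) : SignDetermined {y : Fin k → ℝ | HasEntries m y} := by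
  have : {y : Fin k → ℝ | HasEntries m y} = ⋃ c : Fin m → Fin k,
      ⋂ q : {q : Fin m × Fin m // q.1 ≠ q.2}, {y | y (c q.1.1) = y (c q.1.2)}ᶜ := by
    ext y
    simp only [HasEntries, Function.Injective, mem_iUnion, mem_iInter, mem_compl_iff,
      mem_ofPred_eq, Subtype.forall, Prod.forall, Function.comp_apply]
    exact exists_congr fun c => forall₂_congr fun i j => not_imp_not.symm
  rw [this]
  exact .iUnion fun c => .iInter fun q => (SignDetermined.eq_coord _ _).compl

end HasEntries

/-- Points of `U` have no common entries except in equal positions. -/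
def Separated {n : ℕ} (U : Set (Fin n → ℝ)) : Prop :=
  ∀ u ∈ U, ∀ v ∈ U, ∀ i j, u i = v j → i = j

/-- Every polynomial in `s` has constant sign on `U`. -/
def SignConstant {σ : Type*} (s : Finset (MvPolynomial σ ℝ)) (U : Set (σ → ℝ)) : Prop :=
  ∀ p ∈ s, ∀ u ∈ U, ∀ v ∈ U,
    SignType.sign (MvPolynomial.eval u p) = SignType.sign (MvPolynomial.eval v p)

theorem SignConstant.mono {σ : Type*} {s t : Finset (MvPolynomial σ ℝ)} {U : Set (σ → ℝ)}
    (h : SignConstant t U) (hst : s ⊆ t) : SignConstant s U :=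
  fun p hp => h p (hst hp)

theorem SignDetermined.exists_mem_iff {σ ι : Type*} [Finite ι] {D : ι → Set (σ → ℝ)}
    (hD : ∀ i, SignDetermined (D i)) :
    ∃ s : Finset (MvPolynomial σ ℝ), ∀ U, SignConstant s U →
      ∀ i, ∀ u ∈ U, ∀ v ∈ U, (u ∈ D i ↔ v ∈ D i) := by
  classical
  cases nonempty_fintype ι
  choose s hs using hD
  exact ⟨Finset.univ.biUnion s, fun U hU i u hu v hv => hs i u v fun p hp =>
    hU p (Finset.mem_biUnion.2 ⟨i, Finset.mem_univ _, hp⟩) u hu v hv⟩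

/-- `A` and `B` cannot be told apart after forgetting a coordinate, and neither can their
complements in `U`. -/
structure Confusable {n : ℕ} (U A B : Set (Fin n → ℝ)) : Prop where
  subset_left : A ⊆ U
  subset_right : B ⊆ U
  left : ∀ u ∈ A, ∀ j, ∃ v ∈ B, ∀ i, i ≠ j → v i = u i
  right : ∀ u ∈ B, ∀ j, ∃ v ∈ A, ∀ i, i ≠ j → v i = u i
  compl : ∀ u ∈ U, ∀ j, ∃ v ∈ U, v ∉ A ∧ v ∉ B ∧ ∀ i, i ≠ j → v i = u i

theorem Confusable.symm {n : ℕ} {U A B : Set (Fin n → ℝ)} (h : Confusable U A B) :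
    Confusable U B A where
  subset_left := h.subset_right
  subset_right := h.subset_left
  left := h.right
  right := h.left
  compl u hu j := by
    obtain ⟨v, hv, hA, hB, e⟩ := h.compl u hu j
    exact ⟨v, hv, hB, hA, e⟩

/-- The tuple `x` lists all the entries of some point of `U`. -/
def Enumerates {n k : ℕ} (U : Set (Fin n → ℝ)) (x : Fin k → ℝ) : Prop :=
  ∃ u ∈ U, ∃ f : Fin k → Fin n, Function.Surjective f ∧ x = u ∘ f

/-- `D` depends on the set `S` in a way that is controlled by the booleans `a f` and `b f`: on
tuples enumerating `u ∈ U` by `f`, membership in `D` depends only on whether `u ∈ S`, and on other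
tuples with at least `n` distinct entries, `D` agrees with `D₀`. -/
structure Controlled {n k : ℕ} (U S : Set (Fin n → ℝ)) (a b : (Fin k → Fin n) → Prop)
    (D₀ D : Set (Fin k → ℝ)) : Prop where
  mem_iff : ∀ u ∈ U, ∀ f : Fin k → Fin n, Function.Surjective f →
    (u ∘ f ∈ D ↔ u ∈ S ∧ a f ∨ u ∉ S ∧ b f)
  mem_iff_of_not_enumerates : ∀ x, HasEntries n x → ¬ Enumerates U x → (x ∈ D ↔ x ∈ D₀)

namespace Controlled

variable {n k p : ℕ} {U S : Set (Fin n → ℝ)} {a b a' b' : (Fin k → Fin n) → Prop}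
  {D₀ D D₀' D' : Set (Fin k → ℝ)}

theorem union (h : Controlled U S a b D₀ D) (h' : Controlled U S a' b' D₀' D') :
    Controlled U S (fun f => a f ∨ a' f) (fun f => b f ∨ b' f) (D₀ ∪ D₀') (D ∪ D') where
  mem_iff u hu f hf := by
    rw [mem_union, h.mem_iff u hu f hf, h'.mem_iff u hu f hf]; tauto
  mem_iff_of_not_enumerates x hx hU := by
    rw [mem_union, mem_union, h.mem_iff_of_not_enumerates x hx hU,
      h'.mem_iff_of_not_enumerates x hx hU]

theorem inter (h : Controlled U S a b D₀ D) (h' : Controlled U S a' b' D₀' D') :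
    Controlled U S (fun f => a f ∧ a' f) (fun f => b f ∧ b' f) (D₀ ∩ D₀') (D ∩ D') where
  mem_iff u hu f hf := by
    rw [mem_inter_iff, h.mem_iff u hu f hf, h'.mem_iff u hu f hf]; tauto
  mem_iff_of_not_enumerates x hx hU := by
    rw [mem_inter_iff, mem_inter_iff, h.mem_iff_of_not_enumerates x hx hU,
      h'.mem_iff_of_not_enumerates x hx hU]

theorem diff (h : Controlled U S a b D₀ D) (h' : Controlled U S a' b' D₀' D') :
    Controlled U S (fun f => a f ∧ ¬ a' f) (fun f => b f ∧ ¬ b' f) (D₀ \ D₀') (D \ D') where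
  mem_iff u hu f hf := by
    rw [mem_sdiff, h.mem_iff u hu f hf, h'.mem_iff u hu f hf]; tauto
  mem_iff_of_not_enumerates x hx hU := by
    rw [mem_sdiff, mem_sdiff, h.mem_iff_of_not_enumerates x hx hU,
      h'.mem_iff_of_not_enumerates x hx hU]

theorem const (h : ∀ f : Fin k → Fin n, ∀ u ∈ U, ∀ v ∈ U, (u ∘ f ∈ D ↔ v ∘ f ∈ D)) :
    Controlled U S (fun f => ∃ u ∈ U, u ∘ f ∈ D) (fun f => ∃ u ∈ U, u ∘ f ∈ D) D D where
  mem_iff u hu f _ := by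
    have : u ∘ f ∈ D ↔ ∃ u ∈ U, u ∘ f ∈ D :=
      ⟨fun h' => ⟨u, hu, h'⟩, fun ⟨v, hv, h'⟩ => (h f u hu v hv).2 h'⟩
    rw [← this, ← or_and_right, and_iff_right (em _)]
  mem_iff_of_not_enumerates _ _ _ := Iff.rfl

theorem self (hU : Separated U) (hS : S ⊆ U) :
    Controlled U S (fun f => f = id) (fun _ => False) ∅ S where
  mem_iff u hu f _ := by
    constructor
    · intro h
      obtain rfl : f = id := funext fun i => hU u hu _ (hS h) _ _ rfl
      exact Or.inl ⟨h, rfl⟩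
    · rintro (⟨h, rfl⟩ | ⟨_, h⟩)
      · exact h
      · exact h.elim
  mem_iff_of_not_enumerates x _ hx :=
    ⟨fun h => hx ⟨x, hS h, id, Function.surjective_id, rfl⟩, False.elim⟩

theorem proj (hU : Separated U) (g : Fin p → Fin k) (h : Controlled U S a b D₀ D)
    {c : (Fin p → Fin n) → Prop}
    (hc : ∀ f, ∀ u ∈ U, c f ↔ ∃ y ∈ D₀ ∩ {y | HasEntries (n + 1) y}, y ∘ g = u ∘ f) :
    Controlled U S (fun f => (∃ f', f' ∘ g = f ∧ a f') ∨ c f)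
      (fun f => (∃ f', f' ∘ g = f ∧ b f') ∨ c f)
      ((fun x i => x (g i)) '' D₀) ((fun x i => x (g i)) '' D) where
  mem_iff u hu f hf := by
    have inj : Function.Injective u := fun i j => hU u hu u hu i j
    have hne : ∀ y : Fin k → ℝ, HasEntries (n + 1) y → HasEntries n y ∧ ¬ Enumerates U y := by
      rintro y hy
      refine ⟨?_, ?_⟩
      · obtain ⟨d, hd⟩ := hy
        exact ⟨d ∘ Fin.castSucc, hd.comp (Fin.castSucc_injective n)⟩
      · rintro ⟨v, -, d, -, rfl⟩
        exact HasEntries.not_succ_comp hy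
    have key : u ∘ f ∈ (fun x i => x (g i)) '' D ↔
        (∃ f', f' ∘ g = f ∧ u ∘ f' ∈ D) ∨ c f := by
      rw [hc f u hu]
      constructor
      · rintro ⟨y, hy, hyu⟩
        change y ∘ g = u ∘ f at hyu
        by_cases hw : HasEntries (n + 1) y
        · exact Or.inr ⟨y, ⟨(h.mem_iff_of_not_enumerates y (hne y hw).1 (hne y hw).2).1 hy, hw⟩, hyu⟩
        · obtain ⟨f', rfl⟩ := HasEntries.exists_eq_comp inj hf hyu hw
          exact Or.inl ⟨f', funext fun i => inj (congr_fun hyu i), hy⟩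
      · rintro (⟨f', rfl, hf'⟩ | ⟨y, ⟨hy, hw⟩, hyu⟩)
        · exact ⟨_, hf', rfl⟩
        · exact ⟨y, (h.mem_iff_of_not_enumerates y (hne y hw).1 (hne y hw).2).2 hy, hyu⟩
    rw [key]
    have : (∃ f', f' ∘ g = f ∧ u ∘ f' ∈ D) ↔
        ∃ f', f' ∘ g = f ∧ (u ∈ S ∧ a f' ∨ u ∉ S ∧ b f') := by
      refine exists_congr fun f' => and_congr_right fun e => h.mem_iff u hu f' ?_
      subst e
      exact hf.of_comp
    rw [this]
    by_cases hS : u ∈ S <;> simp [hS]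
  mem_iff_of_not_enumerates x hx hxU := by
    refine exists_congr fun y => and_congr_left fun e => ?_
    change y ∘ g = x at e
    subst e
    refine h.mem_iff_of_not_enumerates y hx.of_comp ?_
    rintro ⟨u, hu, f, -, rfl⟩
    exact hxU ⟨u, hu, f ∘ g, hx.surjective (u := u), rfl⟩

/-- Projections of controlled sets cannot tell confusable sets apart on tuples with few entries. -/
theorem image_subset {A B : Set (Fin n → ℝ)} {DA DB : Set (Fin k → ℝ)} (hU : Separated U)
    (hAB : Confusable U A B) (hA : Controlled U A a b D₀ DA) (hB : Controlled U B a b D₀ DB)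
    (hlow : ∀ y, ¬ HasEntries n y → (y ∈ DA ↔ y ∈ DB)) (g : Fin p → Fin k) {x : Fin p → ℝ}
    (hx : ¬ HasEntries n x) (hxA : x ∈ (fun x i => x (g i)) '' DA) :
    x ∈ (fun x i => x (g i)) '' DB := by
  obtain ⟨y, hy, rfl⟩ := hxA
  by_cases hn : HasEntries n y
  · by_cases he : Enumerates U y
    · obtain ⟨u, hu, f, hf, rfl⟩ := he
      have inj : Function.Injective u := fun i j => hU u hu u hu i j
      have : ∃ j, ∀ i, f (g i) ≠ j := by
        by_contra! hs
        exact hx (HasEntries.of_surjective inj (f := f ∘ g) hs)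
      obtain ⟨j, hj⟩ := this
      rcases (hA.mem_iff u hu f hf).1 hy with ⟨hS, ha⟩ | ⟨-, hb⟩
      · obtain ⟨v, hv, e⟩ := hAB.left u hS j
        exact ⟨v ∘ f, (hB.mem_iff v (hAB.subset_right hv) f hf).2 (Or.inl ⟨hv, ha⟩),
          funext fun i => e _ (hj i)⟩
      · obtain ⟨v, hv, -, hvB, e⟩ := hAB.compl u hu j
        exact ⟨v ∘ f, (hB.mem_iff v hv f hf).2 (Or.inr ⟨hvB, hb⟩), funext fun i => e _ (hj i)⟩
    · exact ⟨y, (hB.mem_iff_of_not_enumerates y hn he).2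
        ((hA.mem_iff_of_not_enumerates y hn he).1 hy), rfl⟩
  · exact ⟨y, (hlow y hn).1 hy, rfl⟩

end Controlled

/-- The expression `e` treats `A` and `B` alike near `U`. -/
def RAE.Indistinct {n k : ℕ} (e : RAE n k) (U A B : Set (Fin n → ℝ)) : Prop :=
  (∀ x, ¬ HasEntries n x → (x ∈ e.eval A ↔ x ∈ e.eval B)) ∧
    ∃ a b : (Fin k → Fin n) → Prop, Controlled U A a b (e.eval ∅) (e.eval A) ∧
      Controlled U B a b (e.eval ∅) (e.eval B)

theorem Separated.not_hasEntries_of_not_mem {n : ℕ} {U : Set (Fin n → ℝ)} (hU : Separated U)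
    {x : Fin n → ℝ} (hx : ¬ HasEntries n x) : x ∉ U :=
  fun h => hx ⟨id, fun i j => hU x h x h i j⟩

theorem RAE.exists_indistinct {n : ℕ} : ∀ {k : ℕ} (e : RAE n k), e.ProductFree →
    ∃ s : Finset (MvPolynomial (Fin n) ℝ), ∀ U A B, Separated U → Confusable U A B →
      SignConstant s U → e.Indistinct U A B := by
  classical
  have two : ∀ {k : ℕ} {e e₁ e₂ : RAE n k},
      (∃ s : Finset (MvPolynomial (Fin n) ℝ), ∀ U A B, Separated U → Confusable U A B →
        SignConstant s U → e₁.Indistinct U A B) →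
      (∃ s : Finset (MvPolynomial (Fin n) ℝ), ∀ U A B, Separated U → Confusable U A B →
        SignConstant s U → e₂.Indistinct U A B) →
      (∀ U A B, e₁.Indistinct U A B → e₂.Indistinct U A B → e.Indistinct U A B) →
      ∃ s : Finset (MvPolynomial (Fin n) ℝ), ∀ U A B, Separated U → Confusable U A B →
        SignConstant s U → e.Indistinct U A B := by
    rintro k e e₁ e₂ ⟨s, hs⟩ ⟨t, ht⟩ h
    exact ⟨s ∪ t, fun U A B hU hAB hc => h U A B
      (hs U A B hU hAB (hc.mono Finset.subset_union_left))
      (ht U A B hU hAB (hc.mono Finset.subset_union_right))⟩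
  intro k e
  induction e with
  | var =>
    intro _
    refine ⟨∅, fun U A B hU hAB _ => ⟨fun x hx => ?_, _, _, .self hU hAB.subset_left,
      .self hU hAB.subset_right⟩⟩
    have := hU.not_hasEntries_of_not_mem hx
    exact iff_of_false (fun h => this (hAB.subset_left h)) fun h => this (hAB.subset_right h)
  | @const k C hC =>
    intro _
    obtain ⟨s, hs⟩ := SignDetermined.exists_mem_iff fun f : Fin k → Fin n =>
      hC.signDetermined.preimage_comp f
    exact ⟨s, fun U A B _ _ hc => ⟨fun _ _ => Iff.rfl, _, _, .const (hs U hc), .const (hs U hc)⟩⟩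
  | union e₁ e₂ ih₁ ih₂ =>
    intro h
    refine two (ih₁ h.1) (ih₂ h.2) ?_
    rintro U A B ⟨l₁, a₁, b₁, hA₁, hB₁⟩ ⟨l₂, a₂, b₂, hA₂, hB₂⟩
    exact ⟨fun x hx => or_congr (l₁ x hx) (l₂ x hx), _, _, hA₁.union hA₂, hB₁.union hB₂⟩
  | inter e₁ e₂ ih₁ ih₂ =>
    intro h
    refine two (ih₁ h.1) (ih₂ h.2) ?_
    rintro U A B ⟨l₁, a₁, b₁, hA₁, hB₁⟩ ⟨l₂, a₂, b₂, hA₂, hB₂⟩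
    exact ⟨fun x hx => and_congr (l₁ x hx) (l₂ x hx), _, _, hA₁.inter hA₂, hB₁.inter hB₂⟩
  | diff e₁ e₂ ih₁ ih₂ =>
    intro h
    refine two (ih₁ h.1) (ih₂ h.2) ?_
    rintro U A B ⟨l₁, a₁, b₁, hA₁, hB₁⟩ ⟨l₂, a₂, b₂, hA₂, hB₂⟩
    exact ⟨fun x hx => and_congr (l₁ x hx) (not_congr (l₂ x hx)), _, _, hA₁.diff hA₂,
      hB₁.diff hB₂⟩
  | prod => exact fun h => h.elim
  | @proj k p g e ih =>
    intro h
    obtain ⟨s, hs⟩ := ih h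
    obtain ⟨t, ht⟩ := SignDetermined.exists_mem_iff fun f : Fin p → Fin n =>
      ((e.signDetermined_eval_empty h).inter (HasEntries.signDetermined (n + 1) k)).exists_comp_eq
        g f
    refine ⟨s ∪ t, fun U A B hU hAB hc => ?_⟩
    obtain ⟨hlow, a, b, hA, hB⟩ := hs U A B hU hAB (hc.mono Finset.subset_union_left)
    have hc' : ∀ f, ∀ u ∈ U,
        (∃ v ∈ U, ∃ y ∈ e.eval ∅ ∩ {y | HasEntries (n + 1) y}, y ∘ g = v ∘ f) ↔
          ∃ y ∈ e.eval ∅ ∩ {y | HasEntries (n + 1) y}, y ∘ g = u ∘ f := fun f u hu =>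
      ⟨fun ⟨v, hv, h⟩ => (ht U (hc.mono Finset.subset_union_right) f u hu v hv).2 h,
        fun h => ⟨u, hu, h⟩⟩
    exact ⟨fun x hx => ⟨Controlled.image_subset hU hAB hA hB hlow g hx,
        Controlled.image_subset hU hAB.symm hB hA (fun y hy => (hlow y hy).symm) g hx⟩,
      _, _, hA.proj hU g hc', hB.proj hU g hc'⟩

/-- The squared Euclidean distance. -/
def sqDist {n : ℕ} (a x : Fin n → ℝ) : ℝ := ∑ i, (x i - a i) ^ 2

section sqDist

variable {n : ℕ} (a : Fin n → ℝ)

theorem continuous_sqDist : Continuous (sqDist a) := by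
  unfold sqDist
  fun_prop

theorem sqDist_self : sqDist a a = 0 := by simp [sqDist]

theorem sqDist_eq_zero {x : Fin n → ℝ} : sqDist a x = 0 ↔ x = a := by
  refine ⟨fun h => funext fun i => ?_, fun h => h ▸ sqDist_self a⟩
  have := (Finset.sum_eq_zero_iff_of_nonneg fun i _ => sq_nonneg (x i - a i)).1 h i
    (Finset.mem_univ i)
  nlinarith

theorem sq_sub_le_sqDist (x : Fin n → ℝ) (i : Fin n) : (x i - a i) ^ 2 ≤ sqDist a x :=
  Finset.single_le_sum (f := fun i => (x i - a i) ^ 2) (fun _ _ => sq_nonneg _) (Finset.mem_univ i)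

theorem sqDist_update (j : Fin n) (t : ℝ) : sqDist a (Function.update a j t) = (t - a j) ^ 2 := by
  rw [sqDist, Finset.sum_eq_single j]
  · simp
  · intro i _ hi
    simp [hi]
  · simp

/-- The polynomial computing the squared distance to `a`. -/
noncomputable def sqDistPoly : MvPolynomial (Fin n) ℝ :=
  ∑ i, (MvPolynomial.X i - MvPolynomial.C (a i)) ^ 2

theorem eval_sqDistPoly (x : Fin n → ℝ) : MvPolynomial.eval x (sqDistPoly a) = sqDist a x := by
  simp [sqDistPoly, sqDist]

theorem isSemialgebraic_zeros (p : MvPolynomial (Fin n) ℝ) :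
    IsSemialgebraic {x | MvPolynomial.eval x p = 0} :=
  ⟨1, fun _ => {p}, fun _ => ∅, by ext x; simp⟩

theorem isSemialgebraic_sphere (r : ℝ) : IsSemialgebraic {x | sqDist a x = r ^ 2} := by
  convert isSemialgebraic_zeros (sqDistPoly a - MvPolynomial.C (r ^ 2)) using 1
  ext x
  simp [eval_sqDistPoly, sub_eq_zero]

theorem isSemialgebraic_insert_sphere (r : ℝ) :
    IsSemialgebraic (insert a {x | sqDist a x = r ^ 2}) := by
  convert isSemialgebraic_zeros (sqDistPoly a * (sqDistPoly a - MvPolynomial.C (r ^ 2))) using 1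
  ext x
  simp [eval_sqDistPoly, sub_eq_zero, sqDist_eq_zero]

theorem isConnected_sqDist_sphere (hn : 1 < n) {r : ℝ} (hr : 0 ≤ r) :
    IsConnected {x | sqDist a x = r ^ 2} := by
  have h : IsConnected (Metric.sphere (WithLp.toLp 2 a : EuclideanSpace ℝ (Fin n)) r) := by
    refine isConnected_sphere ?_ _ hr
    rw [← Module.finrank_eq_rank, finrank_euclideanSpace_fin]
    exact_mod_cast hn
  convert h.image _ (PiLp.continuous_ofLp 2 (fun _ : Fin n => ℝ)).continuousOn using 1
  ext x
  simp only [mem_image, Metric.mem_sphere, EuclideanSpace.dist_eq, Real.dist_eq, sq_abs,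
    Real.sqrt_eq_iff_eq_sq (Finset.sum_nonneg fun i _ => sq_nonneg _) hr, mem_ofPred_eq, sqDist]
  exact ⟨fun h => ⟨WithLp.toLp 2 x, h, rfl⟩, fun ⟨y, hy, e⟩ => e ▸ hy⟩

theorem not_isPreconnected_insert_sphere {r : ℝ} (hr : 0 < r)
    (hne : {x | sqDist a x = r ^ 2}.Nonempty) :
    ¬ IsPreconnected (insert a {x | sqDist a x = r ^ 2}) := by
  intro h
  have h' := (h.image _ (continuous_sqDist a).continuousOn).ordConnected
  obtain ⟨y, hy⟩ := hne
  have hr2 : 0 < r ^ 2 := by positivity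
  have := h'.out ⟨a, mem_insert _ _, rfl⟩ ⟨y, mem_insert_of_mem _ hy, rfl⟩
    (show r ^ 2 / 2 ∈ Icc (sqDist a a) (sqDist a y) by
      rw [sqDist_self, show sqDist a y = r ^ 2 from hy]; constructor <;> linarith)
  obtain ⟨z, rfl | hz, e⟩ := this
  · rw [sqDist_self] at e; linarith
  · rw [show sqDist a z = r ^ 2 from hz] at e; linarith

theorem confusable_sphere {r ε : ℝ} (hr : 0 < r) (hε : r < ε) :
    Confusable (Metric.ball a ε) {x | sqDist a x = r ^ 2}
      (insert a {x | sqDist a x = r ^ 2}) := by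
  have hεp : 0 < ε := hr.trans hε
  have hsub : {x | sqDist a x = r ^ 2} ⊆ Metric.ball a ε := by
    intro x hx
    rw [Metric.mem_ball, dist_pi_lt_iff hεp]
    intro i
    have h1 := sq_sub_le_sqDist a x i
    rw [show sqDist a x = r ^ 2 from hx] at h1
    exact (abs_le_of_sq_le_sq h1 hr.le).trans_lt hε
  refine ⟨hsub, insert_subset (Metric.mem_ball_self hεp) hsub,
    fun u hu j => ⟨u, Or.inr hu, fun _ _ => rfl⟩, ?_, ?_⟩
  · rintro u (rfl | hu) j
    · refine ⟨Function.update u j (u j + r), ?_, fun i hi => by simp [hi]⟩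
      rw [mem_ofPred_eq, sqDist_update]
      ring
    · exact ⟨u, hu, fun _ _ => rfl⟩
  · intro u hu j
    obtain ⟨t, ht1, ht2⟩ := exists_between hε
    have hA : sqDist a (Function.update u j (a j + t)) ≠ r ^ 2 := by
      have := sq_sub_le_sqDist a (Function.update u j (a j + t)) j
      simp only [Function.update_self, add_sub_cancel_left] at this
      nlinarith
    refine ⟨Function.update u j (a j + t), ?_, hA, ?_, fun i hi => by simp [hi]⟩
    · rw [Metric.mem_ball, dist_pi_lt_iff hεp] at hu ⊢
      intro i
      rcases eq_or_ne i j with rfl | hi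
      · simp [abs_of_pos (hr.trans ht1), ht2]
      · simpa [hi] using hu i
    · rintro (h | h)
      · have := congr_fun h j
        simp only [Function.update_self] at this
        linarith
      · exact hA h

end sqDist

theorem separated_ball {n : ℕ} {a : Fin n → ℝ} {ε : ℝ}
    (h : ∀ i j, i ≠ j → ∀ u ∈ Metric.ball a ε, u i ≠ u j) : Separated (Metric.ball a ε) := by
  intro u hu v hv i j e
  by_contra hij
  have hε : 0 < ε := Metric.pos_of_mem_ball hu
  refine h i j hij (Function.update u j (v j)) ?_ (by simp [hij, e])
  rw [Metric.mem_ball, dist_pi_lt_iff hε] at *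
  intro k
  rcases eq_or_ne k j with rfl | hk
  · simpa using hv k
  · simpa [hk] using hu k

/-- Finitely many polynomials have constant sign near a generic point, where the nonzero ones do
not vanish. -/
theorem exists_ball_signConstant {n : ℕ} (s : Finset (MvPolynomial (Fin n) ℝ)) :
    ∃ (a : Fin n → ℝ) (ε : ℝ), 0 < ε ∧ SignConstant s (Metric.ball a ε) ∧
      ∀ p ∈ s, p ≠ 0 → ∀ u ∈ Metric.ball a ε, MvPolynomial.eval u p ≠ 0 := by
  classical
  have hP : (∏ p ∈ s.filter (· ≠ 0), p) ≠ 0 :=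
    Finset.prod_ne_zero_iff.2 fun p hp => (Finset.mem_filter.1 hp).2
  obtain ⟨a, ha⟩ : ∃ a, MvPolynomial.eval a (∏ p ∈ s.filter (· ≠ 0), p) ≠ 0 := by
    by_contra! h
    exact hP (MvPolynomial.funext fun x => by simpa using h x)
  rw [map_prod, Finset.prod_ne_zero_iff] at ha
  have hev : ∀ p ∈ s, ∀ᶠ u in nhds a,
      SignType.sign (MvPolynomial.eval u p) = SignType.sign (MvPolynomial.eval a p) := by
    intro p hp
    by_cases h0 : p = 0
    · simp [h0]
    have hc : Filter.Tendsto (fun u => MvPolynomial.eval u p) (nhds a)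
        (nhds (MvPolynomial.eval a p)) := (MvPolynomial.continuous_eval p).continuousAt
    rcases lt_or_gt_of_ne (ha p (Finset.mem_filter.2 ⟨hp, h0⟩)) with h | h
    · filter_upwards [hc.eventually_lt_const h] with u hu
      rw [sign_neg hu, sign_neg h]
    · filter_upwards [hc.eventually_const_lt h] with u hu
      rw [sign_pos hu, sign_pos h]
  obtain ⟨ε, hε, hball⟩ := Metric.eventually_nhds_iff_ball.1
    ((Filter.eventually_all_finset s).2 hev)
  refine ⟨a, ε, hε, fun p hp u hu v hv => (hball u hu p hp).trans (hball v hv p hp).symm,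
    fun p hp h0 u hu h => ha p (Finset.mem_filter.2 ⟨hp, h0⟩) ?_⟩
  rw [← sign_eq_zero_iff, ← hball u hu p hp, h, sign_zero]

theorem stmt18 (n : ℕ) (hn : 2 < n) (ℓ : ℕ) (e : Fin ℓ → RAE n (n - 1))
    (hpf : ∀ i, (e i).ProductFree) :
    ∃ A B : Set (Fin n → ℝ), IsSemialgebraic A ∧ IsSemialgebraic B ∧
      IsConnected A ∧ ¬ IsPreconnected B ∧
      ∀ i, (e i).eval A = (e i).eval B := by
  classical
  choose s hs using fun i => (e i).exists_indistinct (hpf i)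
  let t : Finset (MvPolynomial (Fin n) ℝ) :=
    Finset.univ.image fun q : Fin n × Fin n => MvPolynomial.X q.1 - MvPolynomial.X q.2
  obtain ⟨a, ε, hε, hsign, hne⟩ := exists_ball_signConstant (Finset.univ.biUnion s ∪ t)
  have hsep : Separated (Metric.ball a ε) := separated_ball fun i j hij u hu h => by
    refine hne (MvPolynomial.X i - MvPolynomial.X j) (Finset.mem_union_right _
      (Finset.mem_image.2 ⟨(i, j), Finset.mem_univ _, rfl⟩)) ?_ u hu (by simp [h])
    rw [sub_ne_zero]
    exact fun h => hij (MvPolynomial.X_injective h)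
  have hconn := isConnected_sqDist_sphere a (by omega) (half_pos hε).le
  refine ⟨_, _, isSemialgebraic_sphere a (ε / 2), isSemialgebraic_insert_sphere a (ε / 2), hconn,
    not_isPreconnected_insert_sphere a (half_pos hε) hconn.nonempty, fun i => ext fun x => ?_⟩
  exact (hs i _ _ _ hsep (confusable_sphere a (half_pos hε) (half_lt_self hε))
    (hsign.mono fun p hp => Finset.mem_union_left _
      (Finset.mem_biUnion.2 ⟨i, Finset.mem_univ _, hp⟩))).1 x
    (HasEntries.not_of_lt (by omega))
end

section
/- Let e₁, …, e_ℓ be finitely many binary positive one-pass relational algebra expressions over a set variable S ranging over subsets of ℝ³. Then there exist semi-algebraic sets A, B ⊆ ℝ³ such that A is connected, B is disconnected, and eᵢ(A) = eᵢ(B) for all i = 1, …, ℓ. -/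
open Set

theorem isIntegral_of_pow_mem_span {R A ι : Type*} [CommRing R] [CommRing A] [Algebra R A]
    [Fintype ι] (x : ι → A) (m : ℕ)
    (h : ∀ i, x i ^ m ∈
      Submodule.span R ((fun α : ι →₀ ℕ ↦ ∏ j, x j ^ α j) '' {α | α.degree < m})) (i : ι) :
    IsIntegral R (x i) := by
  classical
  set mon : (ι →₀ ℕ) → A := fun α ↦ ∏ j, x j ^ α j with hmon
  have mon_add (α β : ι →₀ ℕ) : mon (α + β) = mon α * mon β := by
    simp [hmon, pow_add, Finset.prod_mul_distrib]
  have mon_single (i : ι) (k : ℕ) : mon (Finsupp.single i k) = x i ^ k := by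
    simp only [hmon]
    rw [Finset.prod_eq_single i] <;> simp +contextual [eq_comm]
  set W : Submodule R A := Submodule.span R (mon '' {α | ∀ j, α j < m}) with hW
  have mem_W : ∀ N, ∀ α : ι →₀ ℕ, α.degree = N → mon α ∈ W := by
    intro N
    induction N using Nat.strong_induction_on with
    | _ N ih =>
      intro α hα
      by_cases hlt : ∀ j, α j < m
      · exact Submodule.subset_span ⟨α, hlt, rfl⟩
      push Not at hlt
      obtain ⟨j, hj⟩ := hlt
      obtain ⟨α', rfl⟩ : ∃ α', α = α' + Finsupp.single j m :=
        ⟨α - Finsupp.single j m, (tsub_add_cancel_of_le (by simpa using hj)).symm⟩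
      rw [mon_add, mon_single]
      have key : Submodule.span R (mon '' {α | α.degree < m}) ≤
          W.comap (LinearMap.mulLeft R (mon α')) := by
        rw [Submodule.span_le]
        rintro _ ⟨β, hβ, rfl⟩
        simp only [Submodule.comap_coe, mem_preimage, LinearMap.mulLeft_apply, SetLike.mem_coe]
        rw [← mon_add]
        refine ih _ ?_ _ rfl
        rw [← hα]
        simpa using hβ
      exact key (h j)
  have range_eq : Subalgebra.toSubmodule (MvPolynomial.aeval (R := R) x).range = W := by
    apply le_antisymm
    · rintro _ ⟨p, rfl⟩
      simp only [AlgHom.toRingHom_eq_coe, RingHom.coe_coe]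
      rw [MvPolynomial.aeval_def, MvPolynomial.eval₂_eq']
      refine Submodule.sum_mem _ fun α _ ↦ ?_
      rw [← Algebra.smul_def]
      exact W.smul_mem _ (mem_W _ α rfl)
    · rw [hW, Submodule.span_le]
      rintro _ ⟨α, -, rfl⟩
      exact (Subalgebra.mem_toSubmodule _).2 <| prod_mem fun j _ ↦
        pow_mem ((AlgHom.mem_range _).2 ⟨MvPolynomial.X j, MvPolynomial.aeval_X _ _⟩) _
  refine IsIntegral.of_mem_of_fg (MvPolynomial.aeval (R := R) x).range ?_ _
    ((AlgHom.mem_range _).2 ⟨MvPolynomial.X i, MvPolynomial.aeval_X _ _⟩)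
  rw [range_eq]
  refine Submodule.fg_span (Finite.image _ ?_)
  exact (Set.finite_Iic (Finsupp.equivFunOnFinite.symm fun _ ↦ m)).subset
    fun α hα j ↦ (hα j).le

theorem card_le_of_algebraicIndependent_of_isAlgebraic {k B θ ω : Type*} [Field k] [CommRing B]
    [IsDomain B] [Algebra k B] [Fintype θ] [Fintype ω] (v : θ → B) (w : ω → B)
    (hw : AlgebraicIndependent k w)
    (halg : ∀ j, IsAlgebraic (Algebra.adjoin k (range v)) (w j)) :
    Fintype.card ω ≤ Fintype.card θ := by
  have hind : (AlgebraicIndependent.matroid k B).Indep (range w) :=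
    AlgebraicIndependent.matroid_indep_iff.2 hw.coe_range
  have hsub : range w ⊆ (AlgebraicIndependent.matroid k B).closure (range v) := by
    rw [AlgebraicIndependent.matroid_closure_eq]
    rintro _ ⟨j, rfl⟩
    exact halg j
  have h := (AlgebraicIndependent.matroid k B).eRk_mono hsub
  rw [hind.eRk_eq_encard, Matroid.eRk_closure_eq] at h
  have h₁ : (range w).encard = Fintype.card ω := by
    rw [← image_univ, hw.injective.injOn.encard_image, encard_univ, ENat.card_eq_coe_fintype_card]
  have h₂ : (range v).encard ≤ Fintype.card θ := by
    rw [← image_univ]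
    exact (encard_image_le _ _).trans_eq
      (by rw [encard_univ, ENat.card_eq_coe_fintype_card])
  have := (h₁.symm.trans_le h).trans ((Matroid.eRk_le_encard _ _).trans h₂)
  exact_mod_cast this

/-- Algebraic independence survives in a suitable integral quotient. -/
theorem AlgebraicIndependent.exists_isPrime_quotient {k A ω : Type*} [Field k] [CommRing A]
    [Algebra k A] {w : ω → A} (hw : AlgebraicIndependent k w) :
    ∃ p : Ideal A, p.IsPrime ∧ AlgebraicIndependent k (fun j ↦ Ideal.Quotient.mkₐ k p (w j)) := by
  let S : Submonoid A :=
    (nonZeroDivisors (MvPolynomial ω k)).map (MvPolynomial.aeval w : MvPolynomial ω k →ₐ[k] A)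
  have hS : Disjoint ((⊥ : Ideal A) : Set A) S := by
    rw [Set.disjoint_left]
    rintro _ h ⟨q, hq, rfl⟩
    refine nonZeroDivisors.ne_zero hq (hw ?_)
    simpa using h
  obtain ⟨p, hp, -, hd⟩ := Ideal.exists_le_prime_disjoint ⊥ S hS
  refine ⟨p, hp, algebraicIndependent_iff.2 fun q hq ↦ ?_⟩
  by_contra h0
  refine Set.disjoint_left.1 hd ?_ ⟨q, mem_nonZeroDivisors_of_ne_zero h0, rfl⟩
  have : Ideal.Quotient.mkₐ k p (MvPolynomial.aeval w q) = 0 := by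
    rw [← hq, ← MvPolynomial.comp_aeval_apply]
  exact Ideal.Quotient.eq_zero_iff_mem.1 this

/-- If each `x i` is the root of a monic equation `x i ^ m = δ * g i (y, x)` with `deg (g i) < m`,
then the algebra generated by `δ`, `y` and `x` has transcendence degree at most `1 + #τ`. -/
theorem not_algebraicIndependent_of_pow_eq {k A τ ι σ : Type*} [Field k] [CommRing A] [Algebra k A]
    [Fintype τ] [Fintype ι] [Fintype σ] (hcard : Fintype.card τ < Fintype.card σ)
    (δ : A) (y : τ → A) (x : ι → A) (f : σ → ι) (m : ℕ) (g : ι → MvPolynomial (τ ⊕ ι) k)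
    (hg : ∀ i, (g i).totalDegree < m)
    (hx : ∀ i, x i ^ m = δ * MvPolynomial.aeval (Sum.elim y x) (g i)) :
    ¬ AlgebraicIndependent k (fun o : Option σ ↦ o.elim δ (x ∘ f)) := by
  intro hw
  obtain ⟨p, hp, hw⟩ := hw.exists_isPrime_quotient
  set π := Ideal.Quotient.mkₐ k p
  let v : Option τ → A ⧸ p := fun o ↦ o.elim (π δ) (π ∘ y)
  have hv (o) : v o ∈ Algebra.adjoin k (range v) := Algebra.subset_adjoin ⟨o, rfl⟩
  have hint : ∀ i, IsIntegral (Algebra.adjoin k (range v)) (π (x i)) := by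
    refine isIntegral_of_pow_mem_span (fun i ↦ π (x i)) m fun i ↦ ?_
    rw [← map_pow, hx, map_mul, MvPolynomial.comp_aeval_apply, MvPolynomial.aeval_def,
      MvPolynomial.eval₂_eq', Finset.mul_sum]
    refine Submodule.sum_mem _ fun α hα ↦ ?_
    have hr : π δ * (algebraMap k (A ⧸ p) ((g i).coeff α) * ∏ t, v (some t) ^ α (Sum.inl t)) ∈
        Algebra.adjoin k (range v) :=
      mul_mem (hv none) (mul_mem (algebraMap_mem _ _) (prod_mem fun t _ ↦ pow_mem (hv _) _))
    have : π δ * (algebraMap k (A ⧸ p) ((g i).coeff α) *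
          ∏ s, π (Sum.elim y x s) ^ α s) =
        (⟨_, hr⟩ : Algebra.adjoin k (range v)) • ∏ j, π (x j) ^ α (Sum.inr j) := by
      rw [Subalgebra.smul_def, smul_eq_mul, Fintype.prod_sum_type]
      simp [v, mul_assoc]
    refine this ▸ Submodule.smul_mem _ _ (Submodule.subset_span
      ⟨α.comapDomain Sum.inr Sum.inr_injective.injOn, ?_, by simp⟩)
    have h₁ := (MvPolynomial.le_totalDegree hα).trans_lt (hg i)
    refine lt_of_le_of_lt ?_ h₁
    change _ ≤ α.degree
    rw [Finsupp.degree_eq_sum, Finsupp.degree_eq_sum,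
      Fintype.sum_sum_type]
    exact Nat.le_add_left _ _
  have := card_le_of_algebraicIndependent_of_isAlgebraic v _ hw (fun o ↦ by
    rcases o with _ | s
    · exact isAlgebraic_algebraMap (⟨_, hv none⟩ : Algebra.adjoin k (range v))
    · exact (hint (f s)).isAlgebraic)
  simp only [Fintype.card_option] at this
  omega

theorem isCompact_sum_pow_le {ι : Type*} [Fintype ι] {d : ℕ} (hd : Even d) (hd₀ : d ≠ 0) (c : ℝ) :
    IsCompact {x : ι → ℝ | ∑ i, x i ^ d ≤ c} := by
  have hbox : IsCompact (univ.pi fun _ : ι ↦ Icc (-(1 + |c|)) (1 + |c|)) :=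
    isCompact_univ_pi fun _ ↦ isCompact_Icc
  refine hbox.of_isClosed_subset (isClosed_le (by fun_prop) continuous_const) fun x hx i _ ↦ ?_
  have h₁ : x i ^ d ≤ c :=
    (Finset.single_le_sum (fun j _ ↦ hd.pow_nonneg (x j)) (Finset.mem_univ i)).trans hx
  rw [mem_Icc, ← abs_le]
  by_contra! h
  have h₂ : |x i| ≤ |x i| ^ d := le_self_pow₀ (by linarith [abs_nonneg c]) hd₀
  rw [hd.pow_abs] at h₂
  linarith [le_abs_self c]

open Filter Topology in
theorem eval_leadingCoeff_eq_zero_of_tendsto {σ : Type*} [Finite σ]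
    (p : Polynomial (MvPolynomial σ ℝ)) {s : ℕ → σ → ℝ} {s₀ : σ → ℝ} {δ : ℕ → ℝ}
    (hs : Tendsto s atTop (𝓝 s₀)) (hδ : Tendsto δ atTop atTop)
    (h : ∀ k, (p.map (MvPolynomial.eval (s k))).eval (δ k) = 0) :
    MvPolynomial.eval s₀ p.leadingCoeff = 0 := by
  have hcoeff (i : ℕ) : Tendsto (fun k ↦ MvPolynomial.eval (s k) (p.coeff i)) atTop
      (𝓝 (MvPolynomial.eval s₀ (p.coeff i))) :=
    ((MvPolynomial.continuous_eval _).tendsto _).comp hs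
  have hlow : Tendsto (fun k ↦ ∑ i ∈ Finset.range p.natDegree,
      MvPolynomial.eval (s k) (p.coeff i) * (δ k ^ i / δ k ^ p.natDegree)) atTop (𝓝 0) := by
    rw [← Finset.sum_const_zero (s := Finset.range p.natDegree)]
    refine tendsto_finsetSum _ fun i hi ↦ ?_
    simpa using (hcoeff i).mul
      ((tendsto_pow_div_pow_atTop_zero (𝕜 := ℝ) (Finset.mem_range.1 hi)).comp hδ)
  refine tendsto_nhds_unique (hcoeff p.natDegree) ?_
  rw [← neg_zero]
  refine hlow.neg.congr' ?_
  filter_upwards [hδ.eventually_gt_atTop 0] with k hk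
  have h := h k
  rw [Polynomial.eval_map, Polynomial.eval₂_eq_sum_range, Finset.sum_range_succ] at h
  have hk' : δ k ^ p.natDegree ≠ 0 := by positivity
  simp_rw [← mul_div_assoc, ← Finset.sum_div]
  field_simp
  linarith

theorem MvPolynomial.hasDerivAt_eval_update {ι : Type*} [DecidableEq ι] (p : MvPolynomial ι ℝ)
    (x : ι → ℝ) (i : ι) (t : ℝ) :
    HasDerivAt (fun t ↦ eval (Function.update x i t) p)
      (eval (Function.update x i t) (pderiv i p)) t := by
  induction p using MvPolynomial.induction_on with
  | C a => simpa using hasDerivAt_const t a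
  | add p q hp hq => simpa using hp.fun_add hq
  | mul_X p j hp =>
    have hX : HasDerivAt (fun t ↦ Function.update x i t j) ((Pi.single i 1 : ι → ℝ) j) t :=
      hasDerivAt_pi.1 (hasDerivAt_update x i t) j
    refine ((hp.fun_mul hX).congr_deriv ?_).congr_of_eventuallyEq (.of_forall fun t ↦ by simp)
    rw [Derivation.leibniz]
    simp [pderiv_X, Pi.single_apply]
    split_ifs <;> simp_all <;> ring

theorem exists_forall_add_mul_sum_pow_le {ι : Type*} [Fintype ι] {q : (ι → ℝ) → ℝ}
    (hq : Continuous q) (hq₀ : ∀ x, 0 ≤ q x) {x₀ : ι → ℝ} (hx₀ : q x₀ = 0) {ε : ℝ} (hε : 0 < ε)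
    {d : ℕ} (hd : Even d) (hd₀ : d ≠ 0) :
    ∃ x, ∀ x', q x + ε * ∑ i, x i ^ d ≤ q x' + ε * ∑ i, x' i ^ d := by
  have hK : IsCompact {x : ι → ℝ | ∑ i, x i ^ d ≤ ∑ i, x₀ i ^ d} :=
    isCompact_sum_pow_le hd hd₀ _
  obtain ⟨x, hxK, hx⟩ := hK.exists_isMinOn ⟨x₀, le_refl (∑ i, x₀ i ^ d)⟩
    (f := fun x ↦ q x + ε * ∑ i, x i ^ d) (by fun_prop)
  refine ⟨x, fun x' ↦ ?_⟩
  by_cases hx' : x' ∈ {x : ι → ℝ | ∑ i, x i ^ d ≤ ∑ i, x₀ i ^ d}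
  · exact hx hx'
  · have h₁ : q x + ε * ∑ i, x i ^ d ≤ q x₀ + ε * ∑ i, x₀ i ^ d := hx (le_refl (∑ i, x₀ i ^ d))
    have h₂ : ∑ i, x₀ i ^ d < ∑ i, x' i ^ d := not_le.1 hx'
    have h₃ := mul_lt_mul_of_pos_left h₂ hε
    have := hq₀ x'
    simp only [hx₀] at h₁
    linarith

theorem MvPolynomial.pow_eq_of_forall_add_mul_sum_pow_le {τ ι : Type*} [Fintype ι]
    (Q : MvPolynomial (τ ⊕ ι) ℝ) (y : τ → ℝ) {x : ι → ℝ} {ε : ℝ} (hε : 0 < ε) (m : ℕ)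
    (hx : ∀ x', eval (Sum.elim y x) Q + ε * ∑ i, x i ^ (m + 1) ≤
      eval (Sum.elim y x') Q + ε * ∑ i, x' i ^ (m + 1)) (i : ι) :
    x i ^ m = ε⁻¹ * eval (Sum.elim y x) (C (-((m : ℝ) + 1)⁻¹) * pderiv (Sum.inr i) Q) := by
  classical
  have h₁ := hasDerivAt_eval_update Q (Sum.elim y x) (Sum.inr i) (x i)
  have h₂ : HasDerivAt (fun t ↦ ∑ j, Function.update x i t j ^ (m + 1))
      ((m + 1) * x i ^ m) (x i) := by
    have (j : ι) : HasDerivAt (fun t ↦ Function.update x i t j ^ (m + 1))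
        ((m + 1 : ℕ) * Function.update x i (x i) j ^ m * (Pi.single i 1 : ι → ℝ) j) (x i) := by
      simpa using (hasDerivAt_pi.1 (hasDerivAt_update x i (x i)) j).fun_pow (m + 1)
    refine (HasDerivAt.fun_sum fun j (_ : j ∈ Finset.univ) ↦ this j).congr_deriv ?_
    simp [Pi.single_apply]
  have hupd : Function.update (Sum.elim y x) (Sum.inr i) (x i) = Sum.elim y x :=
    Function.update_eq_self (Sum.inr i) (Sum.elim y x)
  have hmin : IsLocalMin (fun t ↦ eval (Function.update (Sum.elim y x) (Sum.inr i) t) Q +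
      ε * ∑ j, Function.update x i t j ^ (m + 1)) (x i) := by
    refine Filter.Eventually.of_forall fun t ↦ ?_
    simpa only [hupd, Function.update_eq_self, Sum.update_elim_inr] using hx (Function.update x i t)
  have h := hmin.hasDerivAt_eq_zero (h₁.add (h₂.const_mul ε))
  rw [hupd] at h
  simp only [map_mul, eval_C]
  field_simp
  linarith

theorem MvPolynomial.aeval_pi_apply {Z κ R : Type*} [CommSemiring R] (v : κ → Z → R)
    (p : MvPolynomial κ R) (z : Z) : aeval v p z = eval (fun j ↦ v j z) p := by
  have := comp_aeval_apply (φ := Pi.evalAlgHom R (fun _ : Z ↦ R) z) (f := v) p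
  simpa [aeval_eq_eval] using this

open Filter Topology in
/-- The real zero sets `{x | P (y, x) = 0}`, when nonempty, all contain a point whose coordinates
along `f` lie on one fixed hypersurface, as soon as there are fewer parameters `y` than coordinates
selected by `f`. The point is a limit, as `ε → 0`, of minimizers of `P ^ 2 + ε * ∑ i, x i ^ d`. -/
theorem exists_hypersurface_meeting_fibers {τ ι σ : Type*} [Fintype τ] [Fintype ι] [Fintype σ]
    (hcard : Fintype.card τ < Fintype.card σ) (P : MvPolynomial (τ ⊕ ι) ℝ) (f : σ → ι) :
    ∃ H : MvPolynomial σ ℝ, H ≠ 0 ∧ ∀ y, (∃ x, MvPolynomial.eval (Sum.elim y x) P = 0) →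
      ∃ x, MvPolynomial.eval (Sum.elim y x) P = 0 ∧ MvPolynomial.eval (x ∘ f) H = 0 := by
  set Q := P ^ 2 with hQ
  set E := ∑ i : ι, (MvPolynomial.pderiv (Sum.inr i) Q).totalDegree with hE
  set m := 2 * E + 1 with hm
  let g (i : ι) : MvPolynomial (τ ⊕ ι) ℝ :=
    MvPolynomial.C (-((m : ℝ) + 1)⁻¹) * MvPolynomial.pderiv (Sum.inr i) Q
  have hg (i : ι) : (g i).totalDegree < m := by
    have h₁ := MvPolynomial.totalDegree_mul (MvPolynomial.C (-((m : ℝ) + 1)⁻¹))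
      (MvPolynomial.pderiv (Sum.inr i) Q)
    rw [MvPolynomial.totalDegree_C] at h₁
    have h₂ : (MvPolynomial.pderiv (Sum.inr i) Q).totalDegree ≤ E :=
      Finset.single_le_sum (f := fun i : ι ↦ (MvPolynomial.pderiv (Sum.inr i) Q).totalDegree)
        (fun _ _ ↦ Nat.zero_le _) (Finset.mem_univ i)
    change (MvPolynomial.C (-((m : ℝ) + 1)⁻¹) * MvPolynomial.pderiv (Sum.inr i) Q).totalDegree < m
    omega
  let Z := {z : ℝ × (τ → ℝ) × (ι → ℝ) //
    ∀ i, z.2.2 i ^ m = z.1 * MvPolynomial.eval (Sum.elim z.2.1 z.2.2) (g i)}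
  have hdep := not_algebraicIndependent_of_pow_eq (k := ℝ) (A := Z → ℝ) hcard
    (fun z ↦ z.1.1) (fun t z ↦ z.1.2.1 t) (fun i z ↦ z.1.2.2 i) f m g hg fun i ↦ by
      ext z
      refine (z.2 i).trans (congrArg (z.1.1 * ·) ((MvPolynomial.aeval_pi_apply _ _ _).trans
        (congrArg (MvPolynomial.eval · (g i)) (funext ?_))).symm)
      rintro (_ | _) <;> rfl
  rw [algebraicIndependent_iff] at hdep
  push Not at hdep
  obtain ⟨H₀, hH₀, hne⟩ := hdep
  refine ⟨(MvPolynomial.optionEquivLeft ℝ σ H₀).leadingCoeff, by simpa using hne, ?_⟩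
  rintro y ⟨x₀, hx₀⟩
  have hev : Even (m + 1) := ⟨E + 1, by omega⟩
  have hQ₀ : MvPolynomial.eval (Sum.elim y x₀) Q = 0 := by simp [hQ, hx₀]
  have hQnn (x) : 0 ≤ MvPolynomial.eval (Sum.elim y x) Q := by
    rw [hQ, map_pow]
    positivity
  have hQc : Continuous fun x ↦ MvPolynomial.eval (Sum.elim y x) Q :=
    (MvPolynomial.continuous_eval Q).comp
      (continuous_pi fun s ↦ by cases s <;> simp <;> fun_prop)
  have hε (k : ℕ) : (0 : ℝ) < ((k : ℝ) + 1)⁻¹ := by positivity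
  choose x hx using fun k : ℕ ↦
    exists_forall_add_mul_sum_pow_le hQc hQnn hQ₀ (hε k) hev m.succ_ne_zero
  have hle (k : ℕ) := hx k x₀
  simp only [hQ₀, zero_add] at hle
  have hmem (k : ℕ) : x k ∈ {x : ι → ℝ | ∑ i, x i ^ (m + 1) ≤ ∑ i, x₀ i ^ (m + 1)} :=
    le_of_mul_le_mul_left (by linarith [hle k, hQnn (x k)]) (hε k)
  obtain ⟨x', -, φ, hφ, hlim⟩ :=
    (isCompact_sum_pow_le hev m.succ_ne_zero _).tendsto_subseq hmem
  refine ⟨x', ?_, ?_⟩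
  · have hQ' : MvPolynomial.eval (Sum.elim y x') Q ≤ 0 := by
      refine le_of_tendsto_of_tendsto' ((hQc.tendsto x').comp hlim)
        (g := fun k ↦ ((φ k : ℝ) + 1)⁻¹ * ∑ i, x₀ i ^ (m + 1)) ?_ fun k ↦ ?_
      · rw [← zero_mul (∑ i, x₀ i ^ (m + 1))]
        refine Tendsto.mul_const _ (tendsto_inv_atTop_zero.comp ?_)
        exact tendsto_atTop_add_const_right _ _
          (tendsto_natCast_atTop_atTop.comp hφ.tendsto_atTop)
      · have : 0 ≤ ((φ k : ℝ) + 1)⁻¹ * ∑ i, x (φ k) i ^ (m + 1) :=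
          mul_nonneg (hε _).le (Finset.sum_nonneg fun i _ ↦ hev.pow_nonneg _)
        simp only [Function.comp_apply]
        linarith [hle (φ k)]
    have := le_antisymm hQ' (hQnn x')
    simpa [hQ] using this
  · refine eval_leadingCoeff_eq_zero_of_tendsto _ (s := fun k ↦ x (φ k) ∘ f)
      (δ := fun k ↦ (φ k : ℝ) + 1) ?_ (tendsto_atTop_add_const_right _ _
        (tendsto_natCast_atTop_atTop.comp hφ.tendsto_atTop)) fun k ↦ ?_
    · exact ((by fun_prop : Continuous fun x : ι → ℝ ↦ x ∘ f).tendsto x').comp hlim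
    · rw [← MvPolynomial.optionEquivLeft_elim_eval]
      have hz : ∀ i, x (φ k) i ^ m =
          ((φ k : ℝ) + 1) * MvPolynomial.eval (Sum.elim y (x (φ k))) (g i) := fun i ↦ by
        have := MvPolynomial.pow_eq_of_forall_add_mul_sum_pow_le Q y (hε _) m (hx (φ k)) i
        rwa [inv_inv] at this
      have := congr_fun hH₀ ⟨((φ k : ℝ) + 1, y, x (φ k)), hz⟩
      rw [MvPolynomial.aeval_pi_apply, Pi.zero_apply] at this
      rw [← this]
      congr 2
      ext o
      cases o <;> rfl

/-- A nonzero polynomial has no zero on some sphere. -/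
theorem exists_sphere_avoiding {σ : Type*} [Fintype σ] {H : MvPolynomial σ ℝ} (hH : H ≠ 0) :
    ∃ c : σ → ℝ, ∃ r > 0, ∀ x, ∑ i, (x i - c i) ^ 2 = r ^ 2 → MvPolynomial.eval x H ≠ 0 := by
  obtain ⟨c, hc⟩ : ∃ c, MvPolynomial.eval c H ≠ 0 := by
    by_contra! h
    exact hH (MvPolynomial.funext fun x ↦ by simpa using h x)
  obtain ⟨r, hr, hball⟩ := Metric.eventually_nhds_iff_ball.1
    ((MvPolynomial.continuous_eval H).continuousAt.eventually_ne hc)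
  refine ⟨c, r / 2, half_pos hr, fun x hx ↦ hball x ?_⟩
  rw [Metric.mem_ball, dist_pi_lt_iff hr]
  intro i
  have : (x i - c i) ^ 2 ≤ (r / 2) ^ 2 := hx ▸
    Finset.single_le_sum (f := fun i ↦ (x i - c i) ^ 2) (fun _ _ ↦ sq_nonneg _) (Finset.mem_univ i)
  rw [Real.dist_eq]
  exact (abs_le_of_sq_le_sq this (half_pos hr).le).trans_lt (half_lt_self hr)

theorem not_isPreconnected_compl_sphere {σ : Type*} [Fintype σ] [Nonempty σ] (c : σ → ℝ) {r : ℝ}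
    (hr : 0 < r) : ¬ IsPreconnected {x : σ → ℝ | ∑ i, (x i - c i) ^ 2 ≠ r ^ 2} := by
  intro h
  have hc : Continuous fun x : σ → ℝ ↦ ∑ i, (x i - c i) ^ 2 := by fun_prop
  obtain ⟨i⟩ := ‹Nonempty σ›
  obtain ⟨x, -, hx, hx'⟩ := h {x | ∑ i, (x i - c i) ^ 2 < r ^ 2} {x | r ^ 2 < ∑ i, (x i - c i) ^ 2}
    (isOpen_lt hc continuous_const) (isOpen_lt continuous_const hc) (fun x hx ↦ lt_or_gt_of_ne hx)
    ⟨c, by simpa using (pow_pos hr 2).ne, by simpa using pow_pos hr 2⟩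
    (by
      have hlt : r ^ 2 < ∑ j, ((fun j ↦ c j + 2 * r) j - c j) ^ 2 := by
        refine lt_of_lt_of_le ?_ (Finset.single_le_sum
          (f := fun j ↦ ((fun j ↦ c j + 2 * r) j - c j) ^ 2) (fun _ _ ↦ sq_nonneg _)
          (Finset.mem_univ i))
        simp only [add_sub_cancel_left]
        nlinarith
      exact ⟨fun j ↦ c j + 2 * r, hlt.ne', hlt⟩)
  exact lt_asymm (mem_ofPred.1 hx) hx'

/-- A set is projection-algebraic if it is the image of a real algebraic set under a coordinate
projection forgetting finitely many coordinates. -/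
def IsProjAlgebraic {σ : Type} (T : Set (σ → ℝ)) : Prop :=
  ∃ (κ : Type) (_ : Fintype κ) (P : MvPolynomial (σ ⊕ κ) ℝ),
    T = {y | ∃ z, MvPolynomial.eval (Sum.elim y z) P = 0}

namespace IsProjAlgebraic

variable {σ τ : Type} {T U : Set (σ → ℝ)}

theorem zeroLocus (p : MvPolynomial σ ℝ) : IsProjAlgebraic {x | MvPolynomial.eval x p = 0} := by
  refine ⟨Empty, inferInstance, MvPolynomial.rename Sum.inl p, ?_⟩
  ext x
  simp [MvPolynomial.eval_rename]

theorem positivityLocus (p : MvPolynomial σ ℝ) :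
    IsProjAlgebraic {x | 0 < MvPolynomial.eval x p} := by
  refine ⟨Unit, inferInstance,
    MvPolynomial.rename Sum.inl p * MvPolynomial.X (Sum.inr ()) ^ 2 - 1, ?_⟩
  ext x
  simp only [mem_ofPred, map_sub, map_mul, map_pow, map_one, MvPolynomial.eval_rename,
    Sum.elim_comp_inl, MvPolynomial.eval_X, Sum.elim_inr, sub_eq_zero]
  constructor
  · intro h
    refine ⟨fun _ ↦ (√(MvPolynomial.eval x p))⁻¹, ?_⟩
    rw [inv_pow, Real.sq_sqrt h.le, mul_inv_cancel₀ h.ne']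
  · rintro ⟨z, hz⟩
    by_contra! h
    nlinarith [sq_nonneg (z ())]

theorem inter (hT : IsProjAlgebraic T) (hU : IsProjAlgebraic U) : IsProjAlgebraic (T ∩ U) := by
  obtain ⟨κ, _, P, rfl⟩ := hT
  obtain ⟨κ', _, P', rfl⟩ := hU
  refine ⟨κ ⊕ κ', inferInstance, MvPolynomial.rename (Sum.map id Sum.inl) P ^ 2 +
    MvPolynomial.rename (Sum.map id Sum.inr) P' ^ 2, ?_⟩
  ext y
  simp only [mem_inter_iff, mem_ofPred, map_add, map_pow, MvPolynomial.eval_rename,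
    Sum.elim_comp_map, Function.comp_id]
  constructor
  · rintro ⟨⟨z, hz⟩, z', hz'⟩
    exact ⟨Sum.elim z z', by simp [hz, hz']⟩
  · rintro ⟨z, hz⟩
    rw [add_eq_zero_iff_of_nonneg (sq_nonneg _) (sq_nonneg _), sq_eq_zero_iff, sq_eq_zero_iff] at hz
    exact ⟨⟨_, hz.1⟩, _, hz.2⟩

theorem union (hT : IsProjAlgebraic T) (hU : IsProjAlgebraic U) : IsProjAlgebraic (T ∪ U) := by
  obtain ⟨κ, _, P, rfl⟩ := hT
  obtain ⟨κ', _, P', rfl⟩ := hU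
  refine ⟨κ ⊕ κ', inferInstance, MvPolynomial.rename (Sum.map id Sum.inl) P *
    MvPolynomial.rename (Sum.map id Sum.inr) P', ?_⟩
  ext y
  simp only [mem_union, mem_ofPred, map_mul, MvPolynomial.eval_rename,
    Sum.elim_comp_map, Function.comp_id, mul_eq_zero]
  constructor
  · rintro (⟨z, hz⟩ | ⟨z, hz⟩)
    · exact ⟨Sum.elim z 0, .inl hz⟩
    · exact ⟨Sum.elim 0 z, .inr hz⟩
  · rintro ⟨z, hz | hz⟩
    · exact .inl ⟨_, hz⟩
    · exact .inr ⟨_, hz⟩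

theorem univ : IsProjAlgebraic (univ : Set (σ → ℝ)) := by
  simpa using zeroLocus (0 : MvPolynomial σ ℝ)

theorem empty : IsProjAlgebraic (∅ : Set (σ → ℝ)) := by
  simpa using zeroLocus (1 : MvPolynomial σ ℝ)

theorem biInter {α : Type*} (s : Finset α) {F : α → Set (σ → ℝ)}
    (h : ∀ a ∈ s, IsProjAlgebraic (F a)) : IsProjAlgebraic (⋂ a ∈ s, F a) := by
  classical
  induction s using Finset.induction_on with
  | empty => simpa using univ
  | insert a s _ ih =>
    rw [Finset.set_biInter_insert]
    exact (h a (by simp)).inter (ih fun b hb ↦ h b (by simp [hb]))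

theorem biUnion {α : Type*} (s : Finset α) {F : α → Set (σ → ℝ)}
    (h : ∀ a ∈ s, IsProjAlgebraic (F a)) : IsProjAlgebraic (⋃ a ∈ s, F a) := by
  classical
  induction s using Finset.induction_on with
  | empty => simpa using empty
  | insert a s _ ih =>
    rw [Finset.set_biUnion_insert]
    exact (h a (by simp)).union (ih fun b hb ↦ h b (by simp [hb]))

theorem of_isSemialgebraic {n : ℕ} {A : Set (Fin n → ℝ)} (hA : IsSemialgebraic A) :
    IsProjAlgebraic A := by
  obtain ⟨N, E, I, rfl⟩ := hA
  have h := biUnion Finset.univ fun m (_ : m ∈ Finset.univ) ↦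
    (biInter (E m) fun p _ ↦ zeroLocus p).inter (biInter (I m) fun p _ ↦ positivityLocus p)
  convert h using 1
  ext x
  simp

theorem preimage_comp (f : σ → τ) (hT : IsProjAlgebraic T) :
    IsProjAlgebraic {x : τ → ℝ | (fun i ↦ x (f i)) ∈ T} := by
  obtain ⟨κ, _, P, rfl⟩ := hT
  refine ⟨κ, inferInstance, MvPolynomial.rename (Sum.map f id) P, ?_⟩
  ext x
  simp only [mem_ofPred, MvPolynomial.eval_rename, Sum.elim_comp_map, Function.comp_id]
  rfl

theorem exists_sumElim [Fintype τ] {V : Set (σ ⊕ τ → ℝ)} (hV : IsProjAlgebraic V) :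
    IsProjAlgebraic {y | ∃ x, Sum.elim y x ∈ V} := by
  obtain ⟨κ, _, P, rfl⟩ := hV
  refine ⟨τ ⊕ κ, inferInstance, MvPolynomial.rename (Equiv.sumAssoc σ τ κ) P, ?_⟩
  ext y
  have key (x : τ → ℝ) (z : κ → ℝ) :
      Sum.elim y (Sum.elim x z) ∘ Equiv.sumAssoc σ τ κ = Sum.elim (Sum.elim y x) z := by
    ext ((_ | _) | _) <;> rfl
  simp only [mem_ofPred, MvPolynomial.eval_rename]
  constructor
  · rintro ⟨x, z, hz⟩
    exact ⟨Sum.elim x z, by rwa [key]⟩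
  · rintro ⟨w, hw⟩
    refine ⟨w ∘ Sum.inl, w ∘ Sum.inr, ?_⟩
    rwa [← key, Sum.elim_comp_inl_inr]

theorem setOf_forall_apply_eq {α : Type*} [Fintype α] (f g : α → σ) :
    IsProjAlgebraic {x : σ → ℝ | ∀ a, x (f a) = x (g a)} := by
  have h := biInter Finset.univ fun a (_ : a ∈ Finset.univ) ↦
    zeroLocus (MvPolynomial.X (f a) - MvPolynomial.X (g a) : MvPolynomial σ ℝ)
  convert h using 1
  ext x
  simp [sub_eq_zero]

theorem image_comp [Fintype σ] [Fintype τ] (f : τ → σ) (hT : IsProjAlgebraic T) :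
    IsProjAlgebraic ((fun (x : σ → ℝ) i ↦ x (f i)) '' T) := by
  have h := exists_sumElim ((setOf_forall_apply_eq (fun i : τ ↦ Sum.inl i)
    (fun i ↦ Sum.inr (f i))).inter (hT.preimage_comp (Sum.inr : σ → τ ⊕ σ)))
  convert h using 1
  ext y
  simp [funext_iff, and_comm, eq_comm]

end IsProjAlgebraic

namespace RAE

variable {n : ℕ}

theorem exists_isProjAlgebraic_of_varCount_eq_zero {k : ℕ} (e : RAE n k) (hpos : e.Positive)
    (h₀ : e.varCount = 0) : ∃ T, IsProjAlgebraic T ∧ ∀ S, e.eval S = T := by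
  induction e with
  | var => simp [varCount] at h₀
  | const C hC => exact ⟨C, .of_isSemialgebraic hC, fun S ↦ rfl⟩
  | union e₁ e₂ ih₁ ih₂ =>
    simp only [varCount, Nat.add_eq_zero_iff] at h₀
    obtain ⟨T₁, hT₁, h₁⟩ := ih₁ hpos.1 h₀.1
    obtain ⟨T₂, hT₂, h₂⟩ := ih₂ hpos.2 h₀.2
    exact ⟨_, hT₁.union hT₂, fun S ↦ by rw [eval, h₁, h₂]⟩
  | inter e₁ e₂ ih₁ ih₂ =>
    simp only [varCount, Nat.add_eq_zero_iff] at h₀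
    obtain ⟨T₁, hT₁, h₁⟩ := ih₁ hpos.1 h₀.1
    obtain ⟨T₂, hT₂, h₂⟩ := ih₂ hpos.2 h₀.2
    exact ⟨_, hT₁.inter hT₂, fun S ↦ by rw [eval, h₁, h₂]⟩
  | diff e₁ e₂ => exact hpos.elim
  | prod e₁ e₂ ih₁ ih₂ =>
    simp only [varCount, Nat.add_eq_zero_iff] at h₀
    obtain ⟨T₁, hT₁, h₁⟩ := ih₁ hpos.1 h₀.1
    obtain ⟨T₂, hT₂, h₂⟩ := ih₂ hpos.2 h₀.2
    exact ⟨_, (hT₁.preimage_comp _).inter (hT₂.preimage_comp _),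
      fun S ↦ by rw [eval, h₁, h₂]; rfl⟩
  | proj p idx e ih =>
    obtain ⟨T, hT, h⟩ := ih hpos h₀
    exact ⟨_, hT.image_comp idx, fun S ↦ by rw [eval, h]⟩

/-- Normal form of positive one-pass expressions: `S` enters through a single relation `R`. -/
theorem exists_normalForm {k : ℕ} (e : RAE n k) (hpos : e.Positive) (hone : e.varCount = 1) :
    ∃ (L : Set (Fin k → ℝ)) (R : Set (Fin k ⊕ Fin n → ℝ)), IsProjAlgebraic R ∧
      ∀ S y, y ∈ e.eval S ↔ y ∈ L ∨ ∃ s ∈ S, Sum.elim y s ∈ R := by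
  induction e with
  | var =>
    refine ⟨∅, _, .setOf_forall_apply_eq Sum.inl Sum.inr, fun S y ↦ ?_⟩
    simp only [eval, mem_empty_iff_false, false_or, mem_ofPred, Sum.elim_inl, Sum.elim_inr]
    exact ⟨fun h ↦ ⟨y, h, fun _ ↦ rfl⟩, fun ⟨s, hs, h⟩ ↦ funext h ▸ hs⟩
  | const C hC => simp [varCount] at hone
  | union e₁ e₂ ih₁ ih₂ =>
    rcases Nat.add_eq_one_iff.1 hone with ⟨h₁, h₂⟩ | ⟨h₁, h₂⟩
    · obtain ⟨T, hT, hT'⟩ := exists_isProjAlgebraic_of_varCount_eq_zero e₁ hpos.1 h₁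
      obtain ⟨L, R, hR, h⟩ := ih₂ hpos.2 h₂
      exact ⟨T ∪ L, R, hR, fun S y ↦ by rw [eval, mem_union, hT', h, mem_union, or_assoc]⟩
    · obtain ⟨T, hT, hT'⟩ := exists_isProjAlgebraic_of_varCount_eq_zero e₂ hpos.2 h₂
      obtain ⟨L, R, hR, h⟩ := ih₁ hpos.1 h₁
      exact ⟨L ∪ T, R, hR, fun S y ↦ by rw [eval, mem_union, hT', h, mem_union, or_right_comm]⟩
  | inter e₁ e₂ ih₁ ih₂ =>
    rcases Nat.add_eq_one_iff.1 hone with ⟨h₁, h₂⟩ | ⟨h₁, h₂⟩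
    · obtain ⟨T, hT, hT'⟩ := exists_isProjAlgebraic_of_varCount_eq_zero e₁ hpos.1 h₁
      obtain ⟨L, R, hR, h⟩ := ih₂ hpos.2 h₂
      refine ⟨L ∩ T, _, hR.inter (hT.preimage_comp Sum.inl), fun S y ↦ ?_⟩
      rw [eval, mem_inter_iff, hT', h]
      simp
      tauto
    · obtain ⟨T, hT, hT'⟩ := exists_isProjAlgebraic_of_varCount_eq_zero e₂ hpos.2 h₂
      obtain ⟨L, R, hR, h⟩ := ih₁ hpos.1 h₁
      refine ⟨L ∩ T, _, hR.inter (hT.preimage_comp Sum.inl), fun S y ↦ ?_⟩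
      rw [eval, mem_inter_iff, hT', h]
      simp
      tauto
  | diff e₁ e₂ => exact hpos.elim
  | @prod k₁ k₂ e₁ e₂ ih₁ ih₂ =>
    have key {a : Type} (c : a → Fin (k₁ + k₂)) (y : Fin (k₁ + k₂) → ℝ) (s : Fin n → ℝ) :
        (fun i ↦ Sum.elim y s (Sum.map c id i)) = Sum.elim (fun i ↦ y (c i)) s := by
      ext (_ | _) <;> rfl
    rcases Nat.add_eq_one_iff.1 hone with ⟨h₁, h₂⟩ | ⟨h₁, h₂⟩
    · obtain ⟨T, hT, hT'⟩ := exists_isProjAlgebraic_of_varCount_eq_zero e₁ hpos.1 h₁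
      obtain ⟨L, R, hR, h⟩ := ih₂ hpos.2 h₂
      refine ⟨{y | (fun i ↦ y (Fin.castAdd _ i)) ∈ T ∧ (fun i ↦ y (Fin.natAdd _ i)) ∈ L}, _,
        (hR.preimage_comp (Sum.map (Fin.natAdd k₁) id)).inter
          (hT.preimage_comp fun i ↦ Sum.inl (Fin.castAdd k₂ i)), fun S y ↦ ?_⟩
      simp only [eval, hT', h, mem_ofPred, mem_inter_iff, key, Sum.elim_inl]
      constructor
      · rintro ⟨hT₀, hL | ⟨s, hs, hr⟩⟩
        exacts [.inl ⟨hT₀, hL⟩, .inr ⟨s, hs, hr, hT₀⟩]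
      · rintro (⟨hT₀, hL⟩ | ⟨s, hs, hr, hT₀⟩)
        exacts [⟨hT₀, .inl hL⟩, ⟨hT₀, .inr ⟨s, hs, hr⟩⟩]
    · obtain ⟨T, hT, hT'⟩ := exists_isProjAlgebraic_of_varCount_eq_zero e₂ hpos.2 h₂
      obtain ⟨L, R, hR, h⟩ := ih₁ hpos.1 h₁
      refine ⟨{y | (fun i ↦ y (Fin.castAdd _ i)) ∈ L ∧ (fun i ↦ y (Fin.natAdd _ i)) ∈ T}, _,
        (hR.preimage_comp (Sum.map (Fin.castAdd k₂) id)).inter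
          (hT.preimage_comp fun i ↦ Sum.inl (Fin.natAdd k₁ i)), fun S y ↦ ?_⟩
      simp only [eval, hT', h, mem_ofPred, mem_inter_iff, key, Sum.elim_inl]
      tauto
  | @proj k p idx e ih =>
    obtain ⟨L, R, hR, h⟩ := ih hpos hone
    refine ⟨(fun x i ↦ x (idx i)) '' L, (fun (x : Fin k ⊕ Fin n → ℝ) i ↦ x (Sum.map idx id i)) '' R,
      hR.image_comp _, fun S y ↦ ?_⟩
    simp only [eval, mem_image, h]
    constructor
    · rintro ⟨x, hx | ⟨s, hs, hx⟩, rfl⟩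
      · exact .inl ⟨x, hx, rfl⟩
      · exact .inr ⟨s, hs, _, hx, by ext (_ | _) <;> rfl⟩
    · rintro (⟨x, hx, rfl⟩ | ⟨s, hs, x, hx, hxy⟩)
      · exact ⟨x, .inl hx, rfl⟩
      · refine ⟨x ∘ Sum.inl, .inr ⟨s, hs, ?_⟩, funext fun i ↦ congr_fun hxy (Sum.inl i)⟩
        rwa [show s = x ∘ Sum.inr from funext fun i ↦ (congr_fun hxy (Sum.inr i)).symm,
          Sum.elim_comp_inl_inr]

/-- For a positive one-pass expression of arity smaller than that of `S`, removing from `ℝⁿ` a set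
disjoint from a suitable hypersurface does not change the value. -/
theorem exists_hypersurface_eval_compl_eq {k : ℕ} (hkn : k < n) (e : RAE n k) (hpos : e.Positive)
    (hone : e.varCount = 1) : ∃ H : MvPolynomial (Fin n) ℝ, H ≠ 0 ∧ ∀ X : Set (Fin n → ℝ),
      (∀ x ∈ X, MvPolynomial.eval x H ≠ 0) → e.eval Xᶜ = e.eval univ := by
  obtain ⟨L, R, ⟨κ, _, P, rfl⟩, h⟩ := e.exists_normalForm hpos hone
  have hassoc (y : Fin k → ℝ) (x : Fin n ⊕ κ → ℝ) :
      MvPolynomial.eval (Sum.elim y x)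
          (MvPolynomial.rename (Equiv.sumAssoc (Fin k) (Fin n) κ) P) =
        MvPolynomial.eval (Sum.elim (Sum.elim y (x ∘ Sum.inl)) (x ∘ Sum.inr)) P := by
    rw [MvPolynomial.eval_rename]
    congr 1
    congr 1
    ext ((_ | _) | _) <;> rfl
  obtain ⟨H, hH, hmeet⟩ := exists_hypersurface_meeting_fibers (by simpa using hkn)
    (MvPolynomial.rename (Equiv.sumAssoc (Fin k) (Fin n) κ) P) (Sum.inl : Fin n → Fin n ⊕ κ)
  refine ⟨H, hH, fun X hX ↦ Set.ext fun y ↦ ?_⟩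
  rw [h, h]
  refine or_congr_right ⟨fun ⟨s, _, hs⟩ ↦ ⟨s, mem_univ s, hs⟩, fun ⟨s, _, z, hz⟩ ↦ ?_⟩
  obtain ⟨x, hx, hxH⟩ := hmeet y ⟨Sum.elim s z, by
    rwa [hassoc, Sum.elim_comp_inl, Sum.elim_comp_inr]⟩
  exact ⟨x ∘ Sum.inl, fun hmem ↦ hX _ hmem hxH, x ∘ Sum.inr, by rwa [← hassoc]⟩

end RAE

theorem IsSemialgebraic.univ {n : ℕ} : IsSemialgebraic (univ : Set (Fin n → ℝ)) :=
  ⟨1, fun _ ↦ ∅, fun _ ↦ ∅, by simp [iUnion_const]⟩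

theorem IsSemialgebraic.setOf_eval_ne_zero {n : ℕ} (p : MvPolynomial (Fin n) ℝ) :
    IsSemialgebraic {x | MvPolynomial.eval x p ≠ 0} := by
  refine ⟨2, fun _ ↦ ∅, ![{p}, {-p}], ?_⟩
  ext x
  simp [Fin.exists_fin_two, eq_comm]

theorem stmt19 (ℓ : ℕ) (e : Fin ℓ → RAE 3 2)
    (hpos : ∀ i, (e i).Positive) (hone : ∀ i, (e i).varCount = 1) :
    ∃ A B : Set (Fin 3 → ℝ), IsSemialgebraic A ∧ IsSemialgebraic B ∧
      IsConnected A ∧ ¬ IsPreconnected B ∧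
      ∀ i, (e i).eval A = (e i).eval B := by
  choose H hH hcompl using fun i ↦
    (e i).exists_hypersurface_eval_compl_eq (by norm_num) (hpos i) (hone i)
  obtain ⟨c, r, hr, hcr⟩ :=
    exists_sphere_avoiding (Finset.prod_ne_zero_iff.2 fun i (_ : i ∈ Finset.univ) ↦ hH i)
  refine ⟨univ, {x | ∑ i, (x i - c i) ^ 2 ≠ r ^ 2}, .univ, ?_, isConnected_univ,
    not_isPreconnected_compl_sphere c hr, fun i ↦ ?_⟩
  · convert IsSemialgebraic.setOf_eval_ne_zero
      (∑ i, (MvPolynomial.X i - MvPolynomial.C (c i)) ^ 2 - MvPolynomial.C (r ^ 2)) using 3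
    simp [sub_eq_zero]
  · refine (hcompl i {x | ∑ i, (x i - c i) ^ 2 = r ^ 2} fun x hx ↦ ?_).symm
    have hprod := hcr x hx
    rw [map_prod] at hprod
    exact Finset.prod_ne_zero_iff.1 hprod i (Finset.mem_univ i)
end
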